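/- arXiv:1211.2463 — 3 statements merged into one kernel-verified Lean document; each statement's English description precedes it below -/
import Mathlib

section
/- Let 1 < α < 5. Near the origin the Lane-Emden enthalpy profile w is real-analytic: w coincides on some interval [0, ε) with a convergent power series in r. Moreover, there exists a constant b > 0 such that w(r) = 1 − b r² + O(r⁴) as r → 0⁺ (indeed w''(0) = −𝔠/3, so b = 𝔠/6), and all odd-order derivatives of w vanish at the origin: (∂_r^{2k+1} w)(0) = 0 for every integer k ≥ 0. -/
open MeasureTheory Real Filter Set Asymptotics

/-- Averaging a holomorphic function over dilations of the disc gives a holomorphic function. -/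
theorem differentiableOn_integral_dilation {φ : ℝ → ℂ} (hφ : Continuous φ) {h : ℂ → ℂ} {ε : ℝ}
    (hh : DifferentiableOn ℂ h (Metric.ball 0 ε)) :
    DifferentiableOn ℂ (fun z => ∫ u in (0 : ℝ)..1, φ u * h (u * z)) (Metric.ball 0 ε) := by
  intro z₀ hz₀
  obtain ⟨ρ, hzρ, hρε⟩ := exists_between (mem_ball_zero_iff.mp hz₀)
  have hmaps : ∀ u ∈ Icc (0 : ℝ) 1, ∀ z ∈ Metric.closedBall (0 : ℂ) ρ,
      (u : ℂ) * z ∈ Metric.closedBall (0 : ℂ) ρ := by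
    intro u hu z hz
    rw [mem_closedBall_zero_iff] at hz ⊢
    rw [norm_mul, Complex.norm_real, Real.norm_of_nonneg hu.1]
    nlinarith [hu.1, hu.2, norm_nonneg z]
  have hsub : Metric.closedBall (0 : ℂ) ρ ⊆ Metric.ball 0 ε := Metric.closedBall_subset_ball hρε
  have hderiv : ContinuousOn (deriv h) (Metric.ball 0 ε) :=
    (hh.deriv Metric.isOpen_ball).continuousOn
  have hpath : ∀ z ∈ Metric.closedBall (0 : ℂ) ρ, ∀ k : ℂ → ℂ,
      ContinuousOn k (Metric.ball 0 ε) → ContinuousOn (fun u : ℝ => k (u * z)) (Icc 0 1) :=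
    fun z hz k hk => hk.comp (by fun_prop) fun u hu => hsub (hmaps u hu z hz)
  obtain ⟨M, hM⟩ := (isCompact_closedBall (0 : ℂ) ρ).exists_bound_of_continuousOn
    (hderiv.mono hsub)
  have hz₀' : z₀ ∈ Metric.closedBall (0 : ℂ) ρ := mem_closedBall_zero_iff.mpr hzρ.le
  have hmeas : ∀ k : ℝ → ℂ, ContinuousOn k (Icc 0 1) →
      AEStronglyMeasurable k (volume.restrict (uIoc 0 1)) := fun k hk =>
    ((hk.mono Ioc_subset_Icc_self).aestronglyMeasurable measurableSet_Ioc).mono_measure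
      (by rw [uIoc_of_le zero_le_one])
  have hIoc : ∀ u ∈ uIoc (0 : ℝ) 1, u ∈ Icc (0 : ℝ) 1 := fun u hu => by
    rw [uIoc_of_le zero_le_one] at hu
    exact Ioc_subset_Icc_self hu
  have hnhds : Metric.closedBall (0 : ℂ) ρ ∈ nhds z₀ :=
    Filter.mem_of_superset (Metric.isOpen_ball.mem_nhds (mem_ball_zero_iff.mpr hzρ))
      Metric.ball_subset_closedBall
  have key := intervalIntegral.hasDerivAt_integral_of_dominated_loc_of_deriv_le
    (μ := volume) (a := 0) (b := 1) (F := fun (z : ℂ) (u : ℝ) => φ u * h (u * z))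
    (F' := fun (z : ℂ) (u : ℝ) => φ u * (deriv h (u * z) * u))
    (bound := fun u => ‖φ u‖ * M) hnhds
    (Filter.mem_of_superset hnhds fun z hz =>
      hmeas _ (hφ.continuousOn.mul (hpath z hz h hh.continuousOn)))
    (ContinuousOn.intervalIntegrable_of_Icc zero_le_one
      (hφ.continuousOn.mul (hpath z₀ hz₀' h hh.continuousOn)))
    (hmeas _ (hφ.continuousOn.mul ((hpath z₀ hz₀' _ hderiv).mul (by fun_prop))))
    (Eventually.of_forall fun u hu z hz => ?_)
    (Continuous.intervalIntegrable (by fun_prop) _ _)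
    (Eventually.of_forall fun u hu z hz => ?_)
  · exact key.2.differentiableAt.differentiableWithinAt
  · have hu' := hIoc u hu
    have h1 := hM _ (hmaps u hu' z hz)
    rw [norm_mul, norm_mul, Complex.norm_real, Real.norm_of_nonneg hu'.1]
    gcongr
    nlinarith [hu'.1, hu'.2, norm_nonneg (deriv h (u * z))]
  · have h1 : HasDerivAt h (deriv h (u * z)) (u * z) :=
      (hh.differentiableAt
        (Metric.isOpen_ball.mem_nhds (hsub (hmaps u (hIoc u hu) z hz)))).hasDerivAt
    have h2 : HasDerivAt (fun z : ℂ => (u : ℂ) * z) u z := by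
      simpa using (hasDerivAt_id z).const_mul (u : ℂ)
    exact (h1.comp z h2).const_mul (φ u)

/-- The Picard operator of the Lane-Emden equation `w'' + (2/r) w' + c F(w) = 0`, `w(0) = 1`. -/
noncomputable def laneEmdenPicard (F : ℂ → ℂ) (c : ℝ) (g : ℂ → ℂ) (z : ℂ) : ℂ :=
  1 - c * z ^ 2 * ∫ u in (0 : ℝ)..1, ((u * (1 - u) : ℝ) : ℂ) * F (g (u * z))

theorem norm_integral_weight_mul_le {k : ℝ → ℂ} {M : ℝ} (hk : ∀ u ∈ Icc (0 : ℝ) 1, ‖k u‖ ≤ M) :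
    ‖∫ u in (0 : ℝ)..1, ((u * (1 - u) : ℝ) : ℂ) * k u‖ ≤ M := by
  have h := intervalIntegral.norm_integral_le_of_norm_le_const (a := (0 : ℝ)) (b := 1) (C := M)
    (f := fun u : ℝ => ((u * (1 - u) : ℝ) : ℂ) * k u) ?_
  · simpa using h
  · intro u hu
    rw [uIoc_of_le zero_le_one] at hu
    have h1 := hk u (Ioc_subset_Icc_self hu)
    have h2 : 0 ≤ u * (1 - u) := mul_nonneg hu.1.le (by linarith [hu.2])
    rw [norm_mul, Complex.norm_real, Real.norm_of_nonneg h2]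
    nlinarith [norm_nonneg (k u), sq_nonneg u, hu.1, hu.2]

theorem norm_laneEmdenPicard_sub_one_le {F : ℂ → ℂ} {c M : ℝ} {g : ℂ → ℂ} {z : ℂ}
    (hc : 0 ≤ c) (h : ∀ u ∈ Icc (0 : ℝ) 1, ‖F (g (u * z))‖ ≤ M) :
    ‖laneEmdenPicard F c g z - 1‖ ≤ c * ‖z‖ ^ 2 * M := by
  have h1 := norm_integral_weight_mul_le h
  rw [laneEmdenPicard, sub_sub_cancel_left, norm_neg, norm_mul, norm_mul, norm_pow,
    Complex.norm_real, Real.norm_of_nonneg hc]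
  gcongr

theorem norm_laneEmdenPicard_sub_le {F : ℂ → ℂ} {c D : ℝ} {K : NNReal} {s : Set ℂ}
    (hF : LipschitzOnWith K F s) {f g : ℂ → ℂ} {z : ℂ} (hc : 0 ≤ c)
    (hfc : ContinuousOn (fun u : ℝ => f (u * z)) (Icc 0 1))
    (hgc : ContinuousOn (fun u : ℝ => g (u * z)) (Icc 0 1))
    (hf : ∀ u ∈ Icc (0 : ℝ) 1, f (u * z) ∈ s) (hg : ∀ u ∈ Icc (0 : ℝ) 1, g (u * z) ∈ s)
    (hfg : ∀ u ∈ Icc (0 : ℝ) 1, ‖f (u * z) - g (u * z)‖ ≤ D) :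
    ‖laneEmdenPicard F c f z - laneEmdenPicard F c g z‖ ≤ c * ‖z‖ ^ 2 * (K * D) := by
  have hintegrable : ∀ k : ℂ → ℂ, ContinuousOn (fun u : ℝ => k (u * z)) (Icc 0 1) →
      (∀ u ∈ Icc (0 : ℝ) 1, k (u * z) ∈ s) →
      IntervalIntegrable (fun u : ℝ => ((u * (1 - u) : ℝ) : ℂ) * F (k (u * z))) volume 0 1 :=
    fun k hk hks => ContinuousOn.intervalIntegrable_of_Icc zero_le_one
      (ContinuousOn.mul (by fun_prop) (hF.continuousOn.comp hk hks))
  have h1 : laneEmdenPicard F c f z - laneEmdenPicard F c g z =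
      -(c * z ^ 2 * ∫ u in (0 : ℝ)..1,
        ((u * (1 - u) : ℝ) : ℂ) * (F (f (u * z)) - F (g (u * z)))) := by
    simp only [mul_sub (Complex.ofReal _)]
    rw [intervalIntegral.integral_sub (hintegrable f hfc hf) (hintegrable g hgc hg), laneEmdenPicard,
      laneEmdenPicard]
    ring
  have h2 := norm_integral_weight_mul_le (M := K * D)
    (k := fun u : ℝ => F (f (u * z)) - F (g (u * z))) fun u hu =>
      (hF.norm_sub_le (hf u hu) (hg u hu)).trans
        (mul_le_mul_of_nonneg_left (hfg u hu) K.coe_nonneg)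
  rw [h1, norm_neg, norm_mul, norm_mul, norm_pow, Complex.norm_real, Real.norm_of_nonneg hc]
  gcongr

theorem DifferentiableOn.laneEmdenPicard {F : ℂ → ℂ} {c ε : ℝ} {s : Set ℂ} {g : ℂ → ℂ}
    (hF : ∀ z ∈ s, DifferentiableAt ℂ F z) (hg : DifferentiableOn ℂ g (Metric.ball 0 ε))
    (hgs : MapsTo g (Metric.ball 0 ε) s) :
    DifferentiableOn ℂ (laneEmdenPicard F c g) (Metric.ball 0 ε) := by
  have h1 : DifferentiableOn ℂ (fun z => F (g z)) (Metric.ball 0 ε) := fun z hz =>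
    (hF _ (hgs hz)).comp_differentiableWithinAt z (hg z hz)
  have h2 := differentiableOn_integral_dilation
    (φ := fun u => ((u * (1 - u) : ℝ) : ℂ)) (by fun_prop) h1
  unfold _root_.laneEmdenPicard
  exact (differentiableOn_const _).sub (DifferentiableOn.mul (by fun_prop) h2)

/-- On a small disc the Picard iteration converges to an even holomorphic function, which agrees
with every fixed point of the Picard operator on the positive real axis. -/
theorem exists_even_holomorphic_eq_of_laneEmdenPicard {F : ℂ → ℂ} {c ε δ M : ℝ} {K : NNReal}
    (hc : 0 ≤ c) (hδ : 0 ≤ δ)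
    (hF : ∀ z ∈ Metric.closedBall (1 : ℂ) δ, DifferentiableAt ℂ F z)
    (hFK : LipschitzOnWith K F (Metric.closedBall 1 δ))
    (hFM : ∀ z ∈ Metric.closedBall (1 : ℂ) δ, ‖F z‖ ≤ M)
    (hεM : c * ε ^ 2 * M ≤ δ) (hεK : c * ε ^ 2 * K ≤ 1 / 2)
    {w : ℝ → ℂ} (hwc : ContinuousOn w (Ico 0 ε))
    (hw : ∀ r ∈ Ico 0 ε, w r ∈ Metric.closedBall (1 : ℂ) δ)
    (hfix : ∀ r ∈ Ico 0 ε, laneEmdenPicard F c (fun z => w z.re) r = w r) :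
    ∃ g : ℂ → ℂ, DifferentiableOn ℂ g (Metric.ball 0 ε) ∧ (∀ z, g (-z) = g z) ∧
      ∀ r ∈ Ico 0 ε, g r = w r := by
  set G : ℕ → ℂ → ℂ := fun n => (laneEmdenPicard F c)^[n] fun _ => 1 with hG
  have hG0 : G 0 = fun _ => 1 := rfl
  have hGs : ∀ n, G (n + 1) = laneEmdenPicard F c (G n) := fun n =>
    Function.iterate_succ_apply' _ _ _
  have hM : 0 ≤ M := (norm_nonneg _).trans (hFM 1 (Metric.mem_closedBall_self hδ))
  have hseg : ∀ z ∈ Metric.ball (0 : ℂ) ε, ∀ u ∈ Icc (0 : ℝ) 1,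
      (u : ℂ) * z ∈ Metric.ball (0 : ℂ) ε := by
    intro z hz u hu
    rw [mem_ball_zero_iff] at hz ⊢
    rw [norm_mul, Complex.norm_real, Real.norm_of_nonneg hu.1]
    nlinarith [hu.1, hu.2, norm_nonneg z]
  have hsq : ∀ z ∈ Metric.ball (0 : ℂ) ε, ‖z‖ ^ 2 ≤ ε ^ 2 := fun z hz =>
    pow_le_pow_left₀ (norm_nonneg z) (mem_ball_zero_iff.mp hz).le 2
  have hmaps : ∀ n, MapsTo (G n) (Metric.ball 0 ε) (Metric.closedBall 1 δ) := by
    intro n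
    induction n with
    | zero => exact fun z _ => Metric.mem_closedBall_self hδ
    | succ n ih =>
      intro z hz
      rw [hGs, mem_closedBall_iff_norm]
      refine (norm_laneEmdenPicard_sub_one_le hc fun u hu =>
        hFM _ (ih (hseg z hz u hu))).trans (le_trans ?_ hεM)
      gcongr ?_ * M
      exact mul_le_mul_of_nonneg_left (hsq z hz) hc
  have hdiff : ∀ n, DifferentiableOn ℂ (G n) (Metric.ball 0 ε) := by
    intro n
    induction n with
    | zero => exact differentiableOn_const _
    | succ n ih => rw [hGs]; exact ih.laneEmdenPicard hF (hmaps n)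
  have heven : ∀ n z, G n (-z) = G n z := by
    intro n
    induction n with
    | zero => exact fun z => rfl
    | succ n ih =>
      intro z
      rw [hGs]
      simp only [laneEmdenPicard, mul_neg, ih, even_two.neg_pow]
  have hcont : ∀ n, ∀ z ∈ Metric.ball (0 : ℂ) ε,
      ContinuousOn (fun u : ℝ => G n (u * z)) (Icc 0 1) := fun n z hz =>
    (hdiff n).continuousOn.comp (by fun_prop) (hseg z hz)
  have hhalf : ∀ z ∈ Metric.ball (0 : ℂ) ε, ∀ n : ℕ,
      c * ‖z‖ ^ 2 * (K * (δ * (1 / 2) ^ n)) ≤ δ * (1 / 2) ^ (n + 1) := by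
    intro z hz n
    have h1 : c * ‖z‖ ^ 2 * K ≤ 1 / 2 := by
      refine le_trans ?_ hεK
      gcongr ?_ * _
      exact mul_le_mul_of_nonneg_left (hsq z hz) hc
    have h2 : 0 ≤ δ * (1 / 2 : ℝ) ^ n := by positivity
    calc c * ‖z‖ ^ 2 * (K * (δ * (1 / 2) ^ n))
        = c * ‖z‖ ^ 2 * K * (δ * (1 / 2) ^ n) := by ring
      _ ≤ 1 / 2 * (δ * (1 / 2) ^ n) := by gcongr
      _ = δ * (1 / 2) ^ (n + 1) := by ring
  have hstep : ∀ n, ∀ z ∈ Metric.ball (0 : ℂ) ε, ‖G (n + 1) z - G n z‖ ≤ δ * (1 / 2) ^ n := by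
    intro n
    induction n with
    | zero =>
      intro z hz
      have := hmaps 1 hz
      rw [mem_closedBall_iff_norm] at this
      simpa [hG0] using this
    | succ n ih =>
      intro z hz
      rw [hGs (n + 1)]
      nth_rewrite 2 [hGs n]
      exact (norm_laneEmdenPicard_sub_le hFK hc (hcont _ z hz) (hcont _ z hz)
        (fun u hu => hmaps _ (hseg z hz u hu)) (fun u hu => hmaps _ (hseg z hz u hu))
        fun u hu => ih _ (hseg z hz u hu)).trans (hhalf z hz n)
  have hball : ∀ r ∈ Ico 0 ε, (r : ℂ) ∈ Metric.ball (0 : ℂ) ε := fun r hr => by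
    rw [mem_ball_zero_iff, Complex.norm_real, Real.norm_of_nonneg hr.1]
    exact hr.2
  have hsegR : ∀ r ∈ Ico 0 ε, ∀ u ∈ Icc (0 : ℝ) 1, u * r ∈ Ico 0 ε := fun r hr u hu =>
    ⟨mul_nonneg hu.1 hr.1, by nlinarith [hu.1, hu.2, hr.1, hr.2]⟩
  have hre : ∀ u r : ℝ, ((u : ℂ) * r).re = u * r := fun u r => by
    rw [← Complex.ofReal_mul, Complex.ofReal_re]
  have happrox : ∀ n, ∀ r ∈ Ico 0 ε, ‖G n r - w r‖ ≤ δ * (1 / 2) ^ n := by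
    intro n
    induction n with
    | zero =>
      intro r hr
      have := hw r hr
      rw [mem_closedBall_iff_norm, norm_sub_rev] at this
      simpa [hG0] using this
    | succ n ih =>
      intro r hr
      rw [hGs n, ← hfix r hr]
      refine (norm_laneEmdenPicard_sub_le hFK hc (hcont _ _ (hball r hr)) ?_
        (fun u hu => hmaps _ (hseg _ (hball r hr) u hu)) ?_ ?_).trans (hhalf _ (hball r hr) n)
      · simp only [hre]
        exact hwc.comp (by fun_prop) (hsegR r hr)
      · intro u hu
        simp only [hre]
        exact hw _ (hsegR r hr u hu)
      · intro u hu
        simp only [hre]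
        rw [← Complex.ofReal_mul]
        exact ih _ (hsegR r hr u hu)
  have hsum : Summable fun n : ℕ => δ * (1 / 2 : ℝ) ^ n :=
    (summable_geometric_of_lt_one (by norm_num) (by norm_num)).mul_left δ
  refine ⟨fun z => 1 + ∑' n, (G (n + 1) z - G n z), ?_, ?_, ?_⟩
  · exact (differentiableOn_const _).add
      (Complex.differentiableOn_tsum_of_summable_norm hsum
        (fun n => (hdiff (n + 1)).sub (hdiff n)) Metric.isOpen_ball hstep)
  · intro z
    simp only [heven]
  · intro r hr
    have h1 : Summable fun n => G (n + 1) r - G n r :=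
      Summable.of_norm_bounded hsum fun n => hstep n r (hball r hr)
    have h2 := h1.hasSum.tendsto_sum_nat
    simp only [Finset.sum_range_sub (fun n => G n (r : ℂ))] at h2
    have h3 : Tendsto (fun n => G n r) atTop (nhds (w r)) := by
      rw [tendsto_iff_norm_sub_tendsto_zero]
      exact squeeze_zero (fun _ => norm_nonneg _) (fun n => happrox n r hr)
        hsum.tendsto_atTop_zero
    have h4 := tendsto_nhds_unique h2 (h3.sub_const (G 0 r))
    change 1 + ∑' n, (G (n + 1) (r : ℂ) - G n r) = w r
    rw [h4, hG0]
    ring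
/-- Odd derivatives at `0` vanish for a function agreeing with an even analytic function on the
right of `0`, whatever its values on the left. -/
theorem iteratedDeriv_odd_eq_zero_of_eqOn_even {f G : ℝ → ℝ} {ε : ℝ} (hε : 0 < ε)
    (hG : AnalyticAt ℝ G 0) (heven : ∀ x, G (-x) = G x) (hfG : EqOn f G (Ioo 0 ε)) (k : ℕ) :
    iteratedDeriv (2 * k + 1) f 0 = 0 := by
  have hGodd : iteratedDeriv (2 * k + 1) G 0 = 0 := by
    have h := iteratedDeriv_comp_neg (2 * k + 1) G 0
    simp only [heven, (odd_two_mul_add_one k).neg_one_pow, neg_zero, neg_smul, one_smul] at h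
    linarith
  rw [iteratedDeriv_succ] at hGodd ⊢
  by_cases hf : DifferentiableAt ℝ (iteratedDeriv (2 * k) f) 0
  · have hGd : DifferentiableAt ℝ (iteratedDeriv (2 * k) G) 0 := by
      rw [iteratedDeriv_eq_iterate]
      exact (hG.iterated_deriv _).differentiableAt
    have heq : iteratedDeriv (2 * k) f =ᶠ[nhdsWithin 0 (Ioi 0)] iteratedDeriv (2 * k) G := by
      filter_upwards [Ioo_mem_nhdsGT hε] with x hx
      exact Filter.EventuallyEq.iteratedDeriv_eq _
        (Filter.mem_of_superset (isOpen_Ioo.mem_nhds hx) hfG)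
    have h0 : iteratedDeriv (2 * k) f 0 = iteratedDeriv (2 * k) G 0 :=
      tendsto_nhds_unique
        ((hf.continuousAt.tendsto.mono_left nhdsWithin_le_nhds).congr' heq)
        (hGd.continuousAt.tendsto.mono_left nhdsWithin_le_nhds)
    have h1 := (hGd.hasDerivAt.hasDerivWithinAt (s := Ioi 0)).congr_of_eventuallyEq heq h0
    refine Eq.trans ?_ hGodd
    exact UniqueDiffWithinAt.eq_deriv _ (uniqueDiffWithinAt_Ioi 0) hf.hasDerivAt.hasDerivWithinAt h1
  · exact deriv_zero_of_not_differentiableAt hf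

/-- A Lane-Emden profile which is `C²` up to the origin solves the integral equation. -/
theorem laneEmden_integral_eq {α c R : ℝ} (hα : 0 ≤ α) {w : ℝ → ℝ}
    (hw : ContDiffOn ℝ 2 w (Ico 0 R)) (hw0 : w 0 = 1)
    (hode : ∀ r, 0 < r → r < R →
      deriv (deriv w) r + (2 / r) * deriv w r + c * w r ^ α = 0)
    {r : ℝ} (hr : r ∈ Ico 0 R) :
    w r = 1 - c * r ^ 2 * ∫ u in (0 : ℝ)..1, u * (1 - u) * w (u * r) ^ α := by
  rcases hr.1.eq_or_lt with rfl | hr0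
  · simp [hw0]
  have hsub : Icc 0 r ⊆ Ico 0 R := fun t ht => ⟨ht.1, ht.2.trans_lt hr.2⟩
  have hunique : UniqueDiffOn ℝ (Ico 0 R) := uniqueDiffOn_Ico 0 R
  set w₁ := derivWithin w (Ico 0 R)
  have hw₁ : ContinuousOn w₁ (Icc 0 r) :=
    (hw.continuousOn_derivWithin hunique (by norm_num)).mono hsub
  have hwc : ContinuousOn w (Icc 0 r) := hw.continuousOn.mono hsub
  have hwα : ContinuousOn (fun t => w t ^ α) (Icc 0 r) :=
    hwc.rpow_const fun _ _ => Or.inr hα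
  have hintegrable : ContinuousOn (fun t => -c * ((t - t ^ 2 / r) * w t ^ α)) (Icc 0 r) := by fun_prop
  have hderiv : ∀ t ∈ Ioo 0 r, HasDerivAt (fun t => (t - t ^ 2 / r) * w₁ t + w t)
      (-c * ((t - t ^ 2 / r) * w t ^ α)) t := by
    intro t ht
    have htR : t ∈ Ioo 0 R := ⟨ht.1, ht.2.trans hr.2⟩
    have hnear : Ico 0 R ∈ nhds t := Ico_mem_nhds htR.1 htR.2
    have heq : w₁ =ᶠ[nhds t] deriv w := by
      filter_upwards [isOpen_Ioo.mem_nhds htR] with x hx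
      exact derivWithin_of_mem_nhds (Ico_mem_nhds hx.1 hx.2)
    have h2 : ContDiffAt ℝ 2 w t := hw.contDiffAt hnear
    have hd1 : HasDerivAt w (deriv w t) t := (h2.differentiableAt (by norm_num)).hasDerivAt
    have hd2 : HasDerivAt w₁ (deriv (deriv w) t) t :=
      ((((hw.mono Ioo_subset_Ico_self).deriv_of_isOpen (m := 1) isOpen_Ioo
        (by norm_num)).differentiableOn (by norm_num)).differentiableAt
        (isOpen_Ioo.mem_nhds htR)).hasDerivAt.congr_of_eventuallyEq heq
    have hk : HasDerivAt (fun t : ℝ => t - t ^ 2 / r) (1 - 2 * t / r) t := by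
      simpa using (hasDerivAt_id' t).fun_sub ((hasDerivAt_pow 2 t).div_const r)
    refine ((hk.mul hd2).add hd1).congr_deriv ?_
    have h := hode t htR.1 htR.2
    rw [heq.self_of_nhds]
    have h3 : deriv (deriv w) t = -(2 / t) * deriv w t - c * w t ^ α := by linarith
    rw [h3]
    have := ht.1.ne'
    have := hr0.ne'
    field_simp
    ring
  have hftc := intervalIntegral.integral_eq_sub_of_hasDerivAt_of_le hr0.le
    (by fun_prop) hderiv (hintegrable.intervalIntegrable_of_Icc hr0.le)
  have hsubst := intervalIntegral.mul_integral_comp_mul_left (a := 0) (b := 1) (c := r)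
    (f := fun t => -c * ((t - t ^ 2 / r) * w t ^ α))
  rw [mul_zero, mul_one, hftc, ← intervalIntegral.integral_const_mul] at hsubst
  have hscale : ∀ u : ℝ, r * (-c * ((r * u - (r * u) ^ 2 / r) * w (r * u) ^ α)) =
      -(c * r ^ 2) * (u * (1 - u) * w (u * r) ^ α) := by
    intro u
    rw [mul_comm u r]
    have := hr0.ne'
    field_simp
  simp only [hscale] at hsubst
  rw [intervalIntegral.integral_const_mul] at hsubst
  have hrr : r - r ^ 2 / r = 0 := by
    have := hr0.ne'
    field_simp
    ring
  simp only [hrr, hw0] at hsubst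
  norm_num at hsubst
  linarith

theorem laneEmdenPicard_ofReal {α c : ℝ} {w : ℝ → ℝ} {r : ℝ}
    (hw : ∀ u ∈ Icc (0 : ℝ) 1, 0 ≤ w (u * r)) :
    laneEmdenPicard (fun z => z ^ (α : ℂ)) c (fun z => (w z.re : ℂ)) r =
      ((1 - c * r ^ 2 * ∫ u in (0 : ℝ)..1, u * (1 - u) * w (u * r) ^ α : ℝ) : ℂ) := by
  have h : ∫ u in (0 : ℝ)..1, ((u * (1 - u) : ℝ) : ℂ) * ((w ((u : ℂ) * r).re : ℂ) ^ (α : ℂ)) =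
      ((∫ u in (0 : ℝ)..1, u * (1 - u) * w (u * r) ^ α : ℝ) : ℂ) := by
    rw [← intervalIntegral.integral_ofReal]
    refine intervalIntegral.integral_congr fun u hu => ?_
    rw [uIcc_of_le zero_le_one] at hu
    simp only [← Complex.ofReal_mul, Complex.ofReal_re]
    rw [← Complex.ofReal_cpow (hw u hu), ← Complex.ofReal_mul]
  rw [laneEmdenPicard, h]
  push_cast
  rfl

theorem laneEmdenPicard_const_one {F : ℂ → ℂ} (hF : F 1 = 1) (c : ℝ) (z : ℂ) :
    laneEmdenPicard F c (fun _ => 1) z = 1 - c / 6 * z ^ 2 := by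
  have h : ∫ u in (0 : ℝ)..1, ((u * (1 - u) : ℝ) : ℂ) = 1 / 6 := by
    rw [intervalIntegral.integral_ofReal]
    have h1 : ∫ u in (0 : ℝ)..1, u * (1 - u) = 1 / 6 := by
      simp only [mul_sub, mul_one, ← pow_two]
      rw [intervalIntegral.integral_sub (by simp) (by simp)]
      simp
      norm_num
    rw [h1]
    norm_num
  simp only [laneEmdenPicard, hF, mul_one, h]
  ring

/-- Near `1` the power `z ↦ z ^ a` is holomorphic, Lipschitz and bounded. -/
theorem exists_closedBall_cpow_bounds (a : ℂ) :
    ∃ δ > 0, ∃ K : NNReal, ∃ M : ℝ,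
      (∀ z ∈ Metric.closedBall (1 : ℂ) δ, DifferentiableAt ℂ (fun z => z ^ a) z) ∧
      LipschitzOnWith K (fun z : ℂ => z ^ a) (Metric.closedBall 1 δ) ∧
      ∀ z ∈ Metric.closedBall (1 : ℂ) δ, ‖z ^ a‖ ≤ M := by
  have hd : ∀ z ∈ Complex.slitPlane, DifferentiableAt ℂ (fun z : ℂ => z ^ a) z := fun z hz =>
    differentiableAt_id.cpow_const hz
  have hdOn : DifferentiableOn ℂ (fun z : ℂ => z ^ a) Complex.slitPlane := fun z hz =>
    (hd z hz).differentiableWithinAt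
  have hC : ContDiffAt ℂ 1 (fun z : ℂ => z ^ a) 1 :=
    (hdOn.analyticAt
      (Complex.isOpen_slitPlane.mem_nhds Complex.one_mem_slitPlane)).contDiffAt
  obtain ⟨K, t, ht, hK⟩ := hC.exists_lipschitzOnWith
  obtain ⟨δ, hδ, hsub⟩ := Metric.nhds_basis_closedBall.mem_iff.mp
    (Filter.inter_mem ht (Complex.isOpen_slitPlane.mem_nhds Complex.one_mem_slitPlane))
  have hL := hK.mono (hsub.trans inter_subset_left)
  obtain ⟨M, hM⟩ := (isCompact_closedBall (1 : ℂ) δ).exists_bound_of_continuousOn hL.continuousOn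
  exact ⟨δ, hδ, K, M, fun z hz => hd z (hsub hz).2, hL, hM⟩

/-- Near the origin the Lane-Emden enthalpy profile `w` is real-analytic:
it coincides on `[0, ε)` with a convergent power series; moreover `w(r) = 1 - b r² + O(r⁴)`
with `b = 𝔠/6 > 0`, and all odd-order derivatives of `w` vanish at the origin. -/
theorem laneEmden_analytic_origin
    (α c R : ℝ) (hα : 1 < α) (hα' : α < 5) (hc : 0 < c) (hR : 0 < R)
    (w : ℝ → ℝ)
    (hw_cont : ContinuousOn w (Set.Icc 0 R))
    (hw_smooth : ContDiffOn ℝ (⊤ : ℕ∞) w (Set.Ico 0 R))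
    (hw0 : w 0 = 1) (hw'0 : deriv w 0 = 0)
    (hw_pos : ∀ r, 0 ≤ r → r < R → 0 < w r)
    (hwR : w R = 0)
    (hw_dec : ∀ r, 0 < r → r < R → deriv w r < 0)
    (hw_pv : ∃ w'R : ℝ, w'R < 0 ∧
      Filter.Tendsto (deriv w) (nhdsWithin R (Set.Iio R)) (nhds w'R))
    (hw_ode : ∀ r, 0 < r → r < R →
      deriv (deriv w) r + (2 / r) * deriv w r + c * w r ^ α = 0) :
    (∃ ε > (0:ℝ), ∃ a : ℕ → ℝ, ∀ r ∈ Set.Ico (0:ℝ) ε,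
        HasSum (fun n => a n * r ^ n) (w r)) ∧
    (∃ b : ℝ, 0 < b ∧ b = c / 6 ∧
        (fun r => w r - (1 - b * r ^ 2)) =O[nhdsWithin 0 (Set.Ioi 0)]
          (fun r => r ^ 4)) ∧
    (∀ k : ℕ, iteratedDeriv (2 * k + 1) w 0 = 0) := by
  obtain ⟨δ, hδ, K, M, hFd, hFK, hFM⟩ := exists_closedBall_cpow_bounds (α : ℂ)
  obtain ⟨η, hη, hwη⟩ := Metric.continuousWithinAt_iff.mp
    (hw_smooth.continuousOn 0 ⟨le_rfl, hR⟩) δ hδ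
  have hsmall : ∀ B d : ℝ, 0 < d → ∀ᶠ ε in nhdsWithin (0 : ℝ) (Ioi 0), c * ε ^ 2 * B ≤ d := by
    intro B d hd
    have h : Tendsto (fun ε : ℝ => c * ε ^ 2 * B) (nhds 0) (nhds (c * 0 ^ 2 * B)) :=
      Continuous.tendsto (by fun_prop) 0
    exact (h.mono_left nhdsWithin_le_nhds).eventually_le_const (by simpa using hd)
  obtain ⟨ε, ⟨⟨hεM, hεK⟩, hεη⟩, hε⟩ := ((((hsmall M δ hδ).and
    (hsmall K (1 / 2) (by norm_num))).and
    (nhdsWithin_le_nhds (Iio_mem_nhds (lt_min hη hR)))).and self_mem_nhdsWithin).exists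
  have hεη' : ε < η := hεη.trans_le (min_le_left _ _)
  have hεR : ε < R := hεη.trans_le (min_le_right _ _)
  have hε0 : 0 < ε := hε
  have hball : ∀ r ∈ Ico 0 ε, (w r : ℂ) ∈ Metric.closedBall (1 : ℂ) δ := by
    intro r hr
    have h := hwη (x := r) ⟨hr.1, hr.2.trans hεR⟩
      (by rw [Real.dist_eq, sub_zero, abs_of_nonneg hr.1]; exact hr.2.trans hεη')
    rw [hw0, Real.dist_eq] at h
    rw [mem_closedBall_iff_norm, ← Complex.ofReal_one, ← Complex.ofReal_sub, Complex.norm_real]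
    exact h.le
  have hseg : ∀ r ∈ Ico 0 ε, ∀ u ∈ Icc (0 : ℝ) 1, u * r ∈ Ico 0 ε := fun r hr u hu =>
    ⟨mul_nonneg hu.1 hr.1, by nlinarith [hu.1, hu.2, hr.1, hr.2]⟩
  have hre : ∀ u r : ℝ, ((u : ℂ) * r).re = u * r := fun u r => by
    rw [← Complex.ofReal_mul, Complex.ofReal_re]
  have hwc : ContinuousOn (fun r => (w r : ℂ)) (Ico 0 ε) :=
    Complex.continuous_ofReal.comp_continuousOn
      (hw_smooth.continuousOn.mono (Ico_subset_Ico_right hεR.le))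
  have hfix : ∀ r ∈ Ico 0 ε,
      laneEmdenPicard (fun z => z ^ (α : ℂ)) c (fun z => (w z.re : ℂ)) r = w r := by
    intro r hr
    rw [laneEmdenPicard_ofReal fun u hu =>
        (hw_pos _ (hseg r hr u hu).1 ((hseg r hr u hu).2.trans hεR)).le,
      ← laneEmden_integral_eq (by linarith) (contDiffOn_infty.mp hw_smooth 2) hw0
        hw_ode ⟨hr.1, hr.2.trans hεR⟩]
  obtain ⟨g, hgd, hgeven, hgw⟩ := exists_even_holomorphic_eq_of_laneEmdenPicard hc.le hδ.le hFd
    hFK hFM hεM hεK hwc hball hfix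
  have hG : AnalyticAt ℝ (fun x : ℝ => (g x).re) 0 := by
    refine AnalyticAt.re_ofReal ?_
    exact hgd.analyticAt (Metric.isOpen_ball.mem_nhds (by simpa using hε0))
  have hGw : ∀ r ∈ Ico 0 ε, w r = (g r).re := fun r hr => by rw [hgw r hr, Complex.ofReal_re]
  refine ⟨?_, ⟨c / 6, by positivity, rfl, ?_⟩, ?_⟩
  · obtain ⟨p, hp⟩ := hG
    obtain ⟨ρ, hρ, hsum⟩ := Metric.eventually_nhds_iff.mp (hasFPowerSeriesAt_iff.mp hp)
    refine ⟨min ρ ε, lt_min hρ hε0, p.coeff, fun r hr => ?_⟩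
    have h := hsum (y := r) (by
      rw [Real.dist_eq, sub_zero, abs_of_nonneg hr.1]
      exact hr.2.trans_le (min_le_left _ _))
    rw [zero_add, ← hGw r ⟨hr.1, hr.2.trans_le (min_le_right _ _)⟩] at h
    simpa only [smul_eq_mul, mul_comm] using h
  · refine IsBigO.of_bound (c * (K * (c * M))) ?_
    filter_upwards [Ioo_mem_nhdsGT hε0] with r hr
    have hrI : r ∈ Ico 0 ε := ⟨hr.1.le, hr.2⟩
    have hnorm : ∀ x : ℝ, ‖(x : ℂ)‖ ^ 2 = x ^ 2 := fun x => by
      rw [Complex.norm_real, Real.norm_eq_abs, sq_abs]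
    have hM0 : 0 ≤ M := (norm_nonneg _).trans (hFM 1 (Metric.mem_closedBall_self hδ.le))
    have hquad : ∀ x ∈ Ico 0 ε, ‖(w x : ℂ) - 1‖ ≤ c * x ^ 2 * M := by
      intro x hx
      rw [← hfix x hx, ← hnorm]
      refine norm_laneEmdenPicard_sub_one_le hc.le fun u hu => ?_
      rw [hre]
      exact hFM _ (hball _ (hseg x hx u hu))
    have hmain := norm_laneEmdenPicard_sub_le hFK (f := fun z => (w z.re : ℂ))
      (g := fun _ => 1) (z := r) (D := c * r ^ 2 * M) hc.le
      (by simp only [hre]; exact hwc.comp (by fun_prop) (hseg r hrI)) (by fun_prop)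
      (fun u hu => by rw [hre]; exact hball _ (hseg r hrI u hu))
      (fun u hu => Metric.mem_closedBall_self hδ.le)
      (fun u hu => by
        rw [hre]
        refine (hquad _ (hseg r hrI u hu)).trans ?_
        gcongr ?_ * M
        refine mul_le_mul_of_nonneg_left (pow_le_pow_left₀ (hseg r hrI u hu).1 ?_ 2) hc.le
        nlinarith [hu.2, hr.1])
    rw [hfix r hrI, laneEmdenPicard_const_one (by simp), hnorm] at hmain
    have hcast : (w r : ℂ) - (1 - c / 6 * (r : ℂ) ^ 2) =
        ((w r - (1 - c / 6 * r ^ 2) : ℝ) : ℂ) := by push_cast; rfl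
    rw [hcast, Complex.norm_real] at hmain
    refine hmain.trans_eq ?_
    rw [Real.norm_of_nonneg (by positivity : 0 ≤ r ^ 4)]
    ring
  · exact iteratedDeriv_odd_eq_zero_of_eqOn_even hε0 hG
      (fun x => by rw [Complex.ofReal_neg, hgeven]) fun r hr => hGw r ⟨hr.1.le, hr.2⟩
end

section
/- Let 3 < α < 5 and let w be a Lane-Emden enthalpy profile. Then the variational value μ₀ := sup{ Q(φ) : φ weakly differentiable on (0,R), ‖φ‖ < ∞, I(φ) = 1 } is finite and strictly positive, and it is attained: there exists a weakly differentiable function φ₀ : (0,R) → ℝ with ‖φ₀‖ < ∞, I(φ₀) = 1 and Q(φ₀) = μ₀. -/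
open MeasureTheory Real Filter Set

/-- The quadratic form `Q(φ)` of the linearized Euler-Poisson operator. -/
noncomputable def Qfun (α R : ℝ) (w φ : ℝ → ℝ) : ℝ :=
  -((1 + α) / α) * (∫ r in Set.Ioo 0 R, w r ^ (1 + α) * r ^ 4 * (deriv φ r) ^ 2)
    - (4 - 3 * (1 + α) / α) *
      (∫ r in Set.Ioo 0 R, deriv (fun s => w s ^ (1 + α)) r * r ^ 3 * (φ r) ^ 2)

/-- The weighted `L²` normalization `I(φ)`. -/
noncomputable def Ifun (α R : ℝ) (w φ : ℝ → ℝ) : ℝ :=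
  ∫ r in Set.Ioo 0 R, w r ^ α * r ^ 4 * (φ r) ^ 2

/-- Finiteness of the norm `‖φ‖² = ∫ w^{1+α} r⁴ φ'² − ∫ (w^{1+α})' r³ φ² + ∫ w^α r⁴ φ²`. -/
def FiniteNorm (α R : ℝ) (w φ : ℝ → ℝ) : Prop :=
  MeasureTheory.IntegrableOn (fun r => w r ^ (1 + α) * r ^ 4 * (deriv φ r) ^ 2)
      (Set.Ioo 0 R) ∧
  MeasureTheory.IntegrableOn (fun r => deriv (fun s => w s ^ (1 + α)) r * r ^ 3 * (φ r) ^ 2)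
      (Set.Ioo 0 R) ∧
  MeasureTheory.IntegrableOn (fun r => w r ^ α * r ^ 4 * (φ r) ^ 2) (Set.Ioo 0 R)

/-- Continuous on `(0, R)` and bounded near `0`. -/
def TameOn (R : ℝ) (g : ℝ → ℝ) : Prop :=
  ContinuousOn g (Ioo 0 R) ∧ ∀ b ∈ Ioo 0 R, ∃ B, ∀ s ∈ Ioc 0 b, |g s| ≤ B

namespace TameOn

variable {R : ℝ} {f g : ℝ → ℝ}

theorem of_continuousOn_Ico (hg : ContinuousOn g (Ico 0 R)) : TameOn R g := by
  refine ⟨hg.mono Ioo_subset_Ico_self, fun b hb => ?_⟩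
  obtain ⟨B, hB⟩ := (isCompact_Icc (a := (0 : ℝ)) (b := b)).exists_bound_of_continuousOn
    (hg.mono fun s hs => ⟨hs.1, hs.2.trans_lt hb.2⟩)
  exact ⟨B, fun s hs => hB s ⟨hs.1.le, hs.2⟩⟩

theorem of_bound {B : ℝ} (hg : ContinuousOn g (Ioo 0 R)) (hB : ∀ s ∈ Ioo 0 R, |g s| ≤ B) :
    TameOn R g :=
  ⟨hg, fun _ hb => ⟨B, fun s hs => hB s ⟨hs.1, hs.2.trans_lt hb.2⟩⟩⟩

theorem mul (hf : TameOn R f) (hg : TameOn R g) : TameOn R fun s => f s * g s := by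
  refine ⟨hf.1.mul hg.1, fun b hb => ?_⟩
  obtain ⟨B, hB⟩ := hf.2 b hb
  obtain ⟨C, hC⟩ := hg.2 b hb
  refine ⟨B * C, fun s hs => ?_⟩
  rw [abs_mul]
  exact mul_le_mul (hB s hs) (hC s hs) (abs_nonneg _) ((abs_nonneg _).trans (hB s hs))

theorem intervalIntegrable (hg : TameOn R g) {b : ℝ} (hb : b ∈ Ico 0 R) :
    IntervalIntegrable g volume 0 b := by
  rcases hb.1.eq_or_lt with rfl | h0
  · exact IntervalIntegrable.refl
  rw [intervalIntegrable_iff_integrableOn_Ioo_of_le hb.1]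
  obtain ⟨B, hB⟩ := hg.2 b ⟨h0, hb.2⟩
  refine IntegrableOn.of_bound (by simp)
    ((hg.1.mono fun s hs => ⟨hs.1, hs.2.trans hb.2⟩).aestronglyMeasurable measurableSet_Ioo) B ?_
  exact (ae_restrict_mem measurableSet_Ioo).mono fun s hs => hB s ⟨hs.1, hs.2.le⟩

theorem hasDerivAt_primitive (hg : TameOn R g) {r : ℝ} (hr : r ∈ Ioo 0 R) :
    HasDerivAt (fun t => ∫ s in (0 : ℝ)..t, g s) (g r) r :=
  intervalIntegral.integral_hasDerivAt_right (hg.intervalIntegrable ⟨hr.1.le, hr.2⟩)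
    (hg.1.stronglyMeasurableAtFilter isOpen_Ioo r hr) (hg.1.continuousAt (isOpen_Ioo.mem_nhds hr))

theorem continuousOn_primitive (hg : TameOn R g) :
    ContinuousOn (fun t => ∫ s in (0 : ℝ)..t, g s) (Ico 0 R) := by
  intro r hr
  rcases hr.1.eq_or_lt with rfl | h0
  · have hb : R / 2 ∈ Ioo 0 R := ⟨by linarith [hr.2], by linarith [hr.2]⟩
    have h := intervalIntegral.continuousOn_primitive_interval'
      (hg.intervalIntegrable ⟨hb.1.le, hb.2⟩) left_mem_uIcc
    rw [uIcc_of_le hb.1.le] at h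
    refine (h 0 ⟨le_rfl, hb.1.le⟩).mono_of_mem_nhdsWithin ?_
    filter_upwards [self_mem_nhdsWithin, mem_nhdsWithin_of_mem_nhds (Iio_mem_nhds hb.1)]
      with s hs hs'
    exact ⟨hs.1, le_of_lt hs'⟩
  · exact (hg.hasDerivAt_primitive ⟨h0, hr.2⟩).continuousAt.continuousWithinAt

end TameOn

/-- Extension by zero of a function on `(0, R)`. -/
noncomputable def extendZero {R : ℝ} (u : BoundedContinuousFunction (Ioo 0 R) ℝ) (s : ℝ) : ℝ :=
  open Classical in if h : s ∈ Ioo 0 R then u ⟨s, h⟩ else 0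

section extendZero

variable {R : ℝ} (u v : BoundedContinuousFunction (Ioo 0 R) ℝ)

theorem extendZero_apply {s : ℝ} (h : s ∈ Ioo 0 R) : extendZero u s = u ⟨s, h⟩ := dif_pos h

theorem abs_extendZero_le (s : ℝ) : |extendZero u s| ≤ ‖u‖ := by
  unfold extendZero
  split_ifs with h
  · exact u.norm_coe_le_norm _
  · simp

theorem extendZero_add (s : ℝ) : extendZero (u + v) s = extendZero u s + extendZero v s := by
  unfold extendZero
  split_ifs <;> simp

theorem extendZero_sub (s : ℝ) : extendZero (u - v) s = extendZero u s - extendZero v s := by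
  unfold extendZero
  split_ifs <;> simp

theorem extendZero_smul (a : ℝ) (s : ℝ) : extendZero (a • u) s = a * extendZero u s := by
  unfold extendZero
  split_ifs <;> simp

theorem extendZero_mul (s : ℝ) : extendZero (u * v) s = extendZero u s * extendZero v s := by
  unfold extendZero
  split_ifs <;> simp

theorem tameOn_extendZero : TameOn R (extendZero u) := by
  refine TameOn.of_bound ?_ fun s _ => abs_extendZero_le u s
  rw [continuousOn_iff_continuous_domRestrict]
  convert u.continuous using 1
  ext s
  exact extendZero_apply u s.2

end extendZero

/-- Coefficients of a Sturm-Liouville problem on `(0, R)`, singular at both ends, with decreasing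
bounded potential `U`. -/
structure SingularSL (R M B C : ℝ) (p q U H : ℝ → ℝ) : Prop where
  R_pos : 0 < R
  p_cont : ContinuousOn p (Ioo 0 R)
  q_cont : ContinuousOn q (Ioo 0 R)
  U_cont : ContinuousOn U (Ioo 0 R)
  H_cont : ContinuousOn H (Ico 0 R)
  p_pos : ∀ r ∈ Ioo 0 R, 0 < p r
  q_pos : ∀ r ∈ Ioo 0 R, 0 < q r
  U_pos : ∀ r ∈ Ioo 0 R, 0 < U r
  H_nonneg : ∀ r ∈ Ico 0 R, 0 ≤ H r
  U_le : ∀ r ∈ Ioo 0 R, U r ≤ M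
  U_anti : AntitoneOn U (Ioo 0 R)
  q_le : ∀ r ∈ Ioo 0 R, q r ≤ B
  q_le_p : ∀ t ∈ Ioo 0 R, ∀ s ∈ Ioc 0 t, q s ≤ H t * p t
  p_le : ∀ r ∈ Ioo 0 R, p r ≤ C * (R - r)

namespace SingularSL

variable {R M B C : ℝ} {p q U H : ℝ → ℝ}

theorem tame_q (S : SingularSL R M B C p q U H) : TameOn R q :=
  .of_bound S.q_cont fun s hs => by rw [abs_of_pos (S.q_pos s hs)]; exact S.q_le s hs

theorem M_pos (S : SingularSL R M B C p q U H) : 0 < M := by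
  have h : R / 2 ∈ Ioo 0 R := ⟨by linarith [S.R_pos], by linarith [S.R_pos]⟩
  exact (S.U_pos _ h).trans_le (S.U_le _ h)

theorem abs_sub_le (S : SingularSL R M B C p q U H) {μ : ℝ} (hμ : μ ∈ Icc 0 (M + 1)) :
    ∀ r ∈ Ioo 0 R, |μ - U r| ≤ M + 1 := fun r hr => by
  have h1 := S.U_pos r hr
  have h2 := S.U_le r hr
  rw [abs_le]
  constructor <;> linarith [hμ.1, hμ.2]

/-- The shifted potentials as a continuous family of bounded continuous functions. -/
theorem exists_bcf (S : SingularSL R M B C p q U H) :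
    ∃ k : ℝ → BoundedContinuousFunction (Ioo 0 R) ℝ, Continuous k ∧ ∀ μ r, k μ r = μ - U r := by
  let k : ℝ → BoundedContinuousFunction (Ioo 0 R) ℝ := fun μ => .ofNormedAddCommGroup
    (fun r : Ioo 0 R => μ - U r) (continuousOn_iff_continuous_domRestrict.1
      (continuousOn_const.sub S.U_cont)) (|μ| + M) fun r => by
        refine (norm_sub_le _ _).trans (add_le_add le_rfl ?_)
        rw [Real.norm_of_nonneg (S.U_pos r r.2).le]
        exact S.U_le r r.2
  refine ⟨k, (LipschitzWith.mk_one fun μ ν => ?_).continuous, fun _ _ => rfl⟩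
  refine (BoundedContinuousFunction.dist_le dist_nonneg).2 fun r => ?_
  change dist (μ - U r) (ν - U r) ≤ _
  rw [dist_sub_right]

/-- The exponent of the weight that makes the Volterra operator small. -/
noncomputable def expo (H : ℝ → ℝ) (N r : ℝ) : ℝ := N * ∫ s in (0 : ℝ)..r, H s

theorem hasDerivAt_expo (S : SingularSL R M B C p q U H) (N : ℝ) {r : ℝ} (hr : r ∈ Ioo 0 R) :
    HasDerivAt (expo H N) (N * H r) r :=
  ((TameOn.of_continuousOn_Ico S.H_cont).hasDerivAt_primitive hr).const_mul N

theorem continuousOn_expo (S : SingularSL R M B C p q U H) (N : ℝ) :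
    ContinuousOn (expo H N) (Ico 0 R) :=
  (TameOn.of_continuousOn_Ico S.H_cont).continuousOn_primitive.const_smul N

theorem monotoneOn_expo (S : SingularSL R M B C p q U H) {N : ℝ} (hN : 0 ≤ N) :
    MonotoneOn (expo H N) (Ico 0 R) := by
  refine monotoneOn_of_deriv_nonneg (convex_Ico 0 R) (S.continuousOn_expo N) ?_ ?_ <;>
    rw [interior_Ico]
  · exact fun r hr => (S.hasDerivAt_expo N hr).differentiableAt.differentiableWithinAt
  · exact fun r hr => by
      rw [(S.hasDerivAt_expo N hr).deriv]
      exact mul_nonneg hN (S.H_nonneg r ⟨hr.1.le, hr.2⟩)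

theorem tame_exp (S : SingularSL R M B C p q U H) (N : ℝ) :
    TameOn R fun s => exp (expo H N s) :=
  .of_continuousOn_Ico (S.continuousOn_expo N).rexp

/-- The flux `∫₀ᵗ q e^Λ u`. -/
noncomputable def flux (q H : ℝ → ℝ) (N : ℝ) (u : BoundedContinuousFunction (Ioo 0 R) ℝ)
    (t : ℝ) : ℝ :=
  ∫ s in (0 : ℝ)..t, q s * exp (expo H N s) * extendZero u s

theorem tame_flux_integrand (S : SingularSL R M B C p q U H) (N : ℝ)
    (u : BoundedContinuousFunction (Ioo 0 R) ℝ) :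
    TameOn R fun s => q s * exp (expo H N s) * extendZero u s :=
  (S.tame_q.mul (S.tame_exp N)).mul (tameOn_extendZero u)

theorem abs_flux_div_le (S : SingularSL R M B C p q U H) {N : ℝ} (hN : 0 ≤ N)
    (u : BoundedContinuousFunction (Ioo 0 R) ℝ) {t : ℝ} (ht : t ∈ Ioo 0 R) :
    |flux q H N u t / p t| ≤ R * ‖u‖ * (H t * exp (expo H N t)) := by
  have hp := S.p_pos t ht
  have hH := S.H_nonneg t ⟨ht.1.le, ht.2⟩
  rw [abs_div, abs_of_pos hp, div_le_iff₀ hp]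
  have h := intervalIntegral.norm_integral_le_of_norm_le_const (a := 0) (b := t)
    (f := fun s => q s * exp (expo H N s) * extendZero u s)
    (C := H t * p t * exp (expo H N t) * ‖u‖) ?_
  · refine h.trans ?_
    rw [sub_zero, abs_of_pos ht.1]
    calc _ ≤ H t * p t * exp (expo H N t) * ‖u‖ * R := by gcongr; exact ht.2.le
      _ = _ := by ring
  · intro s hs
    rw [uIoc_of_le ht.1.le] at hs
    have hs' : s ∈ Ioo 0 R := ⟨hs.1, hs.2.trans_lt ht.2⟩
    rw [Real.norm_eq_abs, abs_mul, abs_mul, abs_of_pos (S.q_pos s hs'), abs_of_pos (exp_pos _)]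
    gcongr
    · exact S.q_le_p t ht s hs
    · exact S.monotoneOn_expo hN ⟨hs'.1.le, hs'.2⟩ ⟨ht.1.le, ht.2⟩ hs.2
    · exact abs_extendZero_le u s

theorem tame_flux_div (S : SingularSL R M B C p q U H) {N : ℝ} (hN : 0 ≤ N)
    (u : BoundedContinuousFunction (Ioo 0 R) ℝ) : TameOn R fun t => flux q H N u t / p t := by
  refine ⟨ContinuousOn.div
    ((S.tame_flux_integrand N u).continuousOn_primitive.mono Ioo_subset_Ico_self) S.p_cont
    fun r hr => (S.p_pos r hr).ne', fun b hb => ?_⟩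
  obtain ⟨D, hD⟩ := ((TameOn.of_continuousOn_Ico S.H_cont).mul (S.tame_exp N)).2 b hb
  refine ⟨R * ‖u‖ * D, fun s hs => (S.abs_flux_div_le hN u ⟨hs.1, hs.2.trans_lt hb.2⟩).trans ?_⟩
  have := S.R_pos
  gcongr
  exact (le_abs_self _).trans (hD s hs)

theorem abs_volterra_le (S : SingularSL R M B C p q U H) {N : ℝ} (hN : 0 < N)
    (u : BoundedContinuousFunction (Ioo 0 R) ℝ) {r : ℝ} (hr : r ∈ Ioo 0 R) :
    |exp (-expo H N r) * ∫ t in (0 : ℝ)..r, flux q H N u t / p t| ≤ R / N * ‖u‖ := by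
  have hR := S.R_pos
  have hr' : r ∈ Ico 0 R := ⟨hr.1.le, hr.2⟩
  have hi := ((TameOn.of_continuousOn_Ico S.H_cont).mul (S.tame_exp N)).intervalIntegrable hr'
  have h := intervalIntegral.norm_integral_le_of_norm_le hr.1.le
    (f := fun t => flux q H N u t / p t) (μ := volume)
    (.of_forall fun t ht => S.abs_flux_div_le hN.le u ⟨ht.1, ht.2.trans_lt hr.2⟩)
    (hi.const_mul (R * ‖u‖))
  have hftc : ∫ t in (0 : ℝ)..r, H t * exp (expo H N t) = exp (expo H N r) / N - 1 / N := by
    rw [intervalIntegral.integral_eq_sub_of_hasDerivAt_of_le hr.1.le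
      (f := fun t => exp (expo H N t) / N) _ _ hi]
    · simp [expo]
    · exact ((S.continuousOn_expo N).rexp.div_const N).mono
        fun s hs => ⟨hs.1, hs.2.trans_lt hr.2⟩
    · intro s hs
      refine ((S.hasDerivAt_expo N ⟨hs.1, hs.2.trans hr.2⟩).exp.div_const N).congr_deriv ?_
      rw [mul_left_comm, mul_div_cancel_left₀ _ hN.ne', mul_comm]
  rw [intervalIntegral.integral_const_mul, hftc, Real.norm_eq_abs] at h
  rw [abs_mul, abs_of_pos (exp_pos _), exp_neg, inv_mul_le_iff₀ (exp_pos _)]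
  refine h.trans ?_
  have : R * ‖u‖ * (exp (expo H N r) / N - 1 / N) =
    exp (expo H N r) * (R / N * ‖u‖) - R * ‖u‖ * (1 / N) := by ring
  rw [this]
  have : 0 ≤ R * ‖u‖ * (1 / N) := by positivity
  linarith

/-- The weighted Volterra operator `u ↦ e^{-Λ(r)} ∫₀ʳ p⁻¹ ∫₀ᵗ q e^Λ u`. -/
theorem exists_volterra (S : SingularSL R M B C p q U H) {N : ℝ} (hN : 0 < N) :
    ∃ J : BoundedContinuousFunction (Ioo 0 R) ℝ →L[ℝ] BoundedContinuousFunction (Ioo 0 R) ℝ,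
      ‖J‖ ≤ R / N ∧ ∀ u (r : Ioo 0 R),
        J u r = exp (-expo H N r) * ∫ t in (0 : ℝ)..r, flux q H N u t / p t := by
  have hR := S.R_pos
  refine ⟨LinearMap.mkContinuous
    { toFun := fun u => BoundedContinuousFunction.ofNormedAddCommGroup
        (fun r : Ioo 0 R => exp (-expo H N r) * ∫ t in (0 : ℝ)..r, flux q H N u t / p t)
        (continuousOn_iff_continuous_domRestrict.1
          (((S.continuousOn_expo N).neg.rexp.mul
            (S.tame_flux_div hN.le u).continuousOn_primitive).mono Ioo_subset_Ico_self))
        (R / N * ‖u‖) fun r => S.abs_volterra_le hN u r.2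
      map_add' := fun u v => ?_
      map_smul' := fun a u => ?_ } (R / N) fun u => ?_, ?_, fun u r => rfl⟩
  · ext r
    have hr : (r : ℝ) ∈ Ico 0 R := ⟨r.2.1.le, r.2.2⟩
    have hadd : ∫ t in (0 : ℝ)..r, flux q H N (u + v) t / p t =
        ∫ t in (0 : ℝ)..r, (flux q H N u t / p t + flux q H N v t / p t) := by
      refine intervalIntegral.integral_congr fun t ht => ?_
      rw [uIcc_of_le hr.1] at ht
      have ht' : t ∈ Ico 0 R := ⟨ht.1, ht.2.trans_lt hr.2⟩
      simp only [flux]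
      rw [← add_div, ← intervalIntegral.integral_add
        ((S.tame_flux_integrand N u).intervalIntegrable ht')
        ((S.tame_flux_integrand N v).intervalIntegrable ht')]
      simp only [extendZero_add, mul_add]
    rw [intervalIntegral.integral_add ((S.tame_flux_div hN.le u).intervalIntegrable hr)
      ((S.tame_flux_div hN.le v).intervalIntegrable hr)] at hadd
    change (_ : ℝ) * _ = _ * _ + _ * _
    rw [hadd, mul_add]
  · ext r
    have h : ∀ t, flux q H N (a • u) t / p t = a * (flux q H N u t / p t) := fun t => by
      simp only [flux, extendZero_smul]
      rw [← mul_div_assoc, ← intervalIntegral.integral_const_mul]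
      congr 2
      ext s
      ring
    change (_ : ℝ) * _ = a * (_ * _)
    simp only [h, intervalIntegral.integral_const_mul]
    ring
  · exact BoundedContinuousFunction.norm_ofNormedAddCommGroup_le
      (continuousOn_iff_continuous_domRestrict.1
          (((S.continuousOn_expo N).neg.rexp.mul
            (S.tame_flux_div hN.le u).continuousOn_primitive).mono Ioo_subset_Ico_self))
      (by positivity) fun r => S.abs_volterra_le hN u r.2
  · exact LinearMap.mkContinuous_norm_le _ (by positivity) _

end SingularSL

theorem exists_continuous_fixedPoint {X E : Type*} [TopologicalSpace X] [NormedAddCommGroup E]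
    [NormedSpace ℝ E] [CompleteSpace E] {K : X → E →L[ℝ] E} {s : Set X} (hK : Continuous K)
    (hs : ∀ x ∈ s, ‖K x‖ < 1) (f : E) :
    ∃ u : X → E, (∀ x ∈ s, u x = f + K x (u x)) ∧ ∀ x ∈ s, ContinuousAt u x := by
  refine ⟨fun x => Ring.inverse (1 - K x) f, fun x hx => ?_, fun x hx => ?_⟩
  · have hu : IsUnit (1 - K x) := ⟨Units.oneSub (K x) (hs x hx), rfl⟩
    have h : ((1 - K x) * Ring.inverse (1 - K x)) f = f := by
      rw [Ring.mul_inverse_cancel _ hu]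
      rfl
    exact sub_eq_iff_eq_add.1 h
  · have h : ContinuousAt (fun y => Ring.inverse (1 - K y)) x :=
      ContinuousAt.comp (f := fun y => 1 - K y)
        (NormedRing.inverse_continuousAt (Units.oneSub (K x) (hs x hx)))
        (continuous_const.sub hK).continuousAt
    exact h.clm_apply continuousAt_const

/-- `φ` solves `(p φ')' = (μ - U) q φ` with flux `P = p φ'`, normalized at the left endpoint. -/
structure IsRegularSol (R : ℝ) (p q U : ℝ → ℝ) (μ : ℝ) (φ P : ℝ → ℝ) : Prop where
  cont : ContinuousOn φ (Ico 0 R)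
  zero : φ 0 = 1
  flux_cont : ContinuousOn P (Ico 0 R)
  flux_zero : P 0 = 0
  deriv : ∀ r ∈ Ioo 0 R, HasDerivAt φ (P r / p r) r
  flux_deriv : ∀ r ∈ Ioo 0 R, HasDerivAt P ((μ - U r) * q r * φ r) r

namespace SingularSL

variable {R M B C : ℝ} {p q U H : ℝ → ℝ}

/-- Regular solutions exist and depend on the spectral parameter locally uniformly. -/
theorem exists_regularSol (S : SingularSL R M B C p q U H) :
    ∃ φ P : ℝ → ℝ → ℝ, (∀ μ ∈ Icc 0 (M + 1), IsRegularSol R p q U μ (φ μ) (P μ)) ∧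
      ∀ μ ∈ Icc 0 (M + 1), ∀ b ∈ Ioo 0 R, ∀ ε > 0,
        ∀ᶠ ν in nhdsWithin μ (Icc 0 (M + 1)), ∀ r ∈ Icc 0 b, |φ ν r - φ μ r| < ε := by
  have hR := S.R_pos
  have hM := S.M_pos
  obtain ⟨N, hNdef⟩ : ∃ N, N = R * (2 * (M + 1)) := ⟨_, rfl⟩
  have hN : 0 < N := by rw [hNdef]; positivity
  obtain ⟨k, hkc, hkU⟩ := S.exists_bcf
  obtain ⟨J, hJ, hJu⟩ := S.exists_volterra hN
  have hk : ∀ μ ∈ Icc 0 (M + 1), ‖k μ‖ ≤ M + 1 := fun μ hμ =>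
    (BoundedContinuousFunction.norm_le (by positivity)).2 fun r => by
      rw [hkU]; exact S.abs_sub_le hμ r r.2
  let K : ℝ → BoundedContinuousFunction (Ioo 0 R) ℝ →L[ℝ]
      BoundedContinuousFunction (Ioo 0 R) ℝ := fun μ =>
    J ∘L ContinuousLinearMap.mul ℝ (BoundedContinuousFunction (Ioo 0 R) ℝ) (k μ)
  have hKc : Continuous K :=
    continuous_const.clm_comp
      ((ContinuousLinearMap.mul ℝ (BoundedContinuousFunction (Ioo 0 R) ℝ)).continuous.comp hkc)
  have hK : ∀ μ ∈ Icc 0 (M + 1), ‖K μ‖ < 1 := fun μ hμ => by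
    calc ‖K μ‖ ≤ ‖J‖ * ‖ContinuousLinearMap.mul ℝ (BoundedContinuousFunction (Ioo 0 R) ℝ) (k μ)‖ :=
          ContinuousLinearMap.opNorm_comp_le _ _
      _ ≤ R / N * (M + 1) := by
          gcongr
          exact (ContinuousLinearMap.opNorm_mul_apply_le ℝ
            (BoundedContinuousFunction (Ioo 0 R) ℝ) (k μ)).trans (hk μ hμ)
      _ = 1 / 2 := by rw [hNdef]; field_simp
      _ < 1 := by norm_num
  let f : BoundedContinuousFunction (Ioo 0 R) ℝ := BoundedContinuousFunction.ofNormedAddCommGroup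
    (fun r : Ioo 0 R => exp (-expo H N r))
    (continuousOn_iff_continuous_domRestrict.1
      ((S.continuousOn_expo N).neg.rexp.mono Ioo_subset_Ico_self)) 1 fun r => by
        have := S.monotoneOn_expo hN.le ⟨le_rfl, hR⟩ ⟨r.2.1.le, r.2.2⟩ r.2.1.le
        rw [Real.norm_of_nonneg (exp_pos _).le, exp_le_one_iff]
        simpa [expo] using this
  obtain ⟨u, hu, huc⟩ := exists_continuous_fixedPoint hKc hK f
  replace hu : ∀ μ ∈ Icc 0 (M + 1), u μ = f + J (k μ * u μ) := hu
  let φ : ℝ → ℝ → ℝ := fun μ r => 1 + ∫ t in (0 : ℝ)..r, flux q H N (k μ * u μ) t / p t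
  have hφ : ∀ μ ∈ Icc 0 (M + 1), ∀ r ∈ Ioo 0 R,
      φ μ r = exp (expo H N r) * extendZero (u μ) r := fun μ hμ r hr => by
    rw [extendZero_apply _ hr, hu μ hμ, BoundedContinuousFunction.add_apply, hJu, mul_add,
      ← mul_assoc]
    change _ = exp (expo H N r) * exp (-expo H N r) + _
    simp [← exp_add, φ]
  refine ⟨φ, fun μ => flux q H N (k μ * u μ), fun μ hμ => ?_, fun μ hμ b hb ε hε => ?_⟩
  · refine ⟨continuousOn_const.add (S.tame_flux_div hN.le _).continuousOn_primitive, by simp [φ],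
      (S.tame_flux_integrand N _).continuousOn_primitive, by simp [flux], fun r hr =>
      ((S.tame_flux_div hN.le _).hasDerivAt_primitive hr).const_add 1, fun r hr => ?_⟩
    refine ((S.tame_flux_integrand N _).hasDerivAt_primitive hr).congr_deriv ?_
    rw [hφ μ hμ r hr, extendZero_mul, extendZero_apply (k μ) hr]
    rw [hkU]
    ring
  · have h := Metric.tendsto_nhds.1
      ((huc μ hμ).tendsto.mono_left (nhdsWithin_le_nhds (s := Icc 0 (M + 1))))
      (ε / exp (expo H N b)) (by positivity)
    filter_upwards [h, self_mem_nhdsWithin] with ν hν hν' r hr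
    rcases hr.1.eq_or_lt with rfl | h0
    · simpa [φ] using hε
    have hr' : r ∈ Ioo 0 R := ⟨h0, hr.2.trans_lt hb.2⟩
    rw [hφ μ hμ r hr', hφ ν hν' r hr', ← mul_sub, ← extendZero_sub, abs_mul,
      abs_of_pos (exp_pos _)]
    rw [dist_eq_norm, lt_div_iff₀ (exp_pos _), mul_comm] at hν
    refine lt_of_le_of_lt ?_ hν
    gcongr
    · exact S.monotoneOn_expo hN.le ⟨hr.1, hr'.2⟩ ⟨hb.1.le, hb.2⟩ hr.2
    · exact abs_extendZero_le _ _

end SingularSL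

theorem first_zero {R : ℝ} {f : ℝ → ℝ} (hf : ContinuousOn f (Ico 0 R)) (h0 : 0 < f 0) {z : ℝ}
    (hz : z ∈ Ico 0 R) (hfz : f z ≤ 0) : ∃ r ∈ Ioc 0 z, f r = 0 ∧ ∀ s ∈ Ico 0 r, 0 < f s := by
  have hsub : Icc 0 z ⊆ Ico 0 R := fun s hs => ⟨hs.1, hs.2.trans_lt hz.2⟩
  have hcomp : IsCompact (Icc 0 z ∩ f ⁻¹' Iic 0) :=
    isCompact_Icc.of_isClosed_subset
      ((hf.mono hsub).preimage_isClosed_of_isClosed isClosed_Icc isClosed_Iic) inter_subset_left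
  obtain ⟨r, ⟨hr, hfr⟩, hmin⟩ := hcomp.exists_isLeast ⟨z, ⟨hz.1, le_rfl⟩, hfz⟩
  have hpos : ∀ s ∈ Ico 0 r, 0 < f s := fun s hs => by
    by_contra hneg
    exact absurd (hmin ⟨⟨hs.1, hs.2.le.trans hr.2⟩, not_lt.1 hneg⟩) (not_le.2 hs.2)
  have hr0 : 0 < r := by
    refine hr.1.lt_of_ne fun h => ?_
    subst h
    exact absurd hfr (not_le.2 h0)
  obtain ⟨t, ht, hft⟩ := intermediate_value_Icc' hr.1
    (hf.mono ((Icc_subset_Icc_right hr.2).trans hsub)) ⟨hfr, h0.le⟩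
  refine ⟨r, ⟨hr0, hr.2⟩, ?_, hpos⟩
  rcases ht.2.lt_or_eq with hlt | heq
  · exact absurd (hpos t ⟨ht.1, hlt⟩) (by rw [hft]; exact lt_irrefl _)
  · rw [← heq, hft]

theorem exists_pos_le_of_continuousOn {R b : ℝ} {f : ℝ → ℝ} (hf : ContinuousOn f (Ico 0 R))
    (hb : b ∈ Ico 0 R) (hpos : ∀ s ∈ Icc 0 b, 0 < f s) : ∃ ε > 0, ∀ s ∈ Icc 0 b, ε ≤ f s := by
  obtain ⟨x, hx, hmin⟩ := isCompact_Icc.exists_isMinOn (nonempty_Icc.2 hb.1)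
    (hf.mono fun s hs => ⟨hs.1, hs.2.trans_lt hb.2⟩ : ContinuousOn f (Icc 0 b))
  exact ⟨f x, hpos x hx, fun s hs => hmin hs⟩

theorem interior_subset_Ioo {R : ℝ} {D : Set ℝ} (hD : D ⊆ Ico 0 R) : interior D ⊆ Ioo 0 R := by
  rw [← interior_Ico]
  exact interior_mono hD

namespace IsRegularSol

variable {R M B C μ : ℝ} {p q U H φ P : ℝ → ℝ} {D : Set ℝ}

theorem monotoneOn (h : IsRegularSol R p q U μ φ P) (S : SingularSL R M B C p q U H)
    (hD : Convex ℝ D) (hDR : D ⊆ Ico 0 R) (hP : ∀ t ∈ interior D, 0 ≤ P t) : MonotoneOn φ D := by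
  have hi := interior_subset_Ioo hDR
  refine monotoneOn_of_deriv_nonneg hD (h.cont.mono hDR)
    (fun t ht => (h.deriv t (hi ht)).differentiableAt.differentiableWithinAt) fun t ht => ?_
  rw [(h.deriv t (hi ht)).deriv]
  exact div_nonneg (hP t ht) (S.p_pos t (hi ht)).le

theorem flux_monotoneOn (h : IsRegularSol R p q U μ φ P) (S : SingularSL R M B C p q U H)
    (hD : Convex ℝ D) (hDR : D ⊆ Ico 0 R) (hU : ∀ t ∈ interior D, U t ≤ μ)
    (hφ : ∀ t ∈ interior D, 0 ≤ φ t) : MonotoneOn P D := by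
  have hi := interior_subset_Ioo hDR
  refine monotoneOn_of_deriv_nonneg hD (h.flux_cont.mono hDR)
    (fun t ht => (h.flux_deriv t (hi ht)).differentiableAt.differentiableWithinAt) fun t ht => ?_
  rw [(h.flux_deriv t (hi ht)).deriv]
  exact mul_nonneg (mul_nonneg (sub_nonneg.2 (hU t ht)) (S.q_pos t (hi ht)).le) (hφ t ht)

theorem flux_antitoneOn (h : IsRegularSol R p q U μ φ P) (S : SingularSL R M B C p q U H)
    (hD : Convex ℝ D) (hDR : D ⊆ Ico 0 R) (hU : ∀ t ∈ interior D, μ ≤ U t)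
    (hφ : ∀ t ∈ interior D, 0 ≤ φ t) : AntitoneOn P D := by
  have hi := interior_subset_Ioo hDR
  refine antitoneOn_of_deriv_nonpos hD (h.flux_cont.mono hDR)
    (fun t ht => (h.flux_deriv t (hi ht)).differentiableAt.differentiableWithinAt) fun t ht => ?_
  rw [(h.flux_deriv t (hi ht)).deriv]
  exact mul_nonpos_of_nonpos_of_nonneg
    (mul_nonpos_of_nonpos_of_nonneg (sub_nonpos.2 (hU t ht)) (S.q_pos t (hi ht)).le) (hφ t ht)

/-- The mean value theorem for the flux. -/
theorem exists_flux_sub_eq (h : IsRegularSol R p q U μ φ P) {a b : ℝ} (ha : 0 ≤ a) (hab : a < b)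
    (hb : b < R) : ∃ t ∈ Ioo a b, P b - P a = (μ - U t) * q t * φ t * (b - a) := by
  obtain ⟨t, ht, he⟩ := exists_hasDerivAt_eq_slope P (fun t => (μ - U t) * q t * φ t) hab
    (h.flux_cont.mono fun s hs => ⟨ha.trans hs.1, hs.2.trans_lt hb⟩)
    fun t ht => h.flux_deriv t ⟨ha.trans_lt ht.1, ht.2.trans hb⟩
  exact ⟨t, ht, by rw [he, div_mul_cancel₀ _ (sub_pos.2 hab).ne']⟩

/-- A flux bounded away from zero drives the solution to `-∞` at the singular endpoint. -/
theorem exists_neg_of_flux_le (h : IsRegularSol R p q U μ φ P) (S : SingularSL R M B C p q U H)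
    {m l : ℝ} (hm : m ∈ Ioo 0 R) (hl : 0 < l) (hP : ∀ r ∈ Ioo m R, P r ≤ -l) :
    ∃ r ∈ Ioo 0 R, φ r < 0 := by
  have hC : 0 < C := by
    have h1 := S.p_pos m hm
    have h2 := S.p_le m hm
    exact pos_of_mul_pos_left (h1.trans_le h2) (sub_nonneg.2 hm.2.le)
  have hderiv : ∀ r ∈ Ioo m R, HasDerivAt (fun r => φ r - l / C * log (R - r))
      (P r / p r + l / C / (R - r)) r := fun r hr => by
    have h1 : HasDerivAt (fun r => log (R - r)) (-1 / (R - r)) r :=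
      ((hasDerivAt_id r).const_sub R).log (sub_pos.2 hr.2).ne'
    exact ((h.deriv r ⟨hm.1.trans hr.1, hr.2⟩).sub (h1.const_mul (l / C))).congr_deriv (by ring)
  have hanti : AntitoneOn (fun r => φ r - l / C * log (R - r)) (Ico m R) := by
    refine antitoneOn_of_deriv_nonpos (convex_Ico _ _) ?_ ?_ ?_
    · refine (h.cont.mono (Ico_subset_Ico_left hm.1.le)).sub (continuousOn_const.mul
        (ContinuousOn.log (by fun_prop) fun r hr => (sub_pos.2 hr.2).ne'))
    · rw [interior_Ico]
      exact fun r hr => (hderiv r hr).differentiableAt.differentiableWithinAt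
    · rw [interior_Ico]
      intro r hr
      rw [(hderiv r hr).deriv]
      have hr' : r ∈ Ioo 0 R := ⟨hm.1.trans hr.1, hr.2⟩
      have hd : 0 < R - r := sub_pos.2 hr.2
      have h1 : P r / p r ≤ -l / p r := div_le_div_of_nonneg_right (hP r hr) (S.p_pos r hr').le
      have h2 : l / (C * (R - r)) ≤ l / p r :=
        div_le_div_of_nonneg_left hl.le (S.p_pos r hr') (S.p_le r hr')
      rw [neg_div] at h1
      rw [div_div]
      linarith
  obtain ⟨T, hT⟩ : ∃ T, T = (|φ m| + 1) * C / l := ⟨_, rfl⟩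
  have hT0 : 0 < T := by rw [hT]; positivity
  have hd : 0 < R - m := sub_pos.2 hm.2
  have he : exp (-T) < 1 := by rw [exp_lt_one_iff]; linarith
  have hmr : m < R - (R - m) * exp (-T) := by nlinarith
  have hrR : R - (R - m) * exp (-T) < R := by have := mul_pos hd (exp_pos (-T)); linarith
  refine ⟨R - (R - m) * exp (-T), ⟨hm.1.trans hmr, hrR⟩, ?_⟩
  have key := hanti ⟨le_rfl, hm.2⟩ ⟨hmr.le, hrR⟩ hmr.le
  simp only [sub_sub_cancel] at key
  rw [log_mul hd.ne' (exp_pos _).ne', log_exp] at key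
  have h3 : l / C * T = |φ m| + 1 := by rw [hT]; field_simp
  have h4 := le_abs_self (φ m)
  nlinarith

/-- Beyond a point where the flux is nonnegative and the potential is below `μ`, positivity
persists. -/
theorem pos_of_flux_nonneg (h : IsRegularSol R p q U μ φ P) (S : SingularSL R M B C p q U H)
    {s : ℝ} (hs : s ∈ Ico 0 R) (hφ : ∀ r ∈ Icc 0 s, 0 < φ r) (hP : 0 ≤ P s)
    (hU : ∀ t ∈ Ioo s R, U t ≤ μ) : ∀ r ∈ Ico 0 R, 0 < φ r := by
  intro r hr
  by_contra hneg
  obtain ⟨z, hz, hz0, hzpos⟩ := first_zero h.cont (hφ 0 ⟨le_rfl, hs.1⟩) hr (not_lt.1 hneg)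
  have hsz : s < z := by
    by_contra hle
    exact absurd (hφ z ⟨hz.1.le, not_lt.1 hle⟩) (by rw [hz0]; exact lt_irrefl _)
  have hsub : Icc s z ⊆ Ico 0 R := fun t ht => ⟨hs.1.trans ht.1, ht.2.trans_lt (hz.2.trans_lt hr.2)⟩
  have hPm : MonotoneOn P (Icc s z) := by
    refine h.flux_monotoneOn S (convex_Icc _ _) hsub ?_ ?_ <;> rw [interior_Icc]
    · exact fun t ht => hU t ⟨ht.1, ht.2.trans (hz.2.trans_lt hr.2)⟩
    · exact fun t ht => (hzpos t ⟨hs.1.trans ht.1.le, ht.2⟩).le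
  have hφm : MonotoneOn φ (Icc s z) := by
    refine h.monotoneOn S (convex_Icc _ _) hsub ?_
    rw [interior_Icc]
    exact fun t ht => hP.trans (hPm ⟨le_rfl, hsz.le⟩ ⟨ht.1.le, ht.2.le⟩ ht.1.le)
  have := hφm ⟨le_rfl, hsz.le⟩ ⟨hsz.le, le_rfl⟩ hsz.le
  have := hφ s ⟨hs.1, le_rfl⟩
  linarith

/-- A regular solution that increases somewhere while positive stays positive. -/
theorem pos_of_increase (h : IsRegularSol R p q U μ φ P) (S : SingularSL R M B C p q U H)
    {r b : ℝ} (hb : b ∈ Ioo 0 R) (hr : r ∈ Icc 0 b) (hrb : φ r < φ b)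
    (hpos : ∀ s ∈ Icc 0 b, 0 < φ s) : ∀ s ∈ Ico 0 R, 0 < φ s := by
  have hlt : r < b := hr.2.lt_of_ne fun he => by rw [he] at hrb; exact lt_irrefl _ hrb
  obtain ⟨s, hs, hse⟩ := exists_hasDerivAt_eq_slope φ (fun t => P t / p t) hlt
    (h.cont.mono fun s hs => ⟨hr.1.trans hs.1, hs.2.trans_lt hb.2⟩)
    fun t ht => h.deriv t ⟨hr.1.trans_lt ht.1, ht.2.trans hb.2⟩
  have hs0 : s ∈ Ioo 0 R := ⟨hr.1.trans_lt hs.1, hs.2.trans hb.2⟩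
  have hPs : 0 < P s := by
    have h1 : 0 < P s / p s := by
      rw [hse]
      exact div_pos (sub_pos.2 hrb) (sub_pos.2 hlt)
    exact (div_pos_iff_of_pos_right (S.p_pos s hs0)).1 h1
  obtain ⟨t, ht, hte⟩ := h.exists_flux_sub_eq le_rfl hs0.1 hs0.2
  have ht0 : t ∈ Ioo 0 R := ⟨ht.1, ht.2.trans hs0.2⟩
  rw [h.flux_zero, sub_zero, sub_zero] at hte
  have hμ : 0 < μ - U t := by
    have h1 := S.q_pos t ht0
    have h2 := hpos t ⟨ht.1.le, ht.2.le.trans hs.2.le⟩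
    rw [hte, mul_assoc, mul_assoc] at hPs
    exact pos_of_mul_pos_left hPs (by have := hs0.1; positivity)
  refine h.pos_of_flux_nonneg S ⟨hs0.1.le, hs0.2⟩
    (fun τ hτ => hpos τ ⟨hτ.1, hτ.2.trans hs.2.le⟩) hPs.le fun τ hτ => ?_
  have := S.U_anti ht0 ⟨hs0.1.trans hτ.1, hτ.2⟩ (ht.2.trans hτ.1).le
  linarith

theorem exists_increase (h : IsRegularSol R p q U (M + 1) φ P)
    (S : SingularSL R M B C p q U H) : φ 0 < φ (R / 2) ∧ ∀ r ∈ Ico 0 R, 1 ≤ φ r := by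
  have hR := S.R_pos
  have hpos : ∀ r ∈ Ico 0 R, 0 < φ r := by
    refine h.pos_of_flux_nonneg S ⟨le_rfl, hR⟩ (fun r hr => ?_) h.flux_zero.ge fun t ht => ?_
    · rw [le_antisymm hr.2 hr.1, h.zero]
      exact one_pos
    · linarith [S.U_le t ht]
  have hP : ∀ r ∈ Ioo 0 R, 0 < P r := fun r hr => by
    obtain ⟨t, ht, hte⟩ := h.exists_flux_sub_eq le_rfl hr.1 hr.2
    have ht0 : t ∈ Ioo 0 R := ⟨ht.1, ht.2.trans hr.2⟩
    rw [h.flux_zero, sub_zero, sub_zero] at hte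
    rw [hte]
    have h1 : 0 < M + 1 - U t := by linarith [S.U_le t ht0]
    have h2 := S.q_pos t ht0
    have h3 := hpos t ⟨ht0.1.le, ht0.2⟩
    have h4 := hr.1
    positivity
  have hmono : StrictMonoOn φ (Ico 0 R) := by
    refine strictMonoOn_of_deriv_pos (convex_Ico _ _) h.cont fun t ht => ?_
    rw [interior_Ico] at ht
    rw [(h.deriv t ht).deriv]
    exact div_pos (hP t ht) (S.p_pos t ht)
  refine ⟨hmono ⟨le_rfl, hR⟩ ⟨by linarith, by linarith⟩ (by linarith), fun r hr => ?_⟩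
  rw [← h.zero]
  exact hmono.monotoneOn ⟨le_rfl, hR⟩ hr hr.1

theorem exists_neg (h : IsRegularSol R p q U 0 φ P) (S : SingularSL R M B C p q U H) :
    ∃ r ∈ Ioo 0 R, φ r < 0 := by
  by_contra! hnn
  have hR := S.R_pos
  have hanti : AntitoneOn P (Ico 0 R) := by
    refine h.flux_antitoneOn S (convex_Ico _ _) subset_rfl ?_ ?_ <;> rw [interior_Ico]
    · exact fun t ht => (S.U_pos t ht).le
    · exact hnn
  have hev : ∀ᶠ r in nhdsWithin 0 (Ico 0 R), 0 < φ r :=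
    (h.cont 0 ⟨le_rfl, hR⟩).eventually (lt_mem_nhds (by rw [h.zero]; exact one_pos))
  obtain ⟨δ, hδ, hball⟩ := Metric.mem_nhdsWithin_iff.1 hev
  obtain ⟨m, hmdef⟩ : ∃ m, m = min (δ / 2) (R / 2) := ⟨_, rfl⟩
  have hm0 : 0 < m := by rw [hmdef]; positivity
  have hmδ : m ≤ δ / 2 := hmdef ▸ min_le_left _ _
  have hmR : m < R := by have : m ≤ R / 2 := hmdef ▸ min_le_right _ _; linarith
  obtain ⟨t, ht, hte⟩ := h.exists_flux_sub_eq le_rfl hm0 hmR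
  have ht0 : t ∈ Ioo 0 R := ⟨ht.1, ht.2.trans hmR⟩
  have hφt : 0 < φ t := hball ⟨by
    rw [Metric.mem_ball, dist_zero_right, norm_eq_abs, abs_of_pos ht.1]
    linarith [ht.2], ht0.1.le, ht0.2⟩
  rw [h.flux_zero, sub_zero, sub_zero, zero_sub] at hte
  have hl : 0 < -P m := by
    rw [hte]
    have h1 := S.U_pos t ht0
    have h2 := S.q_pos t ht0
    have : 0 < U t * q t * φ t * m := by positivity
    linarith
  obtain ⟨r, hr, hφr⟩ := h.exists_neg_of_flux_le S ⟨hm0, hmR⟩ hl fun r hr => by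
    rw [neg_neg]
    exact hanti ⟨hm0.le, hmR⟩ ⟨(hm0.trans hr.1).le, hr.2⟩ hr.1.le
  exact absurd (hnn r hr) (not_le.2 hφr)

/-- A nonnegative regular solution which is not increasing before its first zero has no zero. -/
theorem pos_of_nonneg (h : IsRegularSol R p q U μ φ P) (S : SingularSL R M B C p q U H)
    (hμ : μ ∈ Icc 0 (M + 1)) (hnn : ∀ r ∈ Ioo 0 R, 0 ≤ φ r)
    (hdec : ∀ b ∈ Ioo 0 R, (∀ s ∈ Icc 0 b, 0 < φ s) → ∀ r ∈ Icc 0 b, φ b ≤ φ r) :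
    ∀ r ∈ Ico 0 R, 0 < φ r := by
  intro r hr
  by_contra hneg
  obtain ⟨z, hz, hz0, hzpos⟩ :=
    first_zero h.cont (by rw [h.zero]; exact one_pos) hr (not_lt.1 hneg)
  have hzR : z ∈ Ioo 0 R := ⟨hz.1, hz.2.trans_lt hr.2⟩
  have hPz : P z = 0 := by
    have hmin : IsLocalMin φ z := by
      filter_upwards [Ioo_mem_nhds hzR.1 hzR.2] with s hs
      rw [hz0]
      exact hnn s hs
    have := hmin.hasDerivAt_eq_zero (h.deriv z hzR)
    exact (div_eq_zero_iff.1 this).resolve_right (S.p_pos z hzR).ne'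
  have hanti : ∀ t ∈ Ioo 0 z, ∀ x ∈ Ioo t z, φ x ≤ φ t := fun t ht x hx =>
    hdec x ⟨ht.1.trans hx.1, hx.2.trans hzR.2⟩
      (fun s hs => hzpos s ⟨hs.1, hs.2.trans_lt hx.2⟩) t ⟨ht.1.le, hx.1.le⟩
  have hM := S.M_pos
  have hB : 0 < B := (S.q_pos z hzR).trans_le (S.q_le z hzR)
  have hflux : ∀ t ∈ Ioo 0 z, -((M + 1) * B * z * φ t) ≤ P t := fun t ht => by
    obtain ⟨x, hx, hxe⟩ := h.exists_flux_sub_eq ht.1.le ht.2 hzR.2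
    have hx0 : x ∈ Ioo 0 R := ⟨ht.1.trans hx.1, hx.2.trans hzR.2⟩
    have h1 := (le_abs_self _).trans (S.abs_sub_le hμ x hx0)
    have h2 := S.q_le x hx0
    have h3 := hanti t ht x hx
    have h4 := hnn x hx0
    have h5 := S.q_pos x hx0
    have h6 : (μ - U x) * q x ≤ (M + 1) * B := mul_le_mul h1 h2 h5.le (by positivity)
    have h7 : (μ - U x) * q x * φ x ≤ (M + 1) * B * φ t :=
      mul_le_mul h6 h3 h4 (by positivity)
    have h8 : (μ - U x) * q x * φ x * (z - t) ≤ (M + 1) * B * φ t * z :=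
      mul_le_mul h7 (by linarith [ht.1]) (by linarith [ht.2])
        (by have := hzpos t ⟨ht.1.le, ht.2⟩; positivity)
    rw [hPz] at hxe
    linarith
  have hz2 : 0 < z / 2 := by linarith [hz.1]
  obtain ⟨y, hy, hymin⟩ := isCompact_Icc.exists_isMinOn
    (nonempty_Icc.2 (by linarith : z / 2 ≤ z))
    (S.p_cont.mono fun s hs => ⟨hz2.trans_le hs.1, hs.2.trans_lt hzR.2⟩ :
      ContinuousOn p (Icc (z / 2) z))
  have hpy := S.p_pos y ⟨hz2.trans_le hy.1, hy.2.trans_lt hzR.2⟩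
  obtain ⟨D, hD⟩ : ∃ D, D = (M + 1) * B * z / p y := ⟨_, rfl⟩
  have hderiv : ∀ t ∈ Ioo (z / 2) z, HasDerivAt (fun t => φ t * exp (D * t))
      ((P t / p t + D * φ t) * exp (D * t)) t := fun t ht => by
    have h1 : HasDerivAt (fun t => exp (D * t)) (exp (D * t) * D) t := by
      simpa using ((hasDerivAt_id t).const_mul D).exp
    exact ((h.deriv t ⟨hz2.trans ht.1, ht.2.trans hzR.2⟩).mul h1).congr_deriv (by ring)
  have hmono : MonotoneOn (fun t => φ t * exp (D * t)) (Icc (z / 2) z) := by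
    refine monotoneOn_of_deriv_nonneg (convex_Icc _ _) ?_ ?_ ?_
    · exact (h.cont.mono fun s hs => ⟨hz2.le.trans hs.1, hs.2.trans_lt hzR.2⟩).mul
        (by fun_prop)
    · rw [interior_Icc]
      exact fun t ht => (hderiv t ht).differentiableAt.differentiableWithinAt
    · rw [interior_Icc]
      intro t ht
      rw [(hderiv t ht).deriv]
      have ht0 : t ∈ Ioo 0 z := ⟨hz2.trans ht.1, ht.2⟩
      have hpt := S.p_pos t ⟨ht0.1, ht0.2.trans hzR.2⟩
      have hφt := hzpos t ⟨ht0.1.le, ht0.2⟩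
      have hz1 := hz.1
      have h1 : -((M + 1) * B * z * φ t) / p t ≤ P t / p t :=
        div_le_div_of_nonneg_right (hflux t ht0) hpt.le
      have h2 : (M + 1) * B * z * φ t / p t ≤ (M + 1) * B * z * φ t / p y :=
        div_le_div_of_nonneg_left (by positivity) hpy (hymin ⟨ht.1.le, ht.2.le⟩)
      have h3 : D * φ t = (M + 1) * B * z * φ t / p y := by rw [hD]; ring
      rw [neg_div] at h1
      exact mul_nonneg (by linarith) (exp_pos _).le
  have h1 := hmono ⟨le_rfl, by linarith⟩ ⟨by linarith, le_rfl⟩ (by linarith)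
  simp only [hz0, zero_mul] at h1
  have h2 := mul_pos (hzpos (z / 2) ⟨hz2.le, by linarith⟩) (exp_pos (D * (z / 2)))
  linarith

end IsRegularSol

/-- There is a spectral parameter whose regular solution is positive and decreasing. -/
theorem SingularSL.exists_groundState {R M B C : ℝ} {p q U H : ℝ → ℝ}
    (S : SingularSL R M B C p q U H) :
    ∃ μ ∈ Icc 0 (M + 1), 0 < μ ∧ ∃ φ P : ℝ → ℝ, IsRegularSol R p q U μ φ P ∧
      (∀ r ∈ Ico 0 R, 0 < φ r) ∧ AntitoneOn φ (Ico 0 R) := by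
  have hR := S.R_pos
  have hM := S.M_pos
  obtain ⟨φ, P, h, hunif⟩ := S.exists_regularSol
  obtain ⟨A, hA⟩ : ∃ A : ℝ → Prop, ∀ μ, A μ ↔
      ∃ b ∈ Ioo 0 R, (∃ r ∈ Icc 0 b, φ μ r < φ μ b) ∧ ∀ s ∈ Icc 0 b, 0 < φ μ s :=
    ⟨_, fun _ => Iff.rfl⟩
  have hAopen : ∀ μ ∈ Icc 0 (M + 1), A μ → ∀ᶠ ν in nhdsWithin μ (Icc 0 (M + 1)), A ν := by
    intro μ hμ hAμ
    obtain ⟨b, hb, ⟨r, hr, hrb⟩, hpos⟩ := (hA μ).1 hAμ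
    obtain ⟨ε, hε, hle⟩ := exists_pos_le_of_continuousOn (h μ hμ).cont ⟨hb.1.le, hb.2⟩ hpos
    filter_upwards [hunif μ hμ b hb ε hε,
      hunif μ hμ b hb ((φ μ b - φ μ r) / 2) (by linarith)] with ν h1 h2
    refine (hA ν).2 ⟨b, hb, ⟨r, hr, ?_⟩, fun s hs => ?_⟩
    · have h3 := abs_lt.1 (h2 r hr)
      have h4 := abs_lt.1 (h2 b ⟨hb.1.le, le_rfl⟩)
      linarith [h3.2, h4.1]
    · linarith [(abs_lt.1 (h1 s hs)).1, hle s hs]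
  have hBopen : ∀ μ ∈ Icc 0 (M + 1), (∃ r ∈ Ioo 0 R, φ μ r < 0) →
      ∀ᶠ ν in nhdsWithin μ (Icc 0 (M + 1)), ∃ r ∈ Ioo 0 R, φ ν r < 0 := by
    rintro μ hμ ⟨r, hr, hneg⟩
    filter_upwards [hunif μ hμ r hr (-φ μ r) (by linarith)] with ν h1
    exact ⟨r, hr, by linarith [(abs_lt.1 (h1 r ⟨hr.1.le, le_rfl⟩)).2]⟩
  have hdisj : ∀ μ ∈ Icc 0 (M + 1), A μ → ¬∃ r ∈ Ioo 0 R, φ μ r < 0 := by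
    rintro μ hμ hAμ ⟨r, hr, hneg⟩
    obtain ⟨b, hb, ⟨x, hx, hxb⟩, hpos⟩ := (hA μ).1 hAμ
    exact lt_asymm hneg ((h μ hμ).pos_of_increase S hb hx hxb hpos r ⟨hr.1.le, hr.2⟩)
  have h0 : (0 : ℝ) ∈ Icc 0 (M + 1) := ⟨le_rfl, by linarith⟩
  have h1 : M + 1 ∈ Icc 0 (M + 1) := ⟨by linarith, le_rfl⟩
  have hA1 : A (M + 1) := by
    obtain ⟨hinc, hge⟩ := (h _ h1).exists_increase S
    exact (hA _).2 ⟨R / 2, ⟨by linarith, by linarith⟩, ⟨0, ⟨le_rfl, by linarith⟩, hinc⟩,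
      fun s hs => one_pos.trans_le (hge s ⟨hs.1, by linarith [hs.2]⟩)⟩
  have hB0 := (h 0 h0).exists_neg S
  obtain ⟨μ, hμ, hAμ, hBμ⟩ : ∃ μ ∈ Icc 0 (M + 1), ¬A μ ∧ ¬∃ r ∈ Ioo 0 R, φ μ r < 0 := by
    by_contra! hall
    classical
    have hcont : ContinuousOn (fun μ => if A μ then (1 : ℝ) else 0) (Icc 0 (M + 1)) := by
      intro μ hμ
      by_cases hAμ : A μ
      · refine (continuousWithinAt_const (b := (1 : ℝ))).congr_of_eventuallyEq ?_ (if_pos hAμ)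
        filter_upwards [hAopen μ hμ hAμ] with ν hν
        exact if_pos hν
      · refine (continuousWithinAt_const (b := (0 : ℝ))).congr_of_eventuallyEq ?_ (if_neg hAμ)
        filter_upwards [hBopen μ hμ (hall μ hμ hAμ), self_mem_nhdsWithin] with ν hν hνI
        exact if_neg fun hAν => hdisj ν hνI hAν hν
    have hhalf := intermediate_value_Icc h1.1 hcont
    simp only [if_pos hA1, if_neg fun hA0 => hdisj 0 h0 hA0 hB0] at hhalf
    obtain ⟨ν, -, hν⟩ := hhalf (⟨by norm_num, by norm_num⟩ : (1 / 2 : ℝ) ∈ Icc (0 : ℝ) 1)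
    dsimp only at hν
    split_ifs at hν <;> norm_num at hν
  have hnn : ∀ r ∈ Ioo 0 R, 0 ≤ φ μ r := by
    push Not at hBμ
    exact hBμ
  have hdec : ∀ b ∈ Ioo 0 R, (∀ s ∈ Icc 0 b, 0 < φ μ s) → ∀ r ∈ Icc 0 b, φ μ b ≤ φ μ r := by
    intro b hb hpos r hr
    by_contra hlt
    exact hAμ ((hA μ).2 ⟨b, hb, ⟨r, hr, not_le.1 hlt⟩, hpos⟩)
  have hpos := (h μ hμ).pos_of_nonneg S hμ hnn hdec
  refine ⟨μ, hμ, hμ.1.lt_of_ne fun he => hBμ (he ▸ hB0), φ μ, P μ, h μ hμ, hpos, ?_⟩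
  intro r hr s hs hrs
  rcases hs.1.eq_or_lt with h' | h'
  · rw [le_antisymm hrs (h' ▸ hr.1)]
  · exact hdec s ⟨h', hs.2⟩ (fun t ht => hpos t ⟨ht.1, ht.2.trans_lt hs.2⟩) r ⟨hr.1, hrs⟩

namespace IsRegularSol

variable {R M B C μ : ℝ} {p q U H φ P : ℝ → ℝ}

theorem flux_nonpos (h : IsRegularSol R p q U μ φ P) (S : SingularSL R M B C p q U H)
    (hanti : AntitoneOn φ (Ico 0 R)) : ∀ r ∈ Ioo 0 R, P r ≤ 0 := by
  intro r hr
  have h1 := (hanti.mono Ioo_subset_Ico_self).derivWithin_nonpos (x := r)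
  rw [(h.deriv r hr).hasDerivWithinAt.derivWithin (isOpen_Ioo.uniqueDiffWithinAt hr)] at h1
  by_contra hP
  exact absurd (div_pos (not_le.1 hP) (S.p_pos r hr)) (not_lt.2 h1)

theorem le_one (h : IsRegularSol R p q U μ φ P) (hanti : AntitoneOn φ (Ico 0 R)) :
    ∀ r ∈ Ico 0 R, φ r ≤ 1 := fun r hr => by
  rw [← h.zero]
  exact hanti ⟨le_rfl, hr.1.trans_lt hr.2⟩ hr hr.1

theorem abs_flux_deriv_le (S : SingularSL R M B C p q U H) (hμ : μ ∈ Icc 0 (M + 1))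
    {t D E : ℝ} (ht : t ∈ Ioo 0 R) (hφ : 0 ≤ φ t) (hE : φ t ≤ E) (hD : q t ≤ D) :
    |(μ - U t) * q t * φ t| ≤ (M + 1) * D * E := by
  have hM := S.M_pos
  have hq := S.q_pos t ht
  rw [abs_mul, abs_mul, abs_of_pos hq, abs_of_nonneg hφ]
  exact mul_le_mul (mul_le_mul (S.abs_sub_le hμ t ht) hD hq.le (by linarith)) hE hφ
    (mul_nonneg (by linarith) (hq.le.trans hD))

/-- The flux of a ground state vanishes at the left endpoint. -/
theorem abs_flux_le_left (h : IsRegularSol R p q U μ φ P) (S : SingularSL R M B C p q U H)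
    (hμ : μ ∈ Icc 0 (M + 1)) (hpos : ∀ r ∈ Ico 0 R, 0 < φ r) (hanti : AntitoneOn φ (Ico 0 R))
    {r D : ℝ} (hr : r ∈ Ioo 0 R) (hD : ∀ s ∈ Ioo 0 r, q s ≤ D) : |P r| ≤ (M + 1) * D * r := by
  obtain ⟨t, ht, he⟩ := h.exists_flux_sub_eq le_rfl hr.1 hr.2
  have ht0 : t ∈ Ico 0 R := ⟨ht.1.le, ht.2.trans hr.2⟩
  rw [h.flux_zero, sub_zero, sub_zero] at he
  rw [he, abs_mul, abs_of_pos hr.1]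
  refine mul_le_mul_of_nonneg_right ?_ hr.1.le
  have := abs_flux_deriv_le S hμ ⟨ht.1, ht0.2⟩ (hpos t ht0).le (h.le_one hanti t ht0) (hD t ht)
  rwa [mul_one] at this

/-- The flux of a ground state vanishes at the right endpoint. -/
theorem abs_flux_le_right (h : IsRegularSol R p q U μ φ P) (S : SingularSL R M B C p q U H)
    (hμ : μ ∈ Icc 0 (M + 1)) (hpos : ∀ r ∈ Ico 0 R, 0 < φ r) (hanti : AntitoneOn φ (Ico 0 R))
    {r D : ℝ} (hr : r ∈ Ioo 0 R) (hD : ∀ s ∈ Ioo r R, q s ≤ D) :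
    |P r| ≤ (M + 1) * D * φ r * (R - r) := by
  rw [abs_of_nonpos (h.flux_nonpos S hanti r hr)]
  by_contra! hlt
  obtain ⟨s, hs, hneg⟩ := h.exists_neg_of_flux_le S hr
    (l := -P r - (M + 1) * D * φ r * (R - r)) (by linarith) fun s hs => by
      obtain ⟨t, ht, he⟩ := h.exists_flux_sub_eq hr.1.le hs.1 hs.2
      have ht0 : t ∈ Ioo 0 R := ⟨hr.1.trans ht.1, ht.2.trans hs.2⟩
      have hb := abs_flux_deriv_le S hμ ht0 (hpos t ⟨ht0.1.le, ht0.2⟩).le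
        (hanti ⟨hr.1.le, hr.2⟩ ⟨ht0.1.le, ht0.2⟩ ht.1.le) (hD t ⟨ht.1, ht0.2⟩)
      have h1 := mul_le_mul ((le_abs_self _).trans hb) (sub_le_sub_right hs.2.le r)
        (sub_nonneg.2 hs.1.le) ((abs_nonneg _).trans hb)
      linarith
  exact lt_asymm hneg (hpos s ⟨hs.1.le, hs.2⟩)

end IsRegularSol

/-- A Lane-Emden enthalpy profile on `[0, R]`. -/
structure LaneEmdenProfile (α c R : ℝ) (w : ℝ → ℝ) : Prop where
  exponent_gt : 3 < α
  c_pos : 0 < c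
  R_pos : 0 < R
  cont : ContinuousOn w (Icc 0 R)
  smooth : ContDiffOn ℝ (⊤ : ℕ∞) w (Ico 0 R)
  zero : w 0 = 1
  pos : ∀ r, 0 ≤ r → r < R → 0 < w r
  endpoint : w R = 0
  deriv_neg : ∀ r, 0 < r → r < R → deriv w r < 0
  ode : ∀ r, 0 < r → r < R → deriv (deriv w) r + (2 / r) * deriv w r + c * w r ^ α = 0

namespace LaneEmdenProfile

variable {α c R : ℝ} {w : ℝ → ℝ}

theorem hasDerivAt (L : LaneEmdenProfile α c R w) {r : ℝ} (hr : r ∈ Ioo 0 R) :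
    HasDerivAt w (deriv w r) r :=
  (((L.smooth r ⟨hr.1.le, hr.2⟩).contDiffAt (Ico_mem_nhds hr.1 hr.2)).differentiableAt
    (by simp)).hasDerivAt

theorem hasDerivAt_deriv (L : LaneEmdenProfile α c R w) {r : ℝ} (hr : r ∈ Ioo 0 R) :
    HasDerivAt (deriv w) (-(2 / r) * deriv w r - c * w r ^ α) r := by
  have h : ContDiffOn ℝ 1 (deriv w) (Ioo 0 R) :=
    (L.smooth.mono Ioo_subset_Ico_self).deriv_of_isOpen isOpen_Ioo (by norm_cast)
  have h2 := ((h.differentiableOn one_ne_zero).differentiableAt (isOpen_Ioo.mem_nhds hr)).hasDerivAt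
  exact h2.congr_deriv (by linarith [L.ode r hr.1 hr.2])

theorem antitoneOn (L : LaneEmdenProfile α c R w) : AntitoneOn w (Icc 0 R) :=
  antitoneOn_of_deriv_nonpos (convex_Icc _ _) L.cont
    (by
      rw [interior_Icc]
      exact fun r hr => (L.hasDerivAt hr).differentiableAt.differentiableWithinAt)
    (by rw [interior_Icc]; exact fun r hr => (L.deriv_neg r hr.1 hr.2).le)

theorem le_one (L : LaneEmdenProfile α c R w) {r : ℝ} (hr : r ∈ Icc 0 R) : w r ≤ 1 := by
  rw [← L.zero]
  exact L.antitoneOn ⟨le_rfl, L.R_pos.le⟩ hr hr.1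

theorem rpow_le_one (L : LaneEmdenProfile α c R w) {r β : ℝ} (hr : r ∈ Ioo 0 R) (hβ : 0 ≤ β) :
    w r ^ β ≤ 1 :=
  Real.rpow_le_one (L.pos r hr.1.le hr.2).le (L.le_one ⟨hr.1.le, hr.2.le⟩) hβ

theorem rpow_pos (L : LaneEmdenProfile α c R w) {r : ℝ} (β : ℝ) (hr : r ∈ Ico 0 R) :
    0 < w r ^ β := Real.rpow_pos_of_pos (L.pos r hr.1 hr.2) β

theorem continuousOn_rpow (L : LaneEmdenProfile α c R w) (β : ℝ) :
    ContinuousOn (fun r => w r ^ β) (Ico 0 R) :=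
  (L.cont.mono Ico_subset_Icc_self).rpow_const fun r hr => Or.inl (L.pos r hr.1 hr.2).ne'

theorem hasDerivAt_rpow (L : LaneEmdenProfile α c R w) (β : ℝ) {r : ℝ} (hr : r ∈ Ioo 0 R) :
    HasDerivAt (fun s => w s ^ β) (β * w r ^ (β - 1) * deriv w r) r :=
  ((L.hasDerivAt hr).rpow_const (Or.inl (L.pos r hr.1.le hr.2).ne')).congr_deriv (by ring)

/-- The flux `r² w'` of the profile. -/
theorem continuousOn_flux (L : LaneEmdenProfile α c R w) :
    ContinuousOn (fun r => r ^ 2 * deriv w r) (Ico 0 R) := by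
  have h := L.smooth.continuousOn_derivWithin (uniqueDiffOn_Ico 0 R) (by simp)
  refine ((continuous_pow 2).continuousOn.mul h).congr fun r hr => ?_
  rcases hr.1.eq_or_lt with rfl | h0
  · simp
  · simp only [Pi.mul_apply]
    rw [derivWithin_of_mem_nhds (Ico_mem_nhds h0 hr.2)]

theorem hasDerivAt_flux (L : LaneEmdenProfile α c R w) {r : ℝ} (hr : r ∈ Ioo 0 R) :
    HasDerivAt (fun r => r ^ 2 * deriv w r) (-(c * r ^ 2 * w r ^ α)) r := by
  refine ((hasDerivAt_pow 2 r).mul (L.hasDerivAt_deriv hr)).congr_deriv ?_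
  have := hr.1.ne'
  simp only [Nat.cast_ofNat]
  field_simp
  ring

/-- A function on `[0, R)` vanishing at `0` with nonnegative derivative is nonnegative. -/
theorem nonneg_of_hasDerivAt_nonneg {f f' : ℝ → ℝ} (hf : ContinuousOn f (Ico 0 R)) (h0 : f 0 = 0)
    (hd : ∀ r ∈ Ioo 0 R, HasDerivAt f (f' r) r) (hf' : ∀ r ∈ Ioo 0 R, 0 ≤ f' r) {r : ℝ}
    (hr : r ∈ Ico 0 R) : 0 ≤ f r := by
  have hm : MonotoneOn f (Ico 0 R) := by
    refine monotoneOn_of_deriv_nonneg (convex_Ico _ _) hf ?_ ?_ <;> rw [interior_Ico]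
    · exact fun r hr => (hd r hr).differentiableAt.differentiableWithinAt
    · exact fun r hr => by rw [(hd r hr).deriv]; exact hf' r hr
  rw [← h0]
  exact hm ⟨le_rfl, hr.1.trans_lt hr.2⟩ hr hr.1

theorem neg_deriv_div_le (L : LaneEmdenProfile α c R w) {r : ℝ} (hr : r ∈ Ioo 0 R) :
    -deriv w r / r ≤ c / 3 := by
  have hd : ∀ r ∈ Ioo 0 R, HasDerivAt (fun r => r ^ 2 * deriv w r + c / 3 * r ^ 3)
      (c * r ^ 2 * (1 - w r ^ α)) r := fun r hr =>
    ((L.hasDerivAt_flux hr).add ((hasDerivAt_pow 3 r).const_mul (c / 3))).congr_deriv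
      (by simp only [Nat.cast_ofNat]; ring)
  have h := nonneg_of_hasDerivAt_nonneg
    (L.continuousOn_flux.add (by fun_prop)) (by simp) hd (fun r hr => by
      have h1 := L.rpow_le_one hr (by linarith [L.exponent_gt])
      have h2 := L.c_pos
      exact mul_nonneg (by positivity) (by linarith)) ⟨hr.1.le, hr.2⟩
  simp only [Pi.add_apply] at h
  have h2 : 0 ≤ r ^ 2 * (deriv w r + c / 3 * r) := by linarith
  rw [div_le_iff₀ hr.1]
  linarith [nonneg_of_mul_nonneg_right h2 (pow_pos hr.1 2)]

theorem antitoneOn_neg_deriv_div (L : LaneEmdenProfile α c R w) :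
    AntitoneOn (fun r => -deriv w r / r) (Ioo 0 R) := by
  have hd : ∀ r ∈ Ioo 0 R, HasDerivAt (fun r => -3 * (r ^ 2 * deriv w r) - c * r ^ 3 * w r ^ α)
      (-(c * r ^ 3 * (α * w r ^ (α - 1) * deriv w r))) r := fun r hr =>
    (((L.hasDerivAt_flux hr).const_mul (-3)).sub
      (((hasDerivAt_pow 3 r).const_mul c).mul (L.hasDerivAt_rpow α hr))).congr_deriv
      (by simp only [Nat.cast_ofNat]; ring)
  have hT : ∀ r ∈ Ioo 0 R, 0 ≤ -3 * (r ^ 2 * deriv w r) - c * r ^ 3 * w r ^ α := fun r hr =>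
    nonneg_of_hasDerivAt_nonneg (f := fun r => -3 * (r ^ 2 * deriv w r) - c * r ^ 3 * w r ^ α)
      ((continuousOn_const.mul L.continuousOn_flux).sub
        (ContinuousOn.mul (by fun_prop) (L.continuousOn_rpow α))) (by simp) hd
      (fun r hr => by
        have h1 := L.deriv_neg r hr.1 hr.2
        have h2 := L.c_pos
        have h3 := L.rpow_pos (α - 1) ⟨hr.1.le, hr.2⟩
        have h4 := L.exponent_gt
        have h5 := hr.1
        have h6 : 0 ≤ c * r ^ 3 * (α * w r ^ (α - 1)) := by positivity
        nlinarith) ⟨hr.1.le, hr.2⟩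
  have hV : ∀ r ∈ Ioo 0 R, HasDerivAt (fun r => -deriv w r / r)
      (((2 / r * deriv w r + c * w r ^ α) * r - -deriv w r * 1) / r ^ 2) r := fun r hr =>
    ((L.hasDerivAt_deriv hr).neg.div (hasDerivAt_id r) hr.1.ne').congr_deriv
      (by simp only [id, Pi.neg_apply]; ring)
  refine antitoneOn_of_deriv_nonpos (convex_Ioo _ _)
    (fun r hr => (hV r hr).continuousAt.continuousWithinAt) ?_ ?_ <;> rw [interior_Ioo]
  · exact fun r hr => (hV r hr).differentiableAt.differentiableWithinAt
  · intro r hr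
    rw [(hV r hr).deriv]
    refine div_nonpos_of_nonpos_of_nonneg ?_ (sq_nonneg r)
    have h1 : (2 / r * deriv w r + c * w r ^ α) * r - -deriv w r * 1 =
        -(-3 * (r ^ 2 * deriv w r) - c * r ^ 3 * w r ^ α) / r ^ 2 := by
      have := hr.1.ne'
      field_simp
      ring
    rw [h1]
    exact div_nonpos_of_nonpos_of_nonneg (neg_nonpos.2 (hT r hr)) (sq_nonneg r)

theorem le_mul_sub (L : LaneEmdenProfile α c R w) {r : ℝ} (hr : r ∈ Ioo 0 R) :
    w r ≤ c / 3 * R * (R - r) := by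
  obtain ⟨t, ht, he⟩ := exists_hasDerivAt_eq_slope w (deriv w) hr.2
    (L.cont.mono (Icc_subset_Icc_left hr.1.le)) fun t ht => L.hasDerivAt ⟨hr.1.trans ht.1, ht.2⟩
  have ht0 : 0 < t := hr.1.trans ht.1
  have h1 := L.neg_deriv_div_le ⟨ht0, ht.2⟩
  rw [he, L.endpoint, zero_sub, ← neg_div, neg_neg, div_div,
    div_le_iff₀ (mul_pos (sub_pos.2 hr.2) ht0)] at h1
  have h2 := L.c_pos
  nlinarith [mul_le_mul_of_nonneg_left ht.2.le (mul_nonneg h2.le (sub_nonneg.2 hr.2.le))]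

theorem singularSL (L : LaneEmdenProfile α c R w) :
    SingularSL R ((α - 3) * (c / 3)) (R ^ 4) (c / 3 * R * R ^ 4)
      (fun r => w r ^ (1 + α) * r ^ 4) (fun r => w r ^ α * r ^ 4)
      (fun r => (α - 3) * (-deriv w r / r)) (fun r => (w r ^ (1 + α))⁻¹) where
  R_pos := L.R_pos
  p_cont := ((L.continuousOn_rpow _).mono Ioo_subset_Ico_self).mul (by fun_prop)
  q_cont := ((L.continuousOn_rpow _).mono Ioo_subset_Ico_self).mul (by fun_prop)
  U_cont := continuousOn_const.mul (ContinuousOn.div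
    (fun r hr => (L.hasDerivAt_deriv hr).continuousAt.continuousWithinAt.neg) continuousOn_id
    fun r hr => hr.1.ne')
  H_cont := (L.continuousOn_rpow _).inv₀ fun r hr => (L.rpow_pos _ hr).ne'
  p_pos r hr := mul_pos (L.rpow_pos _ ⟨hr.1.le, hr.2⟩) (pow_pos hr.1 4)
  q_pos r hr := mul_pos (L.rpow_pos _ ⟨hr.1.le, hr.2⟩) (pow_pos hr.1 4)
  U_pos r hr := mul_pos (sub_pos.2 L.exponent_gt)
    (div_pos (neg_pos.2 (L.deriv_neg r hr.1 hr.2)) hr.1)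
  H_nonneg r hr := (inv_pos.2 (L.rpow_pos _ hr)).le
  U_le r hr := mul_le_mul_of_nonneg_left (L.neg_deriv_div_le hr) (sub_nonneg.2 L.exponent_gt.le)
  U_anti := fun _ hr _ hs hrs => mul_le_mul_of_nonneg_left (L.antitoneOn_neg_deriv_div hr hs hrs)
    (sub_nonneg.2 L.exponent_gt.le)
  q_le r hr := by
    have h1 := L.rpow_le_one hr (β := α) (by linarith [L.exponent_gt])
    have h2 : r ^ 4 ≤ R ^ 4 := pow_le_pow_left₀ hr.1.le hr.2.le 4
    calc w r ^ α * r ^ 4 ≤ 1 * R ^ 4 := by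
          have := hr.1
          gcongr
      _ = R ^ 4 := one_mul _
  q_le_p t ht s hs := by
    have hs' : s ∈ Ioo 0 R := ⟨hs.1, hs.2.trans_lt ht.2⟩
    rw [inv_mul_cancel_left₀ (L.rpow_pos _ ⟨ht.1.le, ht.2⟩).ne']
    have h1 := L.rpow_le_one hs' (β := α) (by linarith [L.exponent_gt])
    have h2 : s ^ 4 ≤ t ^ 4 := pow_le_pow_left₀ hs.1.le hs.2 4
    calc w s ^ α * s ^ 4 ≤ 1 * t ^ 4 := by
          have := hs.1
          gcongr
      _ = t ^ 4 := one_mul _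
  p_le r hr := by
    have h0 := L.pos r hr.1.le hr.2
    have h1 := L.rpow_le_one hr (β := α) (by linarith [L.exponent_gt])
    have h2 : r ^ 4 ≤ R ^ 4 := pow_le_pow_left₀ hr.1.le hr.2.le 4
    have h3 := L.le_mul_sub hr
    calc w r ^ (1 + α) * r ^ 4 = w r * w r ^ α * r ^ 4 := by rw [Real.rpow_add h0, Real.rpow_one]
      _ ≤ c / 3 * R * (R - r) * 1 * R ^ 4 := by
          have h5 := L.rpow_pos α ⟨hr.1.le, hr.2⟩
          have h6 := hr.1
          have h7 := h0.le.trans h3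
          gcongr
      _ = c / 3 * R * R ^ 4 * (R - r) := by ring

end LaneEmdenProfile

theorem exists_abs_sub_mul_abs_lt {a b c ε : ℝ} {F : ℝ → ℝ} (hab : a < b) (hc : c ∈ Icc a b)
    (hF : IntegrableOn F (Ioo a b)) (hε : 0 < ε) : ∃ r ∈ Ioo a b, |r - c| * |F r| < ε := by
  by_contra! hge
  have hfint : IntegrableOn (fun r => (r - c)⁻¹) (Ioo a b) := by
    refine Integrable.mono' (hF.norm.const_mul ε⁻¹) (by fun_prop) ?_
    refine (ae_restrict_mem measurableSet_Ioo).mono fun r hr => ?_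
    rw [norm_eq_abs, norm_eq_abs, abs_inv]
    rcases (abs_nonneg (r - c)).eq_or_lt with h0 | h0
    · rw [← h0, inv_zero]
      positivity
    · rw [← div_eq_inv_mul, inv_le_comm₀ h0 (by
        have := hge r hr
        exact div_pos (pos_of_mul_pos_right (hε.trans_le this) h0.le) hε), inv_div,
        div_le_iff₀ (pos_of_mul_pos_right (hε.trans_le (hge r hr)) h0.le)]
      exact hge r hr
  rw [← intervalIntegrable_iff_integrableOn_Ioo_of_le hab.le, intervalIntegrable_sub_inv_iff,
    uIcc_of_le hab.le] at hfint
  exact hfint.elim hab.ne fun h => h hc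

/-- If `g' ≤ f` on `(0, R)` and `g` is dominated by `r (R - r) F` with `F` integrable, then the
boundary terms disappear and `0 ≤ ∫ f`. -/
theorem integral_nonneg_of_hasDerivAt_le {R : ℝ} {f g g' F : ℝ → ℝ} (hR : 0 < R)
    (hg : ∀ r ∈ Ioo 0 R, HasDerivAt g (g' r) r) (hle : ∀ r ∈ Ioo 0 R, g' r ≤ f r)
    (hf : IntegrableOn f (Ioo 0 R)) (hF : IntegrableOn F (Ioo 0 R))
    (hgF : ∀ r ∈ Ioo 0 R, |g r| ≤ r * (R - r) * |F r|) : 0 ≤ ∫ r in Ioo 0 R, f r := by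
  have hn : ∀ n : ℕ, (0 : ℝ) < 1 / (n + 1 : ℝ) := fun n => Nat.one_div_pos_of_nat
  have hn1 : ∀ n : ℕ, 1 / (n + 1 : ℝ) ≤ 1 := fun n => by
    rw [div_le_one (by positivity)]
    linarith [n.cast_nonneg (α := ℝ)]
  have hlim : Tendsto (fun n : ℕ => 1 / (n + 1 : ℝ)) atTop (nhds 0) :=
    tendsto_one_div_add_atTop_nhds_zero_nat
  have hleft : ∀ n : ℕ, ∃ r ∈ Ioo 0 (R / 2 * (1 / (n + 1 : ℝ))), |g r| ≤ R * (1 / (n + 1 : ℝ)) := by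
    intro n
    have hpos : 0 < R / 2 * (1 / (n + 1 : ℝ)) := mul_pos (by linarith) (hn n)
    have hlt : R / 2 * (1 / (n + 1 : ℝ)) < R := by nlinarith [hn1 n]
    obtain ⟨r, hr, hlt'⟩ := exists_abs_sub_mul_abs_lt hpos ⟨le_rfl, hpos.le⟩
      (hF.mono_set (Ioo_subset_Ioo_right hlt.le)) (hn n)
    refine ⟨r, hr, (hgF r ⟨hr.1, hr.2.trans hlt⟩).trans ?_⟩
    rw [sub_zero, abs_of_pos hr.1] at hlt'
    have h0 : 0 ≤ r * |F r| := mul_nonneg hr.1.le (abs_nonneg _)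
    have h1 := hr.1
    calc r * (R - r) * |F r| = (R - r) * (r * |F r|) := by ring
      _ ≤ R * (1 / (n + 1 : ℝ)) := mul_le_mul (by linarith) hlt'.le h0 hR.le
  have hright : ∀ n : ℕ, ∃ r ∈ Ioo (R - R / 2 * (1 / (n + 1 : ℝ))) R,
      |g r| ≤ R * (1 / (n + 1 : ℝ)) := by
    intro n
    have hpos : 0 < R / 2 * (1 / (n + 1 : ℝ)) := mul_pos (by linarith) (hn n)
    have hlt : R / 2 * (1 / (n + 1 : ℝ)) < R := by nlinarith [hn1 n]
    obtain ⟨r, hr, hlt'⟩ := exists_abs_sub_mul_abs_lt (sub_lt_self R hpos)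
      ⟨by linarith, le_refl R⟩ (hF.mono_set (Ioo_subset_Ioo_left (by linarith))) (hn n)
    refine ⟨r, hr, (hgF r ⟨by linarith [hr.1], hr.2⟩).trans ?_⟩
    rw [abs_of_neg (sub_neg.2 hr.2), neg_sub] at hlt'
    have h0 : 0 ≤ (R - r) * |F r| := mul_nonneg (by linarith [hr.2]) (abs_nonneg _)
    calc r * (R - r) * |F r| = r * ((R - r) * |F r|) := by ring
      _ ≤ R * (1 / (n + 1 : ℝ)) := mul_le_mul hr.2.le hlt'.le h0 hR.le
  choose a ha hga using hleft
  choose b hb hgb using hright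
  have hhalf : ∀ n : ℕ, R / 2 * (1 / (n + 1 : ℝ)) ≤ R / 2 := fun n => by nlinarith [hn1 n]
  have hab : ∀ n, a n ≤ b n := fun n => by linarith [(ha n).2, (hb n).1, hhalf n]
  have hsub : ∀ n, Icc (a n) (b n) ⊆ Ioo 0 R := fun n r hr =>
    ⟨(ha n).1.trans_le hr.1, hr.2.trans_lt (hb n).2⟩
  have hlim2 : Tendsto (fun n : ℕ => R / 2 * (1 / (n + 1 : ℝ))) atTop (nhds 0) := by
    simpa using hlim.const_mul (R / 2)
  have hlima : Tendsto a atTop (nhds 0) :=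
    squeeze_zero (fun n => (ha n).1.le) (fun n => (ha n).2.le) hlim2
  have hlimb : Tendsto b atTop (nhds R) := by
    refine tendsto_of_tendsto_of_tendsto_of_le_of_le (g := fun n : ℕ => R - R / 2 * (1 / (n + 1 : ℝ)))
      (h := fun _ => R) ?_ tendsto_const_nhds (fun n => (hb n).1.le) (fun n => (hb n).2.le)
    simpa using hlim2.const_sub R
  have hfint := (aecover_Ioo_of_Ioc (μ := volume) hlima hlimb).integral_tendsto_of_countably_generated
    hf
  have hlow : Tendsto (fun n : ℕ => -(2 * R) * (1 / (n + 1 : ℝ))) atTop (nhds 0) := by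
    simpa using hlim.const_mul (-(2 * R))
  refine le_of_tendsto_of_tendsto' hlow hfint fun n => ?_
  have hcont : ContinuousOn g (Icc (a n) (b n)) := fun r hr =>
    (hg r (hsub n hr)).continuousAt.continuousWithinAt
  have hftc := intervalIntegral.sub_le_integral_of_hasDeriv_right_of_le (hab n) hcont
    (fun r hr => (hg r (hsub n (Ioo_subset_Icc_self hr))).hasDerivWithinAt)
    (hf.mono_set (hsub n)) (fun r hr => hle r (hsub n (Ioo_subset_Icc_self hr)))
  rw [intervalIntegral.integral_of_le (hab n)] at hftc
  rw [Measure.restrict_restrict measurableSet_Ioc,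
    inter_eq_left.2 (Ioc_subset_Icc_self.trans (hsub n))]
  linarith [(abs_le.1 (hga n)).2, (abs_le.1 (hgb n)).1]

theorem integral_const_mul_sub_add {s : Set ℝ} {f g k : ℝ → ℝ} (μ : ℝ) (hf : IntegrableOn f s)
    (hg : IntegrableOn g s) (hk : IntegrableOn k s) :
    IntegrableOn (fun r => μ * f r - g r + k r) s ∧
      ∫ r in s, (μ * f r - g r + k r) =
        μ * (∫ r in s, f r) - (∫ r in s, g r) + ∫ r in s, k r := by
  have h1 : IntegrableOn (fun r => μ * f r - g r) s := (hf.const_mul μ).sub hg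
  refine ⟨h1.add hk, ?_⟩
  rw [integral_add h1 hk, integral_sub (hf.const_mul μ) hg, integral_const_mul]

namespace IsRegularSol

variable {R M B C E K μ : ℝ} {p q U H φ P : ℝ → ℝ}

/-- Picone's inequality against a positive regular solution. -/
theorem picone (h : IsRegularSol R p q U μ φ P) (S : SingularSL R M B C p q U H)
    (hpos : ∀ r ∈ Ico 0 R, 0 < φ r) (hK : ∀ r ∈ Ioo 0 R, |P r| ≤ r * (R - r) * (K * q r * φ r))
    {ψ : ℝ → ℝ} (hψ : DifferentiableOn ℝ ψ (Ioo 0 R))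
    (hp : IntegrableOn (fun r => p r * _root_.deriv ψ r ^ 2) (Ioo 0 R))
    (hU : IntegrableOn (fun r => U r * q r * ψ r ^ 2) (Ioo 0 R))
    (hq : IntegrableOn (fun r => q r * ψ r ^ 2) (Ioo 0 R)) :
    (∫ r in Ioo 0 R, U r * q r * ψ r ^ 2) - ∫ r in Ioo 0 R, p r * _root_.deriv ψ r ^ 2 ≤
      μ * ∫ r in Ioo 0 R, q r * ψ r ^ 2 := by
  have hd : ∀ r ∈ Ioo 0 R, HasDerivAt ψ (_root_.deriv ψ r) r := fun r hr =>
    (hψ.differentiableAt (isOpen_Ioo.mem_nhds hr)).hasDerivAt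
  obtain ⟨hfint, hsplit⟩ := integral_const_mul_sub_add μ hq hU hp
  have key := integral_nonneg_of_hasDerivAt_le S.R_pos
    (f := fun r => μ * (q r * ψ r ^ 2) - U r * q r * ψ r ^ 2 + p r * _root_.deriv ψ r ^ 2)
    (g := fun r => P r / φ r * ψ r ^ 2) (F := fun r => K * (q r * ψ r ^ 2))
    (fun r hr => ((h.flux_deriv r hr).div (h.deriv r hr) (hpos r ⟨hr.1.le, hr.2⟩).ne').mul
      ((hd r hr).pow 2)) ?_ hfint (hq.const_mul K) ?_
  · rw [hsplit] at key
    linarith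
  · intro r hr
    have h1 := (hpos r ⟨hr.1.le, hr.2⟩).ne'
    have h2 := S.p_pos r hr
    rw [← sub_nonneg]
    have h3 : 0 ≤ (p r * _root_.deriv ψ r - P r / φ r * ψ r) ^ 2 / p r := by positivity
    refine h3.trans_eq ?_
    have h4 := h2.ne'
    simp only [Pi.pow_apply, Pi.div_apply]
    field_simp
    ring
  · intro r hr
    have h1 := hpos r ⟨hr.1.le, hr.2⟩
    have h2 : |P r / φ r| ≤ r * (R - r) * (K * q r) := by
      rw [abs_div, abs_of_pos h1, div_le_iff₀ h1]
      linarith [hK r hr]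
    have h3 : 0 ≤ r * (R - r) := mul_nonneg hr.1.le (sub_nonneg.2 hr.2.le)
    calc |P r / φ r * ψ r ^ 2| = |P r / φ r| * ψ r ^ 2 := by
          rw [abs_mul, abs_of_nonneg (sq_nonneg (ψ r))]
      _ ≤ r * (R - r) * (K * q r) * ψ r ^ 2 := mul_le_mul_of_nonneg_right h2 (sq_nonneg _)
      _ = r * (R - r) * (K * (q r * ψ r ^ 2)) := by ring
      _ ≤ r * (R - r) * |K * (q r * ψ r ^ 2)| := mul_le_mul_of_nonneg_left (le_abs_self _) h3

/-- A ground state whose flux vanishes at the endpoints is admissible and attains equality in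
Picone's inequality. -/
theorem ground_state_identity (h : IsRegularSol R p q U μ φ P) (S : SingularSL R M B C p q U H)
    (hpos : ∀ r ∈ Ico 0 R, 0 < φ r) (hanti : AntitoneOn φ (Ico 0 R))
    (hK : ∀ r ∈ Ioo 0 R, |P r| ≤ r * (R - r) * (K * q r * φ r))
    (hE : ∀ r ∈ Ioo 0 R, q r ^ 2 ≤ E * p r) :
    IntegrableOn (fun r => p r * _root_.deriv φ r ^ 2) (Ioo 0 R) ∧
    IntegrableOn (fun r => U r * q r * φ r ^ 2) (Ioo 0 R) ∧
    IntegrableOn (fun r => q r * φ r ^ 2) (Ioo 0 R) ∧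
    0 < ∫ r in Ioo 0 R, q r * φ r ^ 2 ∧
    (∫ r in Ioo 0 R, U r * q r * φ r ^ 2) - ∫ r in Ioo 0 R, p r * _root_.deriv φ r ^ 2 =
      μ * ∫ r in Ioo 0 R, q r * φ r ^ 2 := by
  have hR := S.R_pos
  have hM := S.M_pos
  have hφ1 : ∀ r ∈ Ioo 0 R, φ r ^ 2 ≤ 1 := fun r hr =>
    pow_le_one₀ (hpos r ⟨hr.1.le, hr.2⟩).le (h.le_one hanti r ⟨hr.1.le, hr.2⟩)
  have hφc : ContinuousOn φ (Ioo 0 R) := h.cont.mono Ioo_subset_Ico_self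
  have hPc : ContinuousOn P (Ioo 0 R) := h.flux_cont.mono Ioo_subset_Ico_self
  have bounded : ∀ {f : ℝ → ℝ} (D : ℝ), ContinuousOn f (Ioo 0 R) → (∀ r ∈ Ioo 0 R, |f r| ≤ D) →
      IntegrableOn f (Ioo 0 R) := fun D hf hD =>
    IntegrableOn.of_bound (by simp) (hf.aestronglyMeasurable measurableSet_Ioo) D
      ((ae_restrict_mem measurableSet_Ioo).mono hD)
  have hq : IntegrableOn (fun r => q r * φ r ^ 2) (Ioo 0 R) := by
    refine bounded (B * 1) (S.q_cont.mul (hφc.pow 2)) fun r hr => ?_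
    have h1 := S.q_pos r hr
    have h2 := S.q_le r hr
    rw [abs_of_nonneg (by positivity)]
    exact mul_le_mul h2 (hφ1 r hr) (sq_nonneg _) (h1.le.trans h2)
  have hU : IntegrableOn (fun r => U r * q r * φ r ^ 2) (Ioo 0 R) := by
    refine bounded (M * B * 1) ((S.U_cont.mul S.q_cont).mul (hφc.pow 2)) fun r hr => ?_
    have h1 := S.q_pos r hr
    have h2 := S.q_le r hr
    have h3 := S.U_pos r hr
    rw [abs_of_nonneg (by positivity)]
    exact mul_le_mul (mul_le_mul (S.U_le r hr) h2 h1.le hM.le) (hφ1 r hr) (sq_nonneg _)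
      (mul_nonneg hM.le (h1.le.trans h2))
  have hp' : IntegrableOn (fun r => p r * (P r / p r) ^ 2) (Ioo 0 R) := by
    refine bounded ((R * R * K) ^ 2 * E) (S.p_cont.mul
      ((hPc.div S.p_cont fun r hr => (S.p_pos r hr).ne').pow 2)) fun r hr => ?_
    have hpr := S.p_pos r hr
    have hqr := S.q_pos r hr
    have hφr := hpos r ⟨hr.1.le, hr.2⟩
    have hr0 := hr.1
    have hdr : 0 ≤ R - r := sub_nonneg.2 hr.2.le
    rw [abs_of_nonneg (by positivity)]
    have h1 : p r * (P r / p r) ^ 2 = |P r| ^ 2 / p r := by rw [sq_abs]; field_simp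
    have h2 : |P r| ^ 2 ≤ (r * (R - r)) ^ 2 * K ^ 2 * (q r ^ 2 * φ r ^ 2) :=
      (pow_le_pow_left₀ (abs_nonneg _) (hK r hr) 2).trans_eq (by ring)
    have h3 : r * (R - r) ≤ R * R := mul_le_mul hr.2.le (by linarith) hdr hR.le
    have h4 : q r ^ 2 * φ r ^ 2 ≤ E * p r :=
      (mul_le_of_le_one_right (sq_nonneg _) (hφ1 r hr)).trans (hE r hr)
    rw [h1, div_le_iff₀ hpr]
    calc |P r| ^ 2 ≤ (r * (R - r)) ^ 2 * K ^ 2 * (q r ^ 2 * φ r ^ 2) := h2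
      _ ≤ (R * R) ^ 2 * K ^ 2 * (E * p r) := by gcongr
      _ = (R * R * K) ^ 2 * E * p r := by ring
  have hp : IntegrableOn (fun r => p r * _root_.deriv φ r ^ 2) (Ioo 0 R) :=
    hp'.congr_fun (fun r hr => by simp only [(h.deriv r hr).deriv]) measurableSet_Ioo
  have hq0 : 0 < ∫ r in Ioo 0 R, q r * φ r ^ 2 := by
    have hpos' : ∀ r ∈ Ioo 0 R, 0 < q r * φ r ^ 2 := fun r hr =>
      mul_pos (S.q_pos r hr) (pow_pos (hpos r ⟨hr.1.le, hr.2⟩) 2)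
    rw [setIntegral_pos_iff_support_of_nonneg_ae
      ((ae_restrict_mem measurableSet_Ioo).mono fun r hr => (hpos' r hr).le) hq,
      inter_eq_right.2 fun r hr => Function.mem_support.2 (hpos' r hr).ne']
    simpa using hR
  refine ⟨hp, hU, hq, hq0, ?_⟩
  have hderiv : ∀ r ∈ Ioo 0 R, HasDerivAt (fun r => P r * φ r)
      (μ * (q r * φ r ^ 2) - U r * q r * φ r ^ 2 + p r * _root_.deriv φ r ^ 2) r := fun r hr => by
    refine ((h.flux_deriv r hr).mul (h.deriv r hr)).congr_deriv ?_
    rw [(h.deriv r hr).deriv]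
    have := (S.p_pos r hr).ne'
    field_simp
  have hbd : ∀ r ∈ Ioo 0 R, |P r * φ r| ≤ r * (R - r) * |K * (q r * φ r ^ 2)| := fun r hr => by
    have h1 := hpos r ⟨hr.1.le, hr.2⟩
    have h3 : 0 ≤ r * (R - r) := mul_nonneg hr.1.le (sub_nonneg.2 hr.2.le)
    rw [abs_mul, abs_of_pos h1]
    calc |P r| * φ r ≤ r * (R - r) * (K * q r * φ r) * φ r :=
          mul_le_mul_of_nonneg_right (hK r hr) h1.le
      _ = r * (R - r) * (K * (q r * φ r ^ 2)) := by ring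
      _ ≤ r * (R - r) * |K * (q r * φ r ^ 2)| := mul_le_mul_of_nonneg_left (le_abs_self _) h3
  obtain ⟨hfint, hsplit⟩ := integral_const_mul_sub_add μ hq hU hp
  have h1 := integral_nonneg_of_hasDerivAt_le hR hderiv (fun r _ => le_rfl) hfint
    (hq.const_mul K) hbd
  have h2 := integral_nonneg_of_hasDerivAt_le hR (fun r hr => (hderiv r hr).neg)
    (fun r _ => le_rfl) hfint.neg (hq.const_mul K)
    (fun r hr => by simpa only [Pi.neg_apply, abs_neg] using hbd r hr)
  rw [integral_neg, neg_nonneg] at h2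
  linarith

end IsRegularSol

namespace LaneEmdenProfile

variable {α c R : ℝ} {w : ℝ → ℝ}

theorem exists_flux_bound (L : LaneEmdenProfile α c R w) {μ : ℝ} {φ P : ℝ → ℝ}
    (hμ : μ ∈ Icc 0 ((α - 3) * (c / 3) + 1))
    (h : IsRegularSol R (fun r => w r ^ (1 + α) * r ^ 4) (fun r => w r ^ α * r ^ 4)
      (fun r => (α - 3) * (-deriv w r / r)) μ φ P)
    (hpos : ∀ r ∈ Ico 0 R, 0 < φ r) (hanti : AntitoneOn φ (Ico 0 R)) :
    ∃ K, ∀ r ∈ Ioo 0 R, |P r| ≤ r * (R - r) * (K * (w r ^ α * r ^ 4) * φ r) := by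
  have hR := L.R_pos
  have hα : 0 ≤ α := by linarith [L.exponent_gt]
  have hm : R / 2 ∈ Ico 0 R := ⟨by linarith, by linarith⟩
  have hφm := hpos _ hm
  have hwm := L.rpow_pos α hm
  obtain ⟨N, hN⟩ : ∃ N, N = (α - 3) * (c / 3) + 1 := ⟨_, rfl⟩
  have hN0 : 0 < N := by linarith [L.singularSL.M_pos]
  have hmono : ∀ r ∈ Ico 0 R, ∀ s ∈ Ico r R, w s ^ α ≤ w r ^ α := fun r hr s hs =>
    Real.rpow_le_rpow (L.pos s (hr.1.trans hs.1) hs.2).le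
      (L.antitoneOn ⟨hr.1, hr.2.le⟩ ⟨hr.1.trans hs.1, hs.2.le⟩ hs.1) hα
  refine ⟨32 * N / R + N / (R / 2 * w (R / 2) ^ α * φ (R / 2)), fun r hr => ?_⟩
  have hr' : r ∈ Ico 0 R := ⟨hr.1.le, hr.2⟩
  have hφr := hpos r hr'
  have hwr := L.rpow_pos α hr'
  have hr0 := hr.1
  have hdr : 0 < R - r := sub_pos.2 hr.2
  rcases le_total (R / 2) r with hle | hle
  · have hb := h.abs_flux_le_right L.singularSL hμ hpos hanti hr (D := w r ^ α * R ^ 4)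
      fun s hs => by
        have h1 := hmono r hr' s ⟨hs.1.le, hs.2⟩
        have h2 : s ^ 4 ≤ R ^ 4 := pow_le_pow_left₀ (hr.1.trans hs.1).le hs.2.le 4
        exact mul_le_mul h1 h2 (by have := hr.1.trans hs.1; positivity) hwr.le
    rw [← hN] at hb
    have h5 : R ^ 5 ≤ 32 * r ^ 5 :=
      calc R ^ 5 ≤ (2 * r) ^ 5 := pow_le_pow_left₀ hR.le (by linarith) 5
        _ = 32 * r ^ 5 := by ring
    calc |P r| ≤ N * (w r ^ α * R ^ 4) * φ r * (R - r) := hb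
      _ = N * w r ^ α * φ r * (R - r) / R * R ^ 5 := by field_simp
      _ ≤ N * w r ^ α * φ r * (R - r) / R * (32 * r ^ 5) := by gcongr
      _ = r * (R - r) * (32 * N / R * (w r ^ α * r ^ 4) * φ r) := by ring
      _ ≤ _ := by
        gcongr
        exact le_add_of_nonneg_right (by positivity)
  · have hb := h.abs_flux_le_left L.singularSL hμ hpos hanti hr (D := r ^ 4) fun s hs => by
      have h1 := L.rpow_le_one ⟨hs.1, hs.2.trans hr.2⟩ hα
      have h2 : s ^ 4 ≤ r ^ 4 := pow_le_pow_left₀ hs.1.le hs.2.le 4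
      exact (mul_le_of_le_one_left (by positivity) h1).trans h2
    rw [← hN] at hb
    have h1 := hmono r hr' (R / 2) ⟨hle, hm.2⟩
    have h2 := hanti hr' hm hle
    have h3 : R / 2 ≤ R - r := by linarith
    calc |P r| ≤ N * r ^ 4 * r := hb
      _ = N / (R / 2 * w (R / 2) ^ α * φ (R / 2)) * r ^ 4 * r *
          (R / 2 * w (R / 2) ^ α * φ (R / 2)) := by field_simp
      _ ≤ N / (R / 2 * w (R / 2) ^ α * φ (R / 2)) * r ^ 4 * r * ((R - r) * w r ^ α * φ r) := by
        gcongr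
      _ = r * (R - r) * (N / (R / 2 * w (R / 2) ^ α * φ (R / 2)) * (w r ^ α * r ^ 4) * φ r) := by
        ring
      _ ≤ _ := by
        gcongr
        exact le_add_of_nonneg_left (by positivity)

theorem deriv_rpow_mul_eq (L : LaneEmdenProfile α c R w) (ψ : ℝ → ℝ) {r : ℝ} (hr : r ∈ Ioo 0 R) :
    deriv (fun s => w s ^ (1 + α)) r * r ^ 3 * ψ r ^ 2 =
      -((1 + α) / (α - 3)) * ((α - 3) * (-deriv w r / r) * (w r ^ α * r ^ 4) * ψ r ^ 2) := by
  have h1 := hr.1.ne'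
  have h2 := (sub_pos.2 L.exponent_gt).ne'
  rw [(L.hasDerivAt_rpow (1 + α) hr).deriv, add_sub_cancel_left]
  field_simp

theorem integrableOn_iff (L : LaneEmdenProfile α c R w) (ψ : ℝ → ℝ) :
    IntegrableOn (fun r => deriv (fun s => w s ^ (1 + α)) r * r ^ 3 * ψ r ^ 2) (Ioo 0 R) ↔
      IntegrableOn (fun r => (α - 3) * (-deriv w r / r) * (w r ^ α * r ^ 4) * ψ r ^ 2)
        (Ioo 0 R) := by
  have h1 : (1 + α) / (α - 3) ≠ 0 :=
    div_ne_zero (by linarith [L.exponent_gt]) (by linarith [L.exponent_gt])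
  rw [integrableOn_congr_fun (fun r hr => L.deriv_rpow_mul_eq ψ hr) measurableSet_Ioo]
  exact integrable_const_mul_iff (IsUnit.mk0 _ (neg_ne_zero.2 h1)) _

theorem Qfun_eq (L : LaneEmdenProfile α c R w) (ψ : ℝ → ℝ) :
    Qfun α R w ψ = (1 + α) / α *
      ((∫ r in Ioo 0 R, (α - 3) * (-deriv w r / r) * (w r ^ α * r ^ 4) * ψ r ^ 2) -
        ∫ r in Ioo 0 R, w r ^ (1 + α) * r ^ 4 * deriv ψ r ^ 2) := by
  have h0 := L.exponent_gt
  have h1 : α ≠ 0 := by linarith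
  have h2 : α - 3 ≠ 0 := by linarith
  rw [Qfun, setIntegral_congr_fun measurableSet_Ioo fun r hr => L.deriv_rpow_mul_eq ψ hr,
    integral_const_mul]
  field_simp
  ring

end LaneEmdenProfile

/-- The variational value `μ₀ = sup{Q(φ) : ‖φ‖ < ∞, I(φ) = 1}` is finite and
strictly positive, and it is attained by some admissible `φ₀`. -/
theorem laneEmden_variational_problem
    (α c R : ℝ) (hα : 3 < α) (hα' : α < 5) (hc : 0 < c) (hR : 0 < R)
    (w : ℝ → ℝ)
    (hw_cont : ContinuousOn w (Set.Icc 0 R))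
    (hw_smooth : ContDiffOn ℝ (⊤ : ℕ∞) w (Set.Ico 0 R))
    (hw0 : w 0 = 1) (hw'0 : deriv w 0 = 0)
    (hw_pos : ∀ r, 0 ≤ r → r < R → 0 < w r)
    (hwR : w R = 0)
    (hw_dec : ∀ r, 0 < r → r < R → deriv w r < 0)
    (hw_pv : ∃ w'R : ℝ, w'R < 0 ∧
      Filter.Tendsto (deriv w) (nhdsWithin R (Set.Iio R)) (nhds w'R))
    (hw_ode : ∀ r, 0 < r → r < R →
      deriv (deriv w) r + (2 / r) * deriv w r + c * w r ^ α = 0) :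
    ∃ μ₀ : ℝ,
      IsLUB {q : ℝ | ∃ φ : ℝ → ℝ, DifferentiableOn ℝ φ (Set.Ioo 0 R) ∧
          FiniteNorm α R w φ ∧ Ifun α R w φ = 1 ∧ q = Qfun α R w φ} μ₀ ∧
      0 < μ₀ ∧
      ∃ φ₀ : ℝ → ℝ, DifferentiableOn ℝ φ₀ (Set.Ioo 0 R) ∧ FiniteNorm α R w φ₀ ∧
        Ifun α R w φ₀ = 1 ∧ Qfun α R w φ₀ = μ₀ := by
  have L : LaneEmdenProfile α c R w :=
    ⟨hα, hc, hR, hw_cont, hw_smooth, hw0, hw_pos, hwR, hw_dec, hw_ode⟩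
  have S := L.singularSL
  obtain ⟨μ, hμ, hμ0, φ, P, h, hpos, hanti⟩ := S.exists_groundState
  obtain ⟨K, hK⟩ := L.exists_flux_bound hμ h hpos hanti
  have hE : ∀ r ∈ Ioo 0 R, (w r ^ α * r ^ 4) ^ 2 ≤ R ^ 4 * (w r ^ (1 + α) * r ^ 4) := by
    intro r hr
    have h0 := hw_pos r hr.1.le hr.2
    have h1 := L.rpow_le_one hr (β := α - 1) (by linarith)
    have h2 : r ^ 4 ≤ R ^ 4 := pow_le_pow_left₀ hr.1.le hr.2.le 4
    have h3 : w r ^ α * w r ^ α = w r ^ (α - 1) * w r ^ (1 + α) := by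
      rw [← Real.rpow_add h0, ← Real.rpow_add h0]
      ring_nf
    have h4 := L.rpow_pos (1 + α) ⟨hr.1.le, hr.2⟩
    have hr0 := hr.1
    calc (w r ^ α * r ^ 4) ^ 2 = w r ^ α * w r ^ α * r ^ 4 * r ^ 4 := by ring
      _ = w r ^ (α - 1) * w r ^ (1 + α) * r ^ 4 * r ^ 4 := by rw [h3]
      _ ≤ 1 * w r ^ (1 + α) * r ^ 4 * R ^ 4 := by gcongr
      _ = R ^ 4 * (w r ^ (1 + α) * r ^ 4) := by ring
  obtain ⟨hp, hU, hq, hI, heq⟩ := h.ground_state_identity S hpos hanti hK hE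
  have hβ : 0 < (1 + α) / α := div_pos (by linarith) (by linarith)
  obtain ⟨a, ha⟩ : ∃ a, a ^ 2 * (∫ r in Ioo 0 R, w r ^ α * r ^ 4 * φ r ^ 2) = 1 :=
    ⟨(√(∫ r in Ioo 0 R, w r ^ α * r ^ 4 * φ r ^ 2))⁻¹, by
      rw [inv_pow, sq_sqrt hI.le, inv_mul_cancel₀ hI.ne']⟩
  have hφd : DifferentiableOn ℝ φ (Ioo 0 R) := fun r hr =>
    (h.deriv r hr).differentiableAt.differentiableWithinAt
  have hderiv : ∀ r, deriv (fun s => a * φ s) r = a * deriv φ r := fun r =>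
    deriv_const_mul_field a
  have hp' : (fun r => w r ^ (1 + α) * r ^ 4 * deriv (fun s => a * φ s) r ^ 2) =
      fun r => a ^ 2 * (w r ^ (1 + α) * r ^ 4 * deriv φ r ^ 2) := by
    funext r
    rw [hderiv]
    ring
  have hU' : (fun r => (α - 3) * (-deriv w r / r) * (w r ^ α * r ^ 4) * (a * φ r) ^ 2) =
      fun r => a ^ 2 * ((α - 3) * (-deriv w r / r) * (w r ^ α * r ^ 4) * φ r ^ 2) := by
    funext r
    ring
  have hq' : (fun r => w r ^ α * r ^ 4 * (a * φ r) ^ 2) =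
      fun r => a ^ 2 * (w r ^ α * r ^ 4 * φ r ^ 2) := by
    funext r
    ring
  have hnorm : FiniteNorm α R w fun s => a * φ s := by
    refine ⟨?_, (L.integrableOn_iff _).2 ?_, ?_⟩
    · rw [hp']
      exact hp.const_mul _
    · rw [hU']
      exact hU.const_mul _
    · rw [hq']
      exact hq.const_mul _
  have hIone : Ifun α R w (fun s => a * φ s) = 1 := by
    rw [Ifun, hq', integral_const_mul, ha]
  have hQ : Qfun α R w (fun s => a * φ s) = (1 + α) / α * μ := by
    rw [L.Qfun_eq, hp', hU', integral_const_mul, integral_const_mul, ← mul_sub, heq]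
    linear_combination (1 + α) / α * μ * ha
  refine ⟨(1 + α) / α * μ, ⟨?_, fun b hb => hb ⟨_, hφd.const_mul a, hnorm, hIone, hQ.symm⟩⟩,
    mul_pos hβ hμ0, _, hφd.const_mul a, hnorm, hIone, hQ⟩
  rintro _ ⟨ψ, hψ, ⟨hψp, hψU, hψq⟩, hψI, rfl⟩
  have hpic := h.picone S hpos hK hψ hψp ((L.integrableOn_iff ψ).1 hψU) hψq
  rw [Ifun] at hψI
  rw [hψI, mul_one] at hpic
  rw [L.Qfun_eq]
  exact mul_le_mul_of_nonneg_left hpic hβ.le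
end

section
/- Let 3 < α < 5, let w be a Lane-Emden enthalpy profile, and let φ₀ be a growing-mode profile with eigenvalue μ₀ > 0. Then φ₀ coincides on some interval (0, ε) with a convergent power series Σ_{n≥0} aₙ rⁿ; in particular φ₀ extends continuously (indeed real-analytically) to r = 0 and φ₀(r) = φ₀(0) + O(r) as r → 0⁺. -/
open MeasureTheory Real Filter Set Asymptotics

section SingularPicard

variable {E : Type*} [NormedAddCommGroup E] [NormedSpace ℂ E]

theorem ofReal_mul_mem_ball {ρ : ℝ} {z : ℂ} (hz : z ∈ Metric.ball (0 : ℂ) ρ) {t : ℝ}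
    (ht : t ∈ Icc (0 : ℝ) 1) : (t : ℂ) * z ∈ Metric.ball (0 : ℂ) ρ := by
  rw [mem_ball_zero_iff] at hz ⊢
  rw [norm_mul, Complex.norm_real, Real.norm_of_nonneg ht.1]
  exact (mul_le_of_le_one_left (norm_nonneg z) ht.2).trans_lt hz

/-- Weighted averages of a holomorphic function along segments from the origin are holomorphic. -/
theorem differentiableOn_integral_comp_ofReal_mul [CompleteSpace E] {N : ℝ → E →L[ℂ] E}
    (hN : Continuous N)
    {f : ℂ → E} {ρ : ℝ} (hf : DifferentiableOn ℂ f (Metric.ball 0 ρ)) :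
    DifferentiableOn ℂ (fun z => ∫ t in (0 : ℝ)..1, N t (f (t * z))) (Metric.ball 0 ρ) := by
  intro z₀ hz₀
  obtain ⟨r, hzr, hrρ⟩ := exists_between (mem_ball_zero_iff.1 hz₀)
  have hsub : Metric.closedBall (0 : ℂ) r ⊆ Metric.ball 0 ρ :=
    Metric.closedBall_subset_ball hrρ
  have hdf : ContinuousOn (deriv f) (Metric.ball 0 ρ) :=
    (hf.deriv Metric.isOpen_ball).continuousOn
  obtain ⟨C, hC⟩ := (isCompact_closedBall (0 : ℂ) r).exists_bound_of_continuousOn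
    (hdf.mono hsub)
  obtain ⟨D, hD⟩ := (isCompact_Icc (a := (0 : ℝ)) (b := 1)).exists_bound_of_continuousOn
    hN.continuousOn
  have hcont : ∀ {g : ℂ → E}, ContinuousOn g (Metric.ball 0 ρ) → ∀ z ∈ Metric.ball (0 : ℂ) ρ,
      ContinuousOn (fun t : ℝ => N t (g (t * z))) (uIcc 0 1) := by
    intro g hg z hz
    rw [uIcc_of_le zero_le_one]
    refine hN.continuousOn.clm_apply (hg.comp (by fun_prop) fun t ht => ?_)
    exact ofReal_mul_mem_ball hz ht
  have hmem : Metric.ball (0 : ℂ) r ∈ nhds z₀ :=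
    Metric.isOpen_ball.mem_nhds (mem_ball_zero_iff.2 hzr)
  have hsub' : Metric.ball (0 : ℂ) r ⊆ Metric.ball 0 ρ := Metric.ball_subset_ball hrρ.le
  have hd : ContinuousOn (fun t : ℝ => N t ((t : ℂ) • deriv f (t * z₀))) (uIcc 0 1) := by
    have h := (Complex.continuous_ofReal.continuousOn (s := uIcc (0 : ℝ) 1)).smul
      (hcont hdf z₀ hz₀)
    exact h.congr fun t _ => by simp
  have key := intervalIntegral.hasDerivAt_integral_of_dominated_loc_of_deriv_le
    (μ := volume) (a := 0) (b := 1) (F := fun z (t : ℝ) => N t (f (t * z)))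
    (F' := fun z (t : ℝ) => N t ((t : ℂ) • deriv f (t * z))) (x₀ := z₀)
    (bound := fun _ => D * C) hmem ?_ ?_ ?_ ?_ ?_ ?_
  · exact key.2.differentiableAt.differentiableWithinAt
  · filter_upwards [hmem] with z hz
    exact (hcont hf.continuousOn z (hsub' hz)).intervalIntegrable.def'.aestronglyMeasurable
  · exact (hcont hf.continuousOn z₀ hz₀).intervalIntegrable
  · exact hd.intervalIntegrable.def'.aestronglyMeasurable
  · refine .of_forall fun t ht z hz => ?_
    rw [uIoc_of_le zero_le_one] at ht
    have ht' : t ∈ Icc (0 : ℝ) 1 := ⟨ht.1.le, ht.2⟩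
    have h1 := hC _ (Metric.ball_subset_closedBall (ofReal_mul_mem_ball hz ht'))
    have h2 : ‖(t : ℂ) • deriv f (t * z)‖ ≤ C := by
      rw [norm_smul, Complex.norm_real, Real.norm_of_nonneg ht'.1]
      exact (mul_le_of_le_one_left (norm_nonneg _) ht'.2).trans h1
    exact (N t).le_of_opNorm_le_of_le (hD t ht') h2
  · exact intervalIntegrable_const
  · refine .of_forall fun t ht z hz => ?_
    rw [uIoc_of_le zero_le_one] at ht
    have hz' := ofReal_mul_mem_ball (hsub' hz) (t := t) ⟨ht.1.le, ht.2⟩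
    have h1 := (hf.differentiableAt (Metric.isOpen_ball.mem_nhds hz')).hasDerivAt
    have h2 : HasDerivAt (fun z : ℂ => (t : ℂ) * z) (t : ℂ) z := by
      simpa using (hasDerivAt_id z).const_mul (t : ℂ)
    exact ((N t).hasFDerivAt.comp_hasDerivAt z (h1.scomp z h2))

/-- The integral operator whose fixed points solve the singular initial value problem
`Y 0 = Y₀` with right-hand side `F`. -/
noncomputable def singularPicard (N : ℝ → E →L[ℂ] E) (F : ℂ × E → E) (Y₀ : E) (Y : ℂ → E)
    (z : ℂ) : E :=
  Y₀ + z • ∫ t in (0 : ℝ)..1, N t (F (t * z, Y (t * z)))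

/-- `singularPicard` contracts distances along a segment from the origin. -/
theorem norm_singularPicard_sub_le {N : ℝ → E →L[ℂ] E} (hN : Continuous N)
    (hN1 : ∀ t ∈ Icc (0 : ℝ) 1, ‖N t‖ ≤ 1) {F : ℂ × E → E} {Y₀ : E} {K : NNReal}
    {U : Set (ℂ × E)} (hF : LipschitzOnWith K F U) {Y Z : ℂ → E} {z : ℂ} {δ : ℝ}
    (hYc : ContinuousOn (fun t : ℝ => Y (t * z)) (Icc 0 1))
    (hZc : ContinuousOn (fun t : ℝ => Z (t * z)) (Icc 0 1))
    (hYU : ∀ t ∈ Icc (0 : ℝ) 1, ((t : ℂ) * z, Y (t * z)) ∈ U)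
    (hZU : ∀ t ∈ Icc (0 : ℝ) 1, ((t : ℂ) * z, Z (t * z)) ∈ U)
    (hδ : ∀ t ∈ Icc (0 : ℝ) 1, ‖Y (t * z) - Z (t * z)‖ ≤ δ) :
    ‖singularPicard N F Y₀ Y z - singularPicard N F Y₀ Z z‖ ≤ ‖z‖ * (K * δ) := by
  have hint : ∀ {X : ℂ → E}, ContinuousOn (fun t : ℝ => X (t * z)) (Icc 0 1) →
      (∀ t ∈ Icc (0 : ℝ) 1, ((t : ℂ) * z, X (t * z)) ∈ U) →
      IntervalIntegrable (fun t : ℝ => N t (F (t * z, X (t * z)))) volume 0 1 := by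
    intro X hX hXU
    apply ContinuousOn.intervalIntegrable
    rw [uIcc_of_le zero_le_one]
    refine hN.continuousOn.clm_apply (hF.continuousOn.comp ?_ hXU)
    exact ContinuousOn.prodMk (by fun_prop) hX
  rw [singularPicard, singularPicard, add_sub_add_left_eq_sub, ← smul_sub, norm_smul,
    ← intervalIntegral.integral_sub (hint hYc hYU) (hint hZc hZU)]
  gcongr
  have := intervalIntegral.norm_integral_le_of_norm_le_const (a := 0) (b := 1) (C := K * δ)
    (f := fun t : ℝ => N t (F (t * z, Y (t * z))) - N t (F (t * z, Z (t * z)))) ?_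
  · simpa using this
  · intro t ht
    rw [uIoc_of_le zero_le_one] at ht
    have ht' : t ∈ Icc (0 : ℝ) 1 := ⟨ht.1.le, ht.2⟩
    rw [← map_sub]
    refine ((N t).le_of_opNorm_le (hN1 t ht') _).trans ?_
    rw [one_mul]
    refine (hF.norm_sub_le (hYU t ht') (hZU t ht')).trans ?_
    gcongr
    simpa [Prod.norm_def] using hδ t ht'

theorem norm_singularPicard_sub_const_le {N : ℝ → E →L[ℂ] E}
    (hN1 : ∀ t ∈ Icc (0 : ℝ) 1, ‖N t‖ ≤ 1) {F : ℂ × E → E} {Y₀ : E} {Y : ℂ → E} {z : ℂ} {M : ℝ}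
    (hM : ∀ t ∈ Icc (0 : ℝ) 1, ‖F (t * z, Y (t * z))‖ ≤ M) :
    ‖singularPicard N F Y₀ Y z - Y₀‖ ≤ ‖z‖ * M := by
  rw [singularPicard, add_sub_cancel_left, norm_smul]
  gcongr
  have := intervalIntegral.norm_integral_le_of_norm_le_const (a := 0) (b := 1) (C := M)
    (f := fun t : ℝ => N t (F (t * z, Y (t * z)))) ?_
  · simpa using this
  · intro t ht
    rw [uIoc_of_le zero_le_one] at ht
    have ht' : t ∈ Icc (0 : ℝ) 1 := ⟨ht.1.le, ht.2⟩
    simpa using (N t).le_of_opNorm_le_of_le (hN1 t ht') (hM t ht')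

/-- A continuous solution on a real interval of a singular integral equation with analytic
right-hand side is the restriction of an analytic function. -/
theorem exists_analyticAt_eq_of_singularPicard [CompleteSpace E] {N : ℝ → E →L[ℂ] E}
    (hN : Continuous N)
    (hN1 : ∀ t ∈ Icc (0 : ℝ) 1, ‖N t‖ ≤ 1) {F : ℂ × E → E} {Y₀ : E}
    (hF : AnalyticAt ℂ F (0, Y₀)) {Y : ℝ → E} {δ : ℝ} (hδ : 0 < δ)
    (hYc : ContinuousOn Y (Ico 0 δ)) (hY0 : Y 0 = Y₀)
    (hY : ∀ r ∈ Ico 0 δ, Y r = singularPicard N F Y₀ (fun z => Y z.re) r) :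
    ∃ G : ℂ → E, AnalyticAt ℂ G 0 ∧ ∃ ε > 0, ∀ r ∈ Ico (0 : ℝ) ε, Y r = G r := by
  obtain ⟨K, U, hU, hLip⟩ := hF.contDiffAt.exists_lipschitzOnWith
  have hev : ∀ᶠ p in nhds ((0 : ℂ), Y₀), p ∈ U ∧ DifferentiableAt ℂ F p ∧
      ‖F p‖ < ‖F (0, Y₀)‖ + 1 :=
    (eventually_mem_set.2 hU).and ((hF.eventually_analyticAt.mono
      fun p hp => hp.differentiableAt).and
      (hF.continuousAt.norm.eventually_lt continuousAt_const (lt_add_one _)))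
  obtain ⟨η, hη, hball⟩ := Metric.eventually_nhds_iff_ball.1 hev
  set M := ‖F (0, Y₀)‖ + 1 with hM
  have hMpos : 0 < M := by positivity
  obtain ⟨δ', hδ', hYη⟩ : ∃ δ' > 0, ∀ r ∈ Ico (0 : ℝ) δ', r < δ ∧ ‖Y r - Y₀‖ < η := by
    have h1 : ∀ᶠ r in nhdsWithin (0 : ℝ) (Ico 0 δ), ‖Y r - Y₀‖ < η := by
      have := (hYc 0 ⟨le_rfl, hδ⟩).eventually (Metric.ball_mem_nhds (Y 0) hη)
      filter_upwards [this] with r hr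
      rw [hY0] at hr
      exact mem_ball_iff_norm.1 hr
    rw [eventually_nhdsWithin_iff] at h1
    obtain ⟨d, hd, hdb⟩ := Metric.eventually_nhds_iff_ball.1 h1
    refine ⟨min d δ, lt_min hd hδ, fun r hr => ?_⟩
    have h2 : r < δ := hr.2.trans_le (min_le_right _ _)
    refine ⟨h2, hdb r ?_ ⟨hr.1, h2⟩⟩
    rw [mem_ball_zero_iff, Real.norm_of_nonneg hr.1]
    exact hr.2.trans_le (min_le_left _ _)
  set ρ := min (min η δ') (min (η / (2 * M)) (1 / (2 * (K + 1)))) with hρ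
  have hρpos : 0 < ρ := by positivity
  have hρη : ρ ≤ η := (min_le_left _ _).trans (min_le_left _ _)
  have hρδ : ρ ≤ δ' := (min_le_left _ _).trans (min_le_right _ _)
  have hρM : ρ * M ≤ η / 2 := by
    have : ρ ≤ η / (2 * M) := (min_le_right _ _).trans (min_le_left _ _)
    calc ρ * M ≤ η / (2 * M) * M := by gcongr
      _ = η / 2 := by field_simp
  have hρK : ρ * K ≤ 1 / 2 := by
    have : ρ ≤ 1 / (2 * (K + 1)) := (min_le_right _ _).trans (min_le_right _ _)
    calc ρ * K ≤ 1 / (2 * (K + 1)) * (K + 1) := by gcongr; simp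
      _ = 1 / 2 := by field_simp
  have hstep : ∀ {z : ℂ} {d : ℝ}, z ∈ Metric.ball (0 : ℂ) ρ → 0 ≤ d →
      ‖z‖ * (K * d) ≤ d / 2 := by
    intro z d hz hd
    rw [mem_ball_zero_iff] at hz
    calc ‖z‖ * (K * d) ≤ ρ * (K * d) := by gcongr
      _ = (ρ * K) * d := by ring
      _ ≤ 1 / 2 * d := by gcongr
      _ = d / 2 := by ring
  have hmemη : ∀ {z : ℂ} {y : E}, z ∈ Metric.ball (0 : ℂ) ρ → ‖y - Y₀‖ < η →
      (z, y) ∈ Metric.ball ((0 : ℂ), Y₀) η := by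
    intro z y hz hy
    rw [mem_ball_iff_norm, Prod.norm_def]
    simpa using ⟨(mem_ball_zero_iff.1 hz).trans_le hρη, hy⟩
  set T := singularPicard N F Y₀ with hT
  set G : ℕ → ℂ → E := fun n => T^[n] (fun _ => Y₀) with hG
  have hGs : ∀ n, G (n + 1) = T (G n) := fun n => Function.iterate_succ_apply' _ _ _
  have hGball : ∀ n, DifferentiableOn ℂ (G n) (Metric.ball 0 ρ) ∧
      ∀ z ∈ Metric.ball (0 : ℂ) ρ, ‖G n z - Y₀‖ < η := by
    intro n
    induction n with
    | zero => exact ⟨differentiableOn_const Y₀, fun z _ => by simpa [hG] using hη⟩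
    | succ n ih =>
      rw [hGs]
      constructor
      · have h1 : DifferentiableOn ℂ (fun z => F (z, G n z)) (Metric.ball 0 ρ) := by
          intro z hz
          exact (hball _ (hmemη hz (ih.2 z hz))).2.1.comp_differentiableWithinAt z
            (differentiableWithinAt_id.prodMk (ih.1 z hz))
        exact (differentiableOn_id.smul
          (differentiableOn_integral_comp_ofReal_mul hN h1)).const_add Y₀
      · intro z hz
        have h1 : ‖T (G n) z - Y₀‖ ≤ ‖z‖ * M :=
          norm_singularPicard_sub_const_le hN1 fun t ht => by
            have hz' := ofReal_mul_mem_ball hz ht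
            exact (hball _ (hmemη hz' (ih.2 _ hz'))).2.2.le
        have h2 : ‖z‖ * M ≤ ρ * M := by
          gcongr; exact (mem_ball_zero_iff.1 hz).le
        linarith
  have hseg : ∀ {g : ℂ → E}, ContinuousOn g (Metric.ball 0 ρ) → ∀ z ∈ Metric.ball (0 : ℂ) ρ,
      ContinuousOn (fun t : ℝ => g (t * z)) (Icc 0 1) := fun hg z hz =>
    hg.comp (by fun_prop) fun t ht => ofReal_mul_mem_ball hz ht
  have hGU : ∀ n, ∀ z ∈ Metric.ball (0 : ℂ) ρ, ∀ t ∈ Icc (0 : ℝ) 1,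
      ((t : ℂ) * z, G n (t * z)) ∈ U := fun n z hz t ht => by
    have hz' := ofReal_mul_mem_ball hz ht
    exact (hball _ (hmemη hz' ((hGball n).2 _ hz'))).1
  have hGdiff : ∀ n, ∀ z ∈ Metric.ball (0 : ℂ) ρ, ‖G (n + 1) z - G n z‖ ≤ η * (1 / 2) ^ n := by
    intro n
    induction n with
    | zero => intro z hz; simpa [hG] using ((hGball 1).2 z hz).le
    | succ n ih =>
      intro z hz
      have h : ‖T (G (n + 1)) z - T (G n) z‖ ≤ ‖z‖ * (K * (η * (1 / 2) ^ n)) :=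
        norm_singularPicard_sub_le hN hN1 hLip (hseg (hGball _).1.continuousOn z hz)
          (hseg (hGball _).1.continuousOn z hz) (hGU _ z hz) (hGU _ z hz)
          fun t ht => ih _ (ofReal_mul_mem_ball hz ht)
      rw [← hGs, ← hGs] at h
      refine h.trans ((hstep hz (by positivity)).trans ?_)
      rw [pow_succ]
      linarith
  have hreal : ∀ r ∈ Ico (0 : ℝ) ρ, (r : ℂ) ∈ Metric.ball (0 : ℂ) ρ := by
    intro r hr
    rw [mem_ball_zero_iff, Complex.norm_real, Real.norm_of_nonneg hr.1]
    exact hr.2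
  have hmulmem : ∀ r ∈ Ico (0 : ℝ) ρ, ∀ t ∈ Icc (0 : ℝ) 1, t * r ∈ Ico (0 : ℝ) ρ :=
    fun r hr t ht => ⟨mul_nonneg ht.1 hr.1, (mul_le_of_le_one_left hr.1 ht.2).trans_lt hr.2⟩
  have hYn : ∀ r ∈ Ico (0 : ℝ) ρ, r < δ ∧ ‖Y r - Y₀‖ < η := fun r hr =>
    hYη r ⟨hr.1, hr.2.trans_le hρδ⟩
  have hGY : ∀ n, ∀ r ∈ Ico (0 : ℝ) ρ, ‖G n r - Y r‖ ≤ η * (1 / 2) ^ n := by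
    intro n
    induction n with
    | zero =>
      intro r hr
      rw [norm_sub_rev]
      simpa [hG] using (hYn r hr).2.le
    | succ n ih =>
      intro r hr
      rw [hGs, hY r ⟨hr.1, (hYn r hr).1⟩]
      have hre : ∀ t : ℝ, ((t : ℂ) * r).re = t * r := fun t => by simp
      refine (norm_singularPicard_sub_le hN hN1 hLip
        (hseg (hGball _).1.continuousOn r (hreal r hr)) ?_ (hGU _ r (hreal r hr)) ?_
        fun t ht => ?_).trans ((hstep (hreal r hr) (by positivity : 0 ≤ η * (1 / 2) ^ n)).trans ?_)
      · simp only [hre]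
        refine hYc.comp (by fun_prop) fun t ht => ?_
        exact ⟨(hmulmem r hr t ht).1, (hYn _ (hmulmem r hr t ht)).1⟩
      · intro t ht
        rw [hre]
        exact (hball _ (hmemη (ofReal_mul_mem_ball (hreal r hr) ht)
          (hYn _ (hmulmem r hr t ht)).2)).1
      · rw [hre]
        simpa using ih _ (hmulmem r hr t ht)
      · rw [pow_succ]; linarith
  have hsum : Summable fun n : ℕ => η * (1 / 2 : ℝ) ^ n :=
    summable_geometric_two.mul_left η
  refine ⟨fun z => Y₀ + ∑' n, (G (n + 1) z - G n z), ?_, ρ, hρpos, fun r hr => ?_⟩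
  · have hd : DifferentiableOn ℂ (fun z => ∑' n, (G (n + 1) z - G n z)) (Metric.ball 0 ρ) :=
      Complex.differentiableOn_tsum_of_summable_norm hsum
        (fun n => (hGball (n + 1)).1.sub (hGball n).1) Metric.isOpen_ball hGdiff
    exact (hd.const_add Y₀).analyticAt (Metric.ball_mem_nhds _ hρpos)
  · have h1 : HasSum (fun n => G (n + 1) r - G n r) (∑' n, (G (n + 1) r - G n r)) :=
      (hsum.of_norm_bounded fun n => hGdiff n r (hreal r hr)).hasSum
    have h2 := h1.tendsto_sum_nat
    simp only [Finset.sum_range_sub (fun n => G n (r : ℂ))] at h2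
    have h3 : Tendsto (fun n => G n (r : ℂ)) atTop (nhds (Y r)) := by
      rw [tendsto_iff_norm_sub_tendsto_zero]
      exact squeeze_zero (fun _ => norm_nonneg _) (fun n => hGY n r hr)
        hsum.tendsto_atTop_zero
    have h4 := tendsto_nhds_unique h2 (h3.sub_const (G 0 r))
    have h5 : G 0 (r : ℂ) = Y₀ := rfl
    simp only [h4, h5, add_sub_cancel]

end SingularPicard

/-- Continuous solutions near `0⁺` of `y'' + (k / r) y' = F (r, y, y')` with `y' → 0` and `F`
analytic are restrictions of analytic functions. -/
theorem exists_analyticAt_eq_of_singular_ode {k : ℕ} (hk : k ≠ 0) {F : ℂ × ℂ × ℂ → ℂ} {y₀ : ℂ}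
    (hF : AnalyticAt ℂ F (0, y₀, 0)) {y v : ℝ → ℂ} {δ : ℝ} (hδ : 0 < δ)
    (hy : ContinuousOn y (Ico 0 δ)) (hv : ContinuousOn v (Ico 0 δ)) (hy0 : y 0 = y₀)
    (hv0 : v 0 = 0) (hy' : ∀ r ∈ Ioo 0 δ, HasDerivAt y (v r) r)
    (hv' : ∀ r ∈ Ioo 0 δ, HasDerivAt v (F (r, y r, v r) - k / r * v r) r) :
    ∃ G : ℂ → ℂ × ℂ, AnalyticAt ℂ G 0 ∧ ∃ ε > 0, ∀ r ∈ Ico (0 : ℝ) ε, (y r, v r) = G r := by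
  have hγ : ContinuousOn (fun r : ℝ => ((r : ℂ), y r, v r)) (Ico 0 δ) :=
    Complex.continuous_ofReal.continuousOn.prodMk (hy.prodMk hv)
  obtain ⟨δ', hδ', hδδ', hFc⟩ : ∃ δ' > 0, δ' ≤ δ ∧
      ContinuousOn (fun r : ℝ => F (r, y r, v r)) (Ico 0 δ') := by
    have h0 := hγ 0 ⟨le_rfl, hδ⟩
    rw [ContinuousWithinAt, hy0, hv0, Complex.ofReal_zero] at h0
    have h1 := h0.eventually hF.eventually_continuousAt
    rw [eventually_nhdsWithin_iff] at h1
    obtain ⟨d, hd, hdb⟩ := Metric.eventually_nhds_iff_ball.1 h1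
    refine ⟨min d δ, lt_min hd hδ, min_le_right _ _, fun r hr => ?_⟩
    have h2 : r ∈ Ico 0 δ := ⟨hr.1, hr.2.trans_le (min_le_right _ _)⟩
    have h3 : ContinuousAt F (r, y r, v r) := by
      refine hdb r ?_ h2
      rw [mem_ball_zero_iff, Real.norm_of_nonneg hr.1]
      exact hr.2.trans_le (min_le_left _ _)
    exact ContinuousAt.comp_continuousWithinAt (f := fun r : ℝ => ((r : ℂ), y r, v r)) h3
      ((hγ r h2).mono (Ico_subset_Ico_right (min_le_right _ _)))
  set N : ℝ → ℂ × ℂ →L[ℂ] ℂ × ℂ := fun t =>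
    (ContinuousLinearMap.fst ℂ ℂ ℂ).prod ((t : ℂ) ^ k • ContinuousLinearMap.snd ℂ ℂ ℂ) with hNdef
  have hN : Continuous N := by
    have h1 : Continuous fun t : ℝ => (t : ℂ) ^ k • ContinuousLinearMap.snd ℂ ℂ ℂ := by fun_prop
    exact (ContinuousLinearMap.prodₗᵢ ℂ).continuous.comp (continuous_const.prodMk h1)
  have hN1 : ∀ t ∈ Icc (0 : ℝ) 1, ‖N t‖ ≤ 1 := by
    intro t ht
    refine ContinuousLinearMap.opNorm_le_bound _ zero_le_one fun p => ?_
    simp only [hNdef, ContinuousLinearMap.prod_apply, ContinuousLinearMap.coe_fst',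
      _root_.smul_apply, ContinuousLinearMap.coe_snd', Prod.norm_def, one_mul]
    refine max_le_max le_rfl ?_
    rw [norm_smul, norm_pow, Complex.norm_real, Real.norm_of_nonneg ht.1]
    exact mul_le_of_le_one_left (norm_nonneg _) (pow_le_one₀ ht.1 ht.2)
  have hF' : AnalyticAt ℂ (fun p : ℂ × ℂ × ℂ => (p.2.2, F p)) (0, y₀, 0) :=
    (analyticAt_snd.comp analyticAt_snd).prod hF
  refine exists_analyticAt_eq_of_singularPicard (Y := fun r => (y r, v r)) hN hN1 hF' hδ'
    ((hy.prodMk hv).mono (Ico_subset_Ico_right hδδ')) (by simp [hy0, hv0]) fun r hr => ?_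
  rcases hr.1.eq_or_lt with rfl | hr0
  · simp [singularPicard, hy0, hv0]
  have hmaps : ∀ t ∈ Icc (0 : ℝ) 1, t * r ∈ Ico (0 : ℝ) δ' := fun t ht =>
    ⟨mul_nonneg ht.1 hr.1, (mul_le_of_le_one_left hr.1 ht.2).trans_lt hr.2⟩
  have hcomp : ∀ {g : ℝ → ℂ}, ContinuousOn g (Ico 0 δ') →
      ContinuousOn (fun t => g (t * r)) (Icc 0 1) := fun hg => hg.comp (by fun_prop) hmaps
  have hy₁ := hcomp (hy.mono (Ico_subset_Ico_right hδδ'))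
  have hv₁ := hcomp (hv.mono (Ico_subset_Ico_right hδδ'))
  have hF₁ := hcomp hFc
  have hpow : ContinuousOn (fun t : ℝ => (t : ℂ) ^ k) (Icc 0 1) := by fun_prop
  have hFTC := intervalIntegral.integral_eq_sub_of_hasDerivAt_of_le (a := 0) (b := 1)
    (f := fun t : ℝ => (y (t * r), (t : ℂ) ^ k * v (t * r)))
    (f' := fun t : ℝ => (r : ℂ) • (v (t * r), (t : ℂ) ^ k * F ((t * r : ℝ), y (t * r), v (t * r))))
    zero_le_one (hy₁.prodMk (hpow.mul hv₁)) ?_ ?_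
  · rw [intervalIntegral.integral_smul] at hFTC
    simp only [singularPicard, hNdef, ContinuousLinearMap.prod_apply,
      ContinuousLinearMap.coe_fst', _root_.smul_apply, ContinuousLinearMap.coe_snd',
      smul_eq_mul, Complex.re_mul_ofReal, Complex.ofReal_re]
    push_cast at hFTC
    rw [hFTC]
    simp [hy0, hk]
  · intro t ht
    have hmem : t * r ∈ Ioo 0 δ :=
      ⟨mul_pos ht.1 hr0, (hmaps t ⟨ht.1.le, ht.2.le⟩).2.trans_le hδδ'⟩
    have hlin : HasDerivAt (fun t : ℝ => t * r) r t := by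
      simpa using (hasDerivAt_id t).mul_const r
    have h1 := (hy' _ hmem).scomp t hlin
    have h2 := (hv' _ hmem).scomp t hlin
    have h3 : HasDerivAt (fun t : ℝ => (t : ℂ) ^ k) (k * (t : ℂ) ^ (k - 1)) t :=
      (hasDerivAt_pow k (t : ℂ)).comp_ofReal
    refine (h1.prodMk (h3.mul h2)).congr_deriv ?_
    have ht0 : (t : ℂ) ≠ 0 := Complex.ofReal_ne_zero.2 ht.1.ne'
    have hr0' : (r : ℂ) ≠ 0 := Complex.ofReal_ne_zero.2 hr0.ne'
    obtain ⟨m, rfl⟩ := Nat.exists_eq_succ_of_ne_zero hk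
    ext
    · simp
    · simp only [Complex.real_smul, Function.comp_apply, Nat.succ_sub_one]
      push_cast
      rw [Prod.smul_snd, smul_eq_mul, Nat.succ_eq_add_one, pow_succ]
      field_simp
      ring
  · apply ContinuousOn.intervalIntegrable
    rw [uIcc_of_le zero_le_one]
    exact (hv₁.prodMk (hpow.mul hF₁)).const_smul (r : ℂ)

/-- A function with bounded derivative on `(0, b]` has a limit at `0⁺`. -/
theorem exists_tendsto_nhdsGT_zero_of_abs_deriv_le {f f' : ℝ → ℝ} {b C : ℝ} (hb : 0 < b)
    (hf : ∀ r ∈ Ioc 0 b, HasDerivAt f (f' r) r) (hC : ∀ r ∈ Ioc 0 b, |f' r| ≤ C) :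
    ∃ ℓ, Tendsto f (nhdsWithin 0 (Ioi 0)) (nhds ℓ) := by
  have hC0 : 0 ≤ C := (abs_nonneg _).trans (hC b ⟨hb, le_rfl⟩)
  have hLip : LipschitzOnWith C.toNNReal f (Ioc 0 b) :=
    (convex_Ioc 0 b).lipschitzOnWith_of_nnnorm_hasDerivWithin_le
      (fun r hr => (hf r hr).hasDerivWithinAt) fun r hr => by
        rw [← NNReal.coe_le_coe, coe_nnnorm, Real.coe_toNNReal _ hC0]
        exact hC r hr
  obtain ⟨g, hg, hfg⟩ := hLip.extend_real
  refine ⟨g 0, ((hg.continuous.tendsto 0).mono_left nhdsWithin_le_nhds).congr' ?_⟩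
  filter_upwards [Ioc_mem_nhdsGT hb] with r hr using (hfg hr).symm

/-- Integrating a power bound for the derivative from the limit value at `0⁺`. -/
theorem abs_sub_le_of_abs_deriv_le_mul_pow {f f' : ℝ → ℝ} {b C ℓ : ℝ} {n : ℕ} (hC0 : 0 ≤ C)
    (hf : ∀ r ∈ Ioc 0 b, HasDerivAt f (f' r) r) (hC : ∀ r ∈ Ioc 0 b, |f' r| ≤ C * r ^ n)
    (hℓ : Tendsto f (nhdsWithin 0 (Ioi 0)) (nhds ℓ)) {r : ℝ} (hr : r ∈ Ioc 0 b) :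
    |f r - ℓ| ≤ C * r ^ (n + 1) := by
  have hlim : Tendsto (fun s => |f r - f s|) (nhdsWithin 0 (Ioi 0)) (nhds |f r - ℓ|) :=
    (hℓ.const_sub (f r)).abs
  refine le_of_tendsto hlim ?_
  filter_upwards [Ioc_mem_nhdsGT hr.1] with s hs
  have hsub : Icc s r ⊆ Ioc 0 b := fun x hx => ⟨hs.1.trans_le hx.1, hx.2.trans hr.2⟩
  have h := (convex_Icc s r).norm_image_sub_le_of_norm_hasDerivWithin_le (C := C * r ^ n)
    (fun x hx => (hf x (hsub hx)).hasDerivWithinAt) (fun x hx => ?_)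
    (left_mem_Icc.2 hs.2) (right_mem_Icc.2 hs.2)
  · rw [Real.norm_eq_abs, Real.norm_of_nonneg (sub_nonneg.2 hs.2)] at h
    refine h.trans ?_
    rw [pow_succ, ← mul_assoc]
    exact mul_le_mul_of_nonneg_left (by linarith [hs.1])
      (mul_nonneg hC0 (pow_nonneg hr.1.le n))
  · refine (hC x (hsub hx)).trans ?_
    gcongr
    · exact (hsub hx).1.le
    · exact hx.2

/-- Finite energy selects the regular branch at the origin: if `(ω r⁴ φ')' = O(r⁴ φ)` and
`r² φ`, `r² φ'` are square integrable near `0`, then `φ` has a limit and `φ' → 0` at `0⁺`. -/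
theorem tendsto_deriv_zero_of_finite_energy {ω φ ψ q : ℝ → ℝ} {b C m M : ℝ} (hb : 0 < b)
    (hb1 : b ≤ 1) (hm : 0 < m) (hωm : ∀ r ∈ Ioo 0 b, m ≤ ω r) (hωM : ∀ r ∈ Ioo 0 b, ω r ≤ M)
    (hφ : ∀ r ∈ Ioo 0 b, HasDerivAt φ (ψ r) r)
    (hq : ∀ r ∈ Ioo 0 b, HasDerivAt (fun s => ω s * s ^ 4 * ψ s) (q r) r)
    (hqC : ∀ r ∈ Ioo 0 b, |q r| ≤ C * (r ^ 4 * |φ r|))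
    (hφi : IntegrableOn (fun r => r ^ 4 * φ r ^ 2) (Ioo 0 b))
    (hψi : IntegrableOn (fun r => r ^ 4 * ψ r ^ 2) (Ioo 0 b)) :
    Tendsto ψ (nhdsWithin 0 (Ioi 0)) (nhds 0) ∧
      ∃ ℓ, Tendsto φ (nhdsWithin 0 (Ioi 0)) (nhds ℓ) := by
  obtain ⟨d, hd0, hdb⟩ := exists_between hb
  have hsub : Ioc 0 d ⊆ Ioo 0 b := fun r hr => ⟨hr.1, hr.2.trans_lt hdb⟩
  wlog hC0 : 0 ≤ C generalizing C
  · exact this (C := |C|) (fun r hr => (hqC r hr).trans (by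
      gcongr
      exact le_abs_self C)) (abs_nonneg C)
  set P : ℝ → ℝ := fun s => ω s * s ^ 4 * ψ s with hP
  have hPψ : ∀ r ∈ Ioc 0 d, m * (r ^ 4 * |ψ r|) ≤ |P r| := by
    intro r hr
    rw [hP, abs_mul, abs_mul, abs_of_pos (hm.trans_le (hωm r (hsub hr))),
      abs_of_pos (pow_pos hr.1 4), mul_assoc]
    have := hωm r (hsub hr)
    have := hr.1
    gcongr
  have hφ3 : ∃ A, ∀ r ∈ Ioc 0 d, r ^ 3 * |φ r| ≤ A := by
    set g : ℝ → ℝ := fun r => 7 * (r ^ 4 * φ r ^ 2) + r ^ 4 * ψ r ^ 2 with hg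
    have hgi : IntegrableOn g (Ioo 0 b) := (hφi.const_mul 7).add hψi
    have hgnn : ∀ r, 0 ≤ g r := fun r => by positivity
    refine ⟨1 + (|d ^ 6 * φ d ^ 2| + ∫ r in Ioo 0 b, g r), fun r hr => ?_⟩
    have hIcc : Icc r d ⊆ Ioo 0 b := fun x hx => hsub ⟨hr.1.trans_le hx.1, hx.2⟩
    have hder : ∀ x ∈ Ioo 0 b, HasDerivAt (fun s => -(s ^ 6 * φ s ^ 2))
        (-(6 * x ^ 5 * φ x ^ 2 + x ^ 6 * (2 * φ x * ψ x))) x := fun x hx => by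
      refine (((hasDerivAt_pow 6 x).mul ((hφ x hx).fun_pow 2)).neg).congr_deriv ?_
      push_cast
      ring
    have h1 := intervalIntegral.sub_le_integral_of_hasDeriv_right_of_le
      (g := fun s => -(s ^ 6 * φ s ^ 2)) (φ := g) hr.2
      (fun x hx => (hder x (hIcc hx)).continuousAt.continuousWithinAt)
      (fun x hx => (hder x (hIcc ⟨hx.1.le, hx.2.le⟩)).hasDerivWithinAt)
      (hgi.mono_set hIcc) (fun x hx => ?_)
    · have h2 : ∫ x in r..d, g x ≤ ∫ x in Ioo 0 b, g x := by
        rw [intervalIntegral.integral_of_le hr.2]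
        exact setIntegral_mono_set hgi (.of_forall hgnn)
          (LE.le.eventuallyLE fun x hx => hIcc ⟨hx.1.le, hx.2⟩)
      have h3 := neg_le_abs (d ^ 6 * φ d ^ 2)
      have h4 := le_abs_self (d ^ 6 * φ d ^ 2)
      have h5 : (r ^ 3 * |φ r|) ^ 2 = r ^ 6 * φ r ^ 2 := by rw [mul_pow, sq_abs]; ring
      nlinarith [sq_nonneg (r ^ 3 * |φ r| - 1)]
    · have hx := hIcc ⟨hx.1.le, hx.2.le⟩
      have hx1 : x ≤ 1 := hx.2.le.trans hb1
      have e5 : x ^ 5 ≤ x ^ 4 := pow_le_pow_of_le_one hx.1.le hx1 (by norm_num)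
      have e6 : x ^ 6 ≤ x ^ 4 := pow_le_pow_of_le_one hx.1.le hx1 (by norm_num)
      have e0 : 0 ≤ x ^ 5 := pow_nonneg hx.1.le 5
      have e0' : 0 ≤ x ^ 6 := pow_nonneg hx.1.le 6
      have a1 : 0 ≤ 6 * x ^ 5 * φ x ^ 2 := by positivity
      have a2 : x ^ 6 * (-(2 * φ x * ψ x)) ≤ x ^ 6 * (φ x ^ 2 + ψ x ^ 2) := by
        gcongr; nlinarith [sq_nonneg (φ x + ψ x)]
      have a3 : x ^ 6 * (φ x ^ 2 + ψ x ^ 2) ≤ x ^ 4 * (φ x ^ 2 + ψ x ^ 2) := by gcongr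
      have a4 : 0 ≤ x ^ 4 * φ x ^ 2 := by positivity
      simp only [hg]
      nlinarith
  have hP0 : Tendsto P (nhdsWithin 0 (Ioi 0)) (nhds 0) := by
    obtain ⟨A, hA⟩ := hφ3
    obtain ⟨ℓ, hℓ⟩ := exists_tendsto_nhdsGT_zero_of_abs_deriv_le (C := C * A) hd0
      (fun r hr => hq r (hsub hr)) fun r hr => by
        refine (hqC r (hsub hr)).trans ?_
        have h1 : r ^ 4 * |φ r| ≤ r ^ 3 * |φ r| := mul_le_mul_of_nonneg_right
          (pow_le_pow_of_le_one hr.1.le ((hsub hr).2.le.trans hb1) (by norm_num)) (abs_nonneg _)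
        exact mul_le_mul_of_nonneg_left (h1.trans (hA r hr)) hC0
    rcases eq_or_ne ℓ 0 with rfl | hne
    · exact hℓ
    exfalso
    have hM : 0 < M := hm.trans_le ((hωm d (hsub ⟨hd0, le_rfl⟩)).trans (hωM d (hsub ⟨hd0, le_rfl⟩)))
    have hev : ∀ᶠ r in nhdsWithin (0 : ℝ) (Ioi 0), |ℓ| / 2 < |P r| :=
      hℓ.abs.eventually (lt_mem_nhds (half_lt_self (abs_pos.2 hne)))
    obtain ⟨e, he0, he⟩ := mem_nhdsGT_iff_exists_Ioc_subset.1 hev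
    set e' := min e d with he'
    have he'0 : 0 < e' := lt_min he0 hd0
    have hsub' : Ioc 0 e' ⊆ Ioo 0 b := fun r hr => hsub ⟨hr.1, hr.2.trans (min_le_right _ _)⟩
    have hinv : IntegrableOn (fun r : ℝ => r⁻¹) (Ioc 0 e') := by
      refine ((hψi.mono_set hsub').const_mul ((2 * M / |ℓ|) ^ 2)).mono'
        (by fun_prop) ?_
      filter_upwards [ae_restrict_mem measurableSet_Ioc] with r hr
      have hr0 := hr.1
      have hr' := hsub' hr
      rw [Real.norm_of_nonneg (inv_nonneg.2 hr0.le)]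
      have h1 : |ℓ| / 2 < |P r| := he ⟨hr.1, hr.2.trans (min_le_left _ _)⟩
      have h2 : |P r| ≤ M * (r ^ 4 * |ψ r|) := by
        rw [hP, abs_mul, abs_mul, abs_of_pos (hm.trans_le (hωm r hr')),
          abs_of_pos (pow_pos hr0 4), mul_assoc]
        have := hωM r hr'
        gcongr
      have hℓ0 := abs_pos.2 hne
      have h3 : 1 ≤ (2 * M / |ℓ|) * (r ^ 4 * |ψ r|) := by
        rw [div_mul_eq_mul_div, one_le_div hℓ0]
        linarith
      have h4 : 1 ≤ ((2 * M / |ℓ|) * (r ^ 4 * |ψ r|)) ^ 2 := one_le_pow₀ h3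
      have h5 : ((2 * M / |ℓ|) * (r ^ 4 * |ψ r|)) ^ 2
          = r ^ 4 * ((2 * M / |ℓ|) ^ 2 * (r ^ 4 * ψ r ^ 2)) := by
        rw [mul_pow, mul_pow, sq_abs]; ring
      have h6 : r ^ 4 ≤ r := by
        simpa using pow_le_pow_of_le_one hr0.le (hr'.2.le.trans hb1) (by norm_num : 1 ≤ 4)
      rw [inv_le_iff_one_le_mul₀ hr0]
      refine (h4.trans_eq h5).trans ?_
      rw [mul_comm]
      gcongr
    have := (intervalIntegrable_iff_integrableOn_Ioc_of_le he'0.le).2 hinv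
    rw [intervalIntegrable_inv_iff] at this
    rcases this with h | h
    · exact he'0.ne h
    · exact h left_mem_uIcc
  have hψ_of : ∀ k n : ℕ, k + n = 4 → (∃ A, ∀ r ∈ Ioc 0 d, r ^ k * |φ r| ≤ A) →
      ∃ B, ∀ r ∈ Ioc 0 d, r ^ k * |ψ r| ≤ B * r := by
    rintro k n hkn ⟨A, hA⟩
    have hA0 : 0 ≤ A := (mul_nonneg (pow_nonneg hd0.le k) (abs_nonneg _)).trans
      (hA d ⟨hd0, le_rfl⟩)
    refine ⟨C * A / m, fun r hr => ?_⟩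
    have hr0 := hr.1
    have h1 := abs_sub_le_of_abs_deriv_le_mul_pow (n := n) (mul_nonneg hC0 hA0)
      (fun r hr => hq r (hsub hr)) (fun s hs => ?_) hP0 hr
    · rw [sub_zero] at h1
      have h2 := (hPψ r hr).trans h1
      rw [← hkn, pow_succ, pow_add] at h2
      have h3 : r ^ n * (m * (r ^ k * |ψ r|)) ≤ r ^ n * (C * A * r) := by linarith
      have h4 := le_of_mul_le_mul_left h3 (pow_pos hr0 n)
      rw [div_mul_eq_mul_div, le_div_iff₀ hm]
      linarith
    · refine (hqC s (hsub hs)).trans ?_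
      have h2 : s ^ 4 * |φ s| = s ^ n * (s ^ k * |φ s|) := by rw [← hkn]; ring
      rw [h2, mul_assoc, mul_comm A]
      have := hA s hs
      have := hs.1
      gcongr
  have hstep : ∀ k n : ℕ, k + 1 + n = 4 → (∃ A, ∀ r ∈ Ioc 0 d, r ^ (k + 1) * |φ r| ≤ A) →
      ∃ A, ∀ r ∈ Ioc 0 d, r ^ k * |φ r| ≤ A := by
    intro k n hkn hA
    obtain ⟨B, hB⟩ := hψ_of (k + 1) n hkn hA
    have hB' : ∀ r ∈ Ioc 0 d, r ^ k * |ψ r| ≤ B := fun r hr => by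
      have := hB r hr
      rw [pow_succ, mul_assoc, mul_comm r, ← mul_assoc] at this
      exact le_of_mul_le_mul_right this hr.1
    have hB0 : 0 ≤ B := (mul_nonneg (pow_nonneg hd0.le k) (abs_nonneg _)).trans
      (hB' d ⟨hd0, le_rfl⟩)
    refine ⟨B * d + d ^ k * |φ d|, fun r hr => ?_⟩
    have hr0 := hr.1
    have hrk : 0 < r ^ k := pow_pos hr0 k
    have h := (convex_Icc r d).norm_image_sub_le_of_norm_hasDerivWithin_le (C := B / r ^ k)
      (fun x hx => (hφ x (hsub ⟨hr0.trans_le hx.1, hx.2⟩)).hasDerivWithinAt) (fun x hx => ?_)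
      (right_mem_Icc.2 hr.2) (left_mem_Icc.2 hr.2)
    · have h1 : |φ r| ≤ |φ r - φ d| + |φ d| := by
        simpa using abs_add_le (φ r - φ d) (φ d)
      have h2 : |φ r - φ d| ≤ B / r ^ k * d := by
        refine h.trans ?_
        gcongr
        rw [Real.norm_eq_abs, abs_sub_comm, abs_of_nonneg (sub_nonneg.2 hr.2)]
        linarith
      have h3 : r ^ k * (B / r ^ k * d) = B * d := by field_simp
      have h4 : r ^ k * |φ d| ≤ d ^ k * |φ d| := by
        have := hr.2
        gcongr
      have h5 : r ^ k * |φ r| ≤ r ^ k * (B / r ^ k * d + |φ d|) := by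
        gcongr
        linarith
      rw [mul_add, h3] at h5
      linarith
    · rw [Real.norm_eq_abs, le_div_iff₀ hrk, mul_comm]
      have := hB' x ⟨hr0.trans_le hx.1, hx.2⟩
      have h1 : r ^ k * |ψ x| ≤ x ^ k * |ψ x| := by
        have := hx.1
        gcongr
      linarith
  obtain ⟨B, hB⟩ := hψ_of 0 4 rfl (hstep 0 3 rfl (hstep 1 2 rfl (hstep 2 1 rfl hφ3)))
  simp only [pow_zero, one_mul] at hB
  have hlin : Tendsto (fun r : ℝ => B * r) (nhdsWithin 0 (Ioi 0)) (nhds 0) := by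
    have : Tendsto (fun r : ℝ => B * r) (nhds 0) (nhds (B * 0)) :=
      (continuous_const.mul continuous_id).tendsto 0
    rw [mul_zero] at this
    exact this.mono_left nhdsWithin_le_nhds
  refine ⟨squeeze_zero_norm' ?_ hlin, ?_⟩
  · filter_upwards [Ioc_mem_nhdsGT hd0] with r hr using hB r hr
  · have hB0 : 0 ≤ B := by
      have := (abs_nonneg _).trans (hB d ⟨hd0, le_rfl⟩)
      exact nonneg_of_mul_nonneg_left this hd0
    refine exists_tendsto_nhdsGT_zero_of_abs_deriv_le (C := B * d) hd0
      (fun r hr => hφ r (hsub hr)) fun r hr => (hB r hr).trans ?_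
    have := hr.2
    gcongr

theorem continuousOn_Ico_update_of_tendsto {f : ℝ → ℝ} {δ ℓ : ℝ} (hδ : 0 < δ)
    (hf : ContinuousOn f (Ioo 0 δ)) (hℓ : Tendsto f (nhdsWithin 0 (Ioi 0)) (nhds ℓ)) :
    ContinuousOn (Function.update f 0 ℓ) (Ico 0 δ) := by
  rw [continuousOn_update_iff, Ico_sdiff_left]
  exact ⟨hf, fun _ => by rwa [nhdsWithin_Ioo_eq_nhdsGT hδ]⟩

/-- Real form of `exists_analyticAt_eq_of_singular_ode`, with the initial data given as limits
at `0⁺`. -/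
theorem exists_analyticAt_eq_of_tendsto_of_singular_ode {k : ℕ} (hk : k ≠ 0) {F : ℂ × ℂ × ℂ → ℂ}
    {y v v' : ℝ → ℝ} {δ ℓ : ℝ} (hF : AnalyticAt ℂ F (0, (ℓ : ℂ), 0)) (hδ : 0 < δ)
    (hy : Tendsto y (nhdsWithin 0 (Ioi 0)) (nhds ℓ))
    (hv : Tendsto v (nhdsWithin 0 (Ioi 0)) (nhds 0))
    (hy' : ∀ r ∈ Ioo 0 δ, HasDerivAt y (v r) r) (hv' : ∀ r ∈ Ioo 0 δ, HasDerivAt v (v' r) r)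
    (hode : ∀ r ∈ Ioo 0 δ, (v' r : ℂ) = F (r, y r, v r) - k / r * v r) :
    ∃ G : ℂ → ℂ × ℂ, AnalyticAt ℂ G 0 ∧ G 0 = ((ℓ : ℂ), 0) ∧
      ∃ ε > 0, ∀ r ∈ Ioo (0 : ℝ) ε, (G r).1 = y r ∧ (G r).2 = v r := by
  have hupd : ∀ {f : ℝ → ℝ} {a r : ℝ}, r ∈ Ioo 0 δ → Function.update f 0 a r = f r :=
    fun hr => Function.update_of_ne hr.1.ne' _ _
  have hcongr : ∀ {f : ℝ → ℝ} {a r : ℝ}, r ∈ Ioo 0 δ →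
      Function.update f 0 a =ᶠ[nhds r] f := fun hr => by
    filter_upwards [Ioo_mem_nhds hr.1 hr.2] with s hs using hupd hs
  have hyc := continuousOn_Ico_update_of_tendsto hδ
    (fun r hr => (hy' r hr).continuousAt.continuousWithinAt) hy
  have hvc := continuousOn_Ico_update_of_tendsto hδ
    (fun r hr => (hv' r hr).continuousAt.continuousWithinAt) hv
  obtain ⟨G, hG, ε, hε, hGeq⟩ := exists_analyticAt_eq_of_singular_ode hk hF hδ
    (y := fun r => (Function.update y 0 ℓ r : ℝ)) (v := fun r => (Function.update v 0 0 r : ℝ))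
    (Complex.continuous_ofReal.comp_continuousOn hyc)
    (Complex.continuous_ofReal.comp_continuousOn hvc) (by simp) (by simp)
    (fun r hr => by
      rw [hupd hr]
      exact ((hy' r hr).congr_of_eventuallyEq (hcongr hr)).ofReal_comp)
    (fun r hr => by
      rw [hupd hr, hupd hr, ← hode r hr]
      exact ((hv' r hr).congr_of_eventuallyEq (hcongr hr)).ofReal_comp)
  refine ⟨G, hG, ?_, ε, hε, fun r hr => ?_⟩
  · simpa using (hGeq 0 ⟨le_rfl, hε⟩).symm
  · rw [← hGeq r ⟨hr.1.le, hr.2⟩, Function.update_of_ne hr.1.ne', Function.update_of_ne hr.1.ne']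
    exact ⟨rfl, rfl⟩

/-- A Lane-Emden profile and its derivative are analytic at the origin. -/
theorem exists_analyticAt_eq_laneEmden {α c R : ℝ} (hR : 0 < R) {w : ℝ → ℝ}
    (hw_smooth : ContDiffOn ℝ (⊤ : ℕ∞) w (Ico 0 R)) (hw0 : w 0 = 1)
    (hw_pos : ∀ r, 0 ≤ r → r < R → 0 < w r)
    (hw_ode : ∀ r, 0 < r → r < R →
      deriv (deriv w) r + (2 / r) * deriv w r + c * w r ^ α = 0) :
    ∃ G : ℂ → ℂ × ℂ, AnalyticAt ℂ G 0 ∧ G 0 = (1, 0) ∧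
      ∃ ε > 0, ∀ r ∈ Ioo (0 : ℝ) ε, (G r).1 = w r ∧ (G r).2 = deriv w r := by
  have hU : UniqueDiffOn ℝ (Ico 0 R) := uniqueDiffOn_Ico 0 R
  set D := derivWithin w (Ico 0 R) with hD
  have hDsmooth : ContDiffOn ℝ 1 D (Ico 0 R) :=
    hw_smooth.derivWithin hU (WithTop.coe_le_coe.2 (le_top : (1 + 1 : ℕ∞) ≤ ⊤))
  have hmem : ∀ r ∈ Ioo 0 R, Ico 0 R ∈ nhds r := fun r hr => Ico_mem_nhds hr.1 hr.2
  have hDeq : ∀ r ∈ Ioo 0 R, D r = deriv w r := fun r hr => derivWithin_of_mem_nhds (hmem r hr)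
  have hDev : ∀ r ∈ Ioo 0 R, D =ᶠ[nhds r] deriv w := fun r hr => by
    filter_upwards [Ioo_mem_nhds hr.1 hr.2] with s hs using hDeq s hs
  have hD2eq : ∀ r ∈ Ioo 0 R, derivWithin D (Ico 0 R) r = deriv (deriv w) r := fun r hr => by
    rw [derivWithin_of_mem_nhds (hmem r hr), (hDev r hr).deriv_eq]
  have hmem0 : (0 : ℝ) ∈ Ico 0 R := ⟨le_rfl, hR⟩
  have hnhds : nhdsWithin (0 : ℝ) (Ioi 0) ≤ nhdsWithin 0 (Ico 0 R) := by
    rw [nhdsWithin_Ico_eq_nhdsGE hR]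
    exact nhdsWithin_mono 0 Ioi_subset_Ici_self
  have hev : ∀ᶠ r in nhdsWithin (0 : ℝ) (Ioi 0), r ∈ Ioo 0 R := Ioo_mem_nhdsGT hR
  have hw_lim : Tendsto w (nhdsWithin 0 (Ioi 0)) (nhds 1) := by
    have := (hw_smooth.continuousOn 0 hmem0).mono_left hnhds
    rwa [hw0] at this
  have hD_lim : Tendsto D (nhdsWithin 0 (Ioi 0)) (nhds (D 0)) :=
    (hDsmooth.continuousOn 0 hmem0).mono_left hnhds
  have hD2_lim : Tendsto (derivWithin D (Ico 0 R)) (nhdsWithin 0 (Ioi 0))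
      (nhds (derivWithin D (Ico 0 R) 0)) :=
    (hDsmooth.continuousOn_derivWithin hU le_rfl 0 hmem0).mono_left hnhds
  have hid : Tendsto (fun r : ℝ => r) (nhdsWithin 0 (Ioi 0)) (nhds 0) := nhdsWithin_le_nhds
  have hD0 : D 0 = 0 := by
    have h1 := ((hid.mul hD2_lim).add (hD_lim.const_mul 2)).add
      ((hid.const_mul c).mul (hw_lim.rpow_const (p := α) (Or.inl one_ne_zero)))
    have h2 := h1.congr' (f₂ := fun _ => (0 : ℝ)) (by
      filter_upwards [hev] with r hr
      have h := hw_ode r hr.1 hr.2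
      have hr0 := hr.1.ne'
      rw [hD2eq r hr, hDeq r hr]
      field_simp at h
      linear_combination h)
    have h3 := tendsto_nhds_unique h2 tendsto_const_nhds
    simpa using h3
  have hv : Tendsto (deriv w) (nhdsWithin 0 (Ioi 0)) (nhds 0) := by
    rw [hD0] at hD_lim
    refine hD_lim.congr' ?_
    filter_upwards [hev] with r hr using hDeq r hr
  have hF : AnalyticAt ℂ (fun p : ℂ × ℂ × ℂ => -((c : ℂ) * p.2.1 ^ (α : ℂ)))
      (0, ((1 : ℝ) : ℂ), 0) := by
    have h1 : AnalyticAt ℂ (fun p : ℂ × ℂ × ℂ => p.2.1) (0, ((1 : ℝ) : ℂ), 0) :=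
      analyticAt_fst.comp analyticAt_snd
    exact (analyticAt_const.mul (h1.cpow analyticAt_const (by simp))).neg
  have h := exists_analyticAt_eq_of_tendsto_of_singular_ode (k := 2) two_ne_zero hF hR hw_lim hv
    (v' := deriv (deriv w)) (fun r hr => ?_) (fun r hr => ?_) (fun r hr => ?_)
  · simpa using h
  · exact (((hw_smooth.differentiableOn (by simp)) r ⟨hr.1.le, hr.2⟩).differentiableAt
      (hmem r hr)).hasDerivAt
  · have h1 := ((hDsmooth.differentiableOn one_ne_zero) r ⟨hr.1.le, hr.2⟩).differentiableAt
      (hmem r hr)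
    exact (h1.congr_of_eventuallyEq (hDev r hr).symm).hasDerivAt
  · have h1 := hw_ode r hr.1 hr.2
    have h2 : deriv (deriv w) r = -(c * w r ^ α) - 2 / r * deriv w r := by linarith
    rw [h2, ← Complex.ofReal_cpow (hw_pos r hr.1.le hr.2).le]
    push_cast
    rfl

/-- A real function agreeing on `(0, ε)` with a complex analytic function is there the sum of a
real power series. -/
theorem exists_hasSum_of_analyticAt_eq {g : ℂ → ℂ} (hg : AnalyticAt ℂ g 0) {f : ℝ → ℝ} {ε : ℝ}
    (hε : 0 < ε) (hfg : ∀ r ∈ Ioo (0 : ℝ) ε, g r = f r) :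
    ∃ ε > (0 : ℝ), ∃ a : ℕ → ℝ,
      (∀ r ∈ Ioo (0 : ℝ) ε, HasSum (fun n => a n * r ^ n) (f r)) ∧
      Tendsto f (nhdsWithin 0 (Ioi 0)) (nhds (a 0)) ∧
      (fun r => f r - a 0) =O[nhdsWithin 0 (Ioi 0)] (fun r => r) := by
  obtain ⟨p, hp⟩ := hg
  have hsum := hasFPowerSeriesAt_iff.1 hp
  obtain ⟨d, hd, hdb⟩ := Metric.eventually_nhds_iff_ball.1 hsum
  have ha0 : p.coeff 0 = g 0 := hp.coeff_zero _
  have hO : (fun r => f r - (p.coeff 0).re) =O[nhdsWithin 0 (Ioi 0)] (fun r => r) := by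
    have h1 : (fun z : ℂ => g z - g 0) =O[nhds 0] fun z => z - 0 :=
      hp.analyticAt.differentiableAt.isBigO_sub
    have h2 : Tendsto (fun r : ℝ => (r : ℂ)) (nhdsWithin 0 (Ioi 0)) (nhds 0) := by
      have := Complex.continuous_ofReal.tendsto 0
      rw [Complex.ofReal_zero] at this
      exact this.mono_left nhdsWithin_le_nhds
    have h3 := h1.comp_tendsto h2
    refine IsBigO.trans ?_ (h3.trans ?_)
    · refine IsBigO.of_bound 1 ?_
      filter_upwards [Ioo_mem_nhdsGT hε] with r hr
      rw [one_mul, ha0, Function.comp_apply, hfg r hr]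
      simpa using Complex.abs_re_le_norm ((f r : ℂ) - g 0)
    · exact IsBigO.of_bound 1 (.of_forall fun r => by simp)
  refine ⟨min d ε, lt_min hd hε, fun n => (p.coeff n).re, fun r hr => ?_, ?_, hO⟩
  · have h1 := hdb r (by
      rw [mem_ball_zero_iff, Complex.norm_real, Real.norm_of_nonneg hr.1.le]
      exact hr.2.trans_le (min_le_left _ _))
    rw [zero_add, hfg r ⟨hr.1, hr.2.trans_le (min_le_right _ _)⟩] at h1
    have h2 := Complex.hasSum_re h1
    rw [Complex.ofReal_re] at h2
    refine h2.congr_fun fun n => ?_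
    rw [smul_eq_mul, ← Complex.ofReal_pow, Complex.re_ofReal_mul, mul_comm]
  · have h1 : Tendsto (fun r => f r - (p.coeff 0).re) (nhdsWithin 0 (Ioi 0)) (nhds 0) :=
      hO.trans_tendsto nhdsWithin_le_nhds
    simpa using h1.add_const (p.coeff 0).re

/-- The growing-mode profile `φ₀` coincides near the origin with a convergent
power series; in particular it extends continuously (real-analytically) to `r = 0` and
`φ₀(r) = φ₀(0) + O(r)` as `r → 0⁺`. -/
theorem growingMode_analytic_origin
    (α c R : ℝ) (hα : 3 < α) (hα' : α < 5) (hc : 0 < c) (hR : 0 < R)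
    (w : ℝ → ℝ)
    (hw_cont : ContinuousOn w (Set.Icc 0 R))
    (hw_smooth : ContDiffOn ℝ (⊤ : ℕ∞) w (Set.Ico 0 R))
    (hw0 : w 0 = 1) (hw'0 : deriv w 0 = 0)
    (hw_pos : ∀ r, 0 ≤ r → r < R → 0 < w r)
    (hwR : w R = 0)
    (hw_dec : ∀ r, 0 < r → r < R → deriv w r < 0)
    (hw_pv : ∃ w'R : ℝ, w'R < 0 ∧
      Filter.Tendsto (deriv w) (nhdsWithin R (Set.Iio R)) (nhds w'R))
    (hw_ode : ∀ r, 0 < r → r < R →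
      deriv (deriv w) r + (2 / r) * deriv w r + c * w r ^ α = 0)
    (φ₀ : ℝ → ℝ) (μ₀ : ℝ) (hμ₀ : 0 < μ₀)
    (hφ_smooth : ContDiffOn ℝ (⊤ : ℕ∞) φ₀ (Set.Ioo 0 R))
    (hφ_norm : FiniteNorm α R w φ₀)
    (hφ_eq : ∀ r ∈ Set.Ioo (0:ℝ) R,
      μ₀ * w r ^ α * r ^ 4 * φ₀ r =
        ((1 + α) / α) * deriv (fun s => w s ^ (1 + α) * s ^ 4 * deriv φ₀ s) r
          - (4 - 3 * (1 + α) / α) * deriv (fun s => w s ^ (1 + α)) r * r ^ 3 * φ₀ r) :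
    ∃ ε > (0:ℝ), ∃ a : ℕ → ℝ,
      (∀ r ∈ Set.Ioo (0:ℝ) ε, HasSum (fun n => a n * r ^ n) (φ₀ r)) ∧
      Filter.Tendsto φ₀ (nhdsWithin 0 (Set.Ioi 0)) (nhds (a 0)) ∧
      (fun r => φ₀ r - a 0) =O[nhdsWithin 0 (Set.Ioi 0)] (fun r => r) := by
  have hα0 : 0 < α := by linarith
  have hR0 : ∀ r ∈ Ioo 0 R, 0 < w r := fun r hr => hw_pos r hr.1.le hr.2
  have hwd : ∀ r ∈ Ioo 0 R, HasDerivAt w (deriv w r) r := fun r hr =>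
    (((hw_smooth.differentiableOn (by simp)) r ⟨hr.1.le, hr.2⟩).differentiableAt
      (Ico_mem_nhds hr.1 hr.2)).hasDerivAt
  have hφd : ∀ r ∈ Ioo 0 R, HasDerivAt φ₀ (deriv φ₀ r) r := fun r hr =>
    (((hφ_smooth.differentiableOn (by simp)) r hr).differentiableAt
      (isOpen_Ioo.mem_nhds hr)).hasDerivAt
  have hφ2 : ContDiffOn ℝ 1 (deriv φ₀) (Ioo 0 R) :=
    hφ_smooth.deriv_of_isOpen isOpen_Ioo (WithTop.coe_le_coe.2 (le_top : (1 + 1 : ℕ∞) ≤ ⊤))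
  have hφdd : ∀ r ∈ Ioo 0 R, HasDerivAt (deriv φ₀) (deriv (deriv φ₀) r) r := fun r hr =>
    (((hφ2.differentiableOn one_ne_zero) r hr).differentiableAt
      (isOpen_Ioo.mem_nhds hr)).hasDerivAt
  obtain ⟨G, hG, hG0, ε, hε, hGeq⟩ := exists_analyticAt_eq_laneEmden hR hw_smooth hw0 hw_pos hw_ode
  have hG1 : AnalyticAt ℂ (fun z => (G z).1) 0 := analyticAt_fst.comp hG
  have hG2 : AnalyticAt ℂ (fun z => (G z).2) 0 := analyticAt_snd.comp hG
  have hG10 : (G 0).1 = 1 := by rw [hG0]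
  have hG20 : (G 0).2 = 0 := by rw [hG0]
  set u : ℂ → ℂ := dslope (fun z => (G z).2) 0
  have huan : AnalyticAt ℂ u 0 := by
    obtain ⟨p, hp⟩ := hG2
    exact ⟨_, hp.has_fpower_series_dslope_fslope⟩
  have hueq : ∀ r ∈ Ioo (0 : ℝ) ε, ((deriv w r : ℝ) : ℂ) = r * u r := fun r hr => by
    have h := sub_smul_dslope (fun z => (G z).2) 0 (r : ℂ)
    rw [sub_zero, hG20, sub_zero, (hGeq r hr).2, smul_eq_mul] at h
    exact h.symm
  set κ : ℝ := (1 + α) / α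
  have hκ0 : 0 < κ := by positivity
  set β : ℝ := 4 - 3 * (1 + α) / α
  have hpowd : ∀ r ∈ Ioo 0 R,
      HasDerivAt (fun s => w s ^ (1 + α)) ((1 + α) * w r ^ α * deriv w r) r := fun r hr => by
    refine ((hwd r hr).rpow_const (p := 1 + α) (Or.inl (hR0 r hr).ne')).congr_deriv ?_
    rw [add_sub_cancel_left]
    ring
  set q : ℝ → ℝ := fun r => (1 + α) * w r ^ α * deriv w r * r ^ 4 * deriv φ₀ r
    + w r ^ (1 + α) * (4 * r ^ 3) * deriv φ₀ r + w r ^ (1 + α) * r ^ 4 * deriv (deriv φ₀) r with hq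
  have hPd : ∀ r ∈ Ioo 0 R,
      HasDerivAt (fun s => w s ^ (1 + α) * s ^ 4 * deriv φ₀ s) (q r) r := fun r hr => by
    refine (((hpowd r hr).mul (hasDerivAt_pow 4 r)).mul (hφdd r hr)).congr_deriv ?_
    simp only [hq, Pi.mul_apply]
    push_cast
    ring
  have hqeq : ∀ r ∈ Ioo 0 R, κ * q r =
      w r ^ α * r ^ 4 * φ₀ r * μ₀ + β * ((1 + α) * w r ^ α * deriv w r) * r ^ 3 * φ₀ r :=
    fun r hr => by
      have h := hφ_eq r hr
      rw [(hPd r hr).deriv, (hpowd r hr).deriv] at h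
      linarith
  have hid : Tendsto (fun r : ℝ => (r : ℂ)) (nhdsWithin 0 (Ioi 0)) (nhds 0) := by
    have := Complex.continuous_ofReal.tendsto 0
    rw [Complex.ofReal_zero] at this
    exact this.mono_left nhdsWithin_le_nhds
  have hw_lim : Tendsto w (nhdsWithin 0 (Ioi 0)) (nhds 1) := by
    have h := hw_smooth.continuousOn 0 ⟨le_rfl, hR⟩
    rw [ContinuousWithinAt, hw0, nhdsWithin_Ico_eq_nhdsGE hR] at h
    exact h.mono_left (nhdsWithin_mono 0 Ioi_subset_Ici_self)
  have hpow_lim : ∀ p : ℝ, ∀ᶠ r in nhdsWithin (0 : ℝ) (Ioi 0),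
      1 / 2 ≤ w r ^ p ∧ w r ^ p ≤ 2 := fun p => by
    have h := hw_lim.rpow_const (p := p) (Or.inl one_ne_zero)
    rw [one_rpow] at h
    exact h.eventually (Icc_mem_nhds (by norm_num) (by norm_num))
  set U : ℝ := ‖u 0‖ + 1
  have hU0 : 0 ≤ U := by positivity
  have hu_bound : ∀ᶠ r : ℝ in nhdsWithin (0 : ℝ) (Ioi 0), ‖u r‖ < U :=
    hid.eventually (huan.continuousAt.norm.eventually_lt_const (lt_add_one _))
  obtain ⟨b, hb, hbsub⟩ := mem_nhdsGT_iff_exists_Ioo_subset.1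
    (inter_mem (inter_mem (inter_mem (Ioo_mem_nhdsGT hε) (Ioo_mem_nhdsGT hR))
      (Ioo_mem_nhdsGT one_pos)) (inter_mem (inter_mem (hpow_lim α) (hpow_lim (1 + α))) hu_bound))
  rw [mem_Ioi] at hb
  have hbR : Ioo 0 b ⊆ Ioo 0 R := fun r hr => (hbsub hr).1.1.2
  obtain ⟨d, hd, hdb⟩ := exists_between hb
  have hdsub : Ioo 0 d ⊆ Ioo 0 b := Ioo_subset_Ioo_right hdb.le
  have hd1 : d ≤ 1 := (hbsub ⟨hd, hdb⟩).1.2.2.le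
  have hdR : Ioo 0 d ⊆ Ioo 0 R := hdsub.trans hbR
  have hw'_bound : ∀ r ∈ Ioo 0 d, |deriv w r| ≤ r * U := fun r hr => by
    have h := congrArg norm (hueq r (hbsub (hdsub hr)).1.1.1)
    rw [norm_mul, Complex.norm_real, Complex.norm_real, Real.norm_of_nonneg hr.1.le] at h
    rw [← Real.norm_eq_abs, h]
    exact mul_le_mul_of_nonneg_left (hbsub (hdsub hr)).2.2.le hr.1.le
  have hq_bound : ∀ r ∈ Ioo 0 d,
      |q r| ≤ (2 * μ₀ + |β| * ((1 + α) * 2 * U)) / κ * (r ^ 4 * |φ₀ r|) := fun r hr => by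
    have hr0 := hr.1
    have hW := (hbsub (hdsub hr)).2.1.1.2
    have hW0 : 0 ≤ w r ^ α := (rpow_pos_of_pos (hR0 r (hdR hr)) α).le
    have h1 : κ * |q r| ≤ 2 * r ^ 4 * |φ₀ r| * μ₀
        + |β| * ((1 + α) * 2 * (r * U)) * r ^ 3 * |φ₀ r| := by
      rw [show κ * |q r| = |κ * q r| by rw [abs_mul, abs_of_pos hκ0], hqeq r (hdR hr)]
      refine (abs_add_le _ _).trans (add_le_add ?_ ?_)
      · rw [abs_mul, abs_mul, abs_mul, abs_of_nonneg hW0, abs_of_pos hμ₀,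
          abs_of_pos (pow_pos hr0 4)]
        gcongr
      · rw [abs_mul, abs_mul, abs_mul, abs_mul, abs_mul, abs_of_nonneg hW0,
          abs_of_pos (pow_pos hr0 3), abs_of_pos (by linarith : 0 < 1 + α)]
        have := hw'_bound r hr
        gcongr
    rw [div_mul_eq_mul_div, le_div_iff₀ hκ0]
    linarith
  have hφc : ContinuousOn φ₀ (Ioo 0 d) := hφ_smooth.continuousOn.mono hdR
  have hφ'c : ContinuousOn (deriv φ₀) (Ioo 0 d) := hφ2.continuousOn.mono hdR
  have hint : ∀ {f : ℝ → ℝ} {p : ℝ}, ContinuousOn f (Ioo 0 d) →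
      (∀ r ∈ Ioo 0 d, 1 / 2 ≤ w r ^ p) →
      IntegrableOn (fun r => w r ^ p * r ^ 4 * f r ^ 2) (Ioo 0 R) →
      IntegrableOn (fun r => r ^ 4 * f r ^ 2) (Ioo 0 d) := by
    intro f p hf hp hi
    refine ((hi.mono_set hdR).const_mul 2).mono'
      (ContinuousOn.aestronglyMeasurable (by fun_prop) measurableSet_Ioo) ?_
    filter_upwards [ae_restrict_mem measurableSet_Ioo] with r hr
    have h0 : 0 ≤ r ^ 4 * f r ^ 2 := by positivity
    rw [Real.norm_of_nonneg h0]
    nlinarith [mul_le_mul_of_nonneg_right (hp r hr) h0]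
  obtain ⟨hφ'lim, ℓ, hφlim⟩ := tendsto_deriv_zero_of_finite_energy hd hd1
    (ω := fun r => w r ^ (1 + α)) (M := 2) one_half_pos
    (fun r hr => (hbsub (hdsub hr)).2.1.2.1) (fun r hr => (hbsub (hdsub hr)).2.1.2.2)
    (fun r hr => hφd r (hdR hr)) (fun r hr => hPd r (hdR hr)) hq_bound
    (hint hφc (fun r hr => (hbsub (hdsub hr)).2.1.1.1) hφ_norm.2.2)
    (hint hφ'c (fun r hr => (hbsub (hdsub hr)).2.1.2.1) hφ_norm.1)
  have hF : AnalyticAt ℂ (fun p : ℂ × ℂ × ℂ =>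
      -(1 + α) * (G p.1).2 / (G p.1).1 * p.2.2
        + (μ₀ + β * (1 + α) * u p.1) / (κ * (G p.1).1) * p.2.1) (0, (ℓ : ℂ), 0) := by
    have hfst : AnalyticAt ℂ (fun p : ℂ × ℂ × ℂ => p.1) (0, (ℓ : ℂ), 0) := analyticAt_fst
    have h1 : AnalyticAt ℂ (fun p : ℂ × ℂ × ℂ => (G p.1).1) (0, (ℓ : ℂ), 0) :=
      AnalyticAt.comp (g := fun z => (G z).1) hG1 hfst
    have h2 : AnalyticAt ℂ (fun p : ℂ × ℂ × ℂ => (G p.1).2) (0, (ℓ : ℂ), 0) :=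
      AnalyticAt.comp (g := fun z => (G z).2) hG2 hfst
    have h3 : AnalyticAt ℂ (fun p : ℂ × ℂ × ℂ => u p.1) (0, (ℓ : ℂ), 0) :=
      AnalyticAt.comp (g := u) huan hfst
    have h4 : AnalyticAt ℂ (fun p : ℂ × ℂ × ℂ => p.2.1) (0, (ℓ : ℂ), 0) :=
      analyticAt_fst.comp analyticAt_snd
    have h5 : AnalyticAt ℂ (fun p : ℂ × ℂ × ℂ => p.2.2) (0, (ℓ : ℂ), 0) :=
      analyticAt_snd.comp analyticAt_snd
    have hκ0' : (κ : ℂ) ≠ 0 := Complex.ofReal_ne_zero.2 hκ0.ne'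
    exact (((analyticAt_const.mul h2).div h1 (by simp [hG10])).mul h5).add
      (((analyticAt_const.add (analyticAt_const.mul h3)).div (analyticAt_const.mul h1)
        (by simp [hG10, hκ0'])).mul h4)
  obtain ⟨Φ, hΦ, -, ε', hε', hΦeq⟩ := exists_analyticAt_eq_of_tendsto_of_singular_ode (k := 4)
    (by norm_num) hF hd hφlim hφ'lim (fun r hr => hφd r (hdR hr)) (fun r hr => hφdd r (hdR hr))
    fun r hr => by
      have hrε := (hbsub (hdsub hr)).1.1.1
      have hr0 := hr.1.ne'
      have hw0' := (hR0 r (hdR hr)).ne'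
      have hW0 := (rpow_pos_of_pos (hR0 r (hdR hr)) α).ne'
      have hur : u r = ((deriv w r / r : ℝ) : ℂ) := by
        rw [Complex.ofReal_div, hueq r hrε, mul_div_cancel_left₀ _ (Complex.ofReal_ne_zero.2 hr0)]
      have h1 := hqeq r (hdR hr)
      simp only [hq, rpow_add (hR0 r (hdR hr)), rpow_one] at h1
      have h2 : deriv (deriv φ₀) r = -(1 + α) * deriv w r / w r * deriv φ₀ r
          + (μ₀ + β * (1 + α) * (deriv w r / r)) / (κ * w r) * φ₀ r - 4 / r * deriv φ₀ r := by
        have h3 : w r ^ α * r ^ 3 * (κ * ((1 + α) * deriv w r * r * deriv φ₀ r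
            + w r * 4 * deriv φ₀ r + w r * r * deriv (deriv φ₀) r))
            = w r ^ α * r ^ 3 * (r * φ₀ r * μ₀ + β * (1 + α) * deriv w r * φ₀ r) := by
          linear_combination h1
        have h4 := mul_left_cancel₀ (mul_ne_zero hW0 (pow_ne_zero 3 hr0)) h3
        have hκ0' := hκ0.ne'
        clear_value κ β
        field_simp
        linear_combination h4
      rw [h2, (hGeq r hrε).1, (hGeq r hrε).2, hur]
      push_cast
      ring
  exact exists_hasSum_of_analyticAt_eq (g := fun z => (Φ z).1) (analyticAt_fst.comp hΦ) hε'
    fun r hr => (hΦeq r hr).1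
end
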